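/- arXiv:1404.0861 — 4 statements merged into one kernel-verified Lean document; each statement's English description precedes it below -/
import Mathlib

section
/- (Ennola duality for orders.) Let q be a prime power and n ≥ 1. Then, as integers, |U_n(F_q)| = (−1)^n · (−q)^{n(n-1)/2} · ∏_{i=1}^{n} ((−q)^i − 1); that is, the order of U_n(F_q) is, up to sign, obtained from the order formula |GL_n(F_q)| = q^{n(n-1)/2} ∏_{i=1}^{n}(q^i − 1) by substituting −q for q. -/
section NormFibers

variable {K : Type*} [Field K] [Fintype K] {q : ℕ}

theorem two_le_of_card_eq_sq (hK : Fintype.card K = q ^ 2) : 2 ≤ q := by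
  have := Fintype.one_lt_card (α := K)
  rw [hK] at this
  by_contra h
  interval_cases q <;> simp at this

theorem card_units_of_card_eq_sq (hK : Fintype.card K = q ^ 2) :
    Nat.card Kˣ = (q + 1) * (q - 1) := by
  rw [Nat.card_units, Nat.card_eq_fintype_card, hK]
  simpa using Nat.sq_sub_sq q 1

theorem card_ker_powMonoidHom_add_one (hK : Fintype.card K = q ^ 2) :
    Nat.card (powMonoidHom (q + 1) : Kˣ →* Kˣ).ker = q + 1 := by
  rw [IsCyclic.card_powMonoidHom_ker, card_units_of_card_eq_sq hK]
  exact Nat.gcd_eq_right (Dvd.intro _ rfl)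

theorem range_powMonoidHom_add_one (hK : Fintype.card K = q ^ 2) :
    (powMonoidHom (q + 1) : Kˣ →* Kˣ).range = (powMonoidHom (q - 1) : Kˣ →* Kˣ).ker := by
  have hu := card_units_of_card_eq_sq hK
  apply Subgroup.eq_of_le_of_card_ge
  · rintro _ ⟨u, rfl⟩
    rw [MonoidHom.mem_ker, powMonoidHom_apply, powMonoidHom_apply, ← pow_mul, ← hu]
    exact pow_card_eq_one'
  · rw [IsCyclic.card_powMonoidHom_ker, IsCyclic.card_powMonoidHom_range, hu,
      Nat.gcd_eq_right (Dvd.intro_left _ rfl), Nat.gcd_eq_right (Dvd.intro _ rfl),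
      Nat.mul_div_cancel_left _ (Nat.succ_pos q)]

/-- Every nonzero element of the fixed field of `x ↦ x ^ q` is the norm of exactly `q + 1`
elements. -/
theorem card_pow_add_one_eq (hK : Fintype.card K = q ^ 2) {t : K} (ht0 : t ≠ 0)
    (ht : t ^ q = t) : Nat.card {c : K // c ^ (q + 1) = t} = q + 1 := by
  have hq := two_le_of_card_eq_sq hK
  have hmem : Units.mk0 t ht0 ∈ (powMonoidHom (q + 1) : Kˣ →* Kˣ).range := by
    rw [range_powMonoidHom_add_one hK, MonoidHom.mem_ker, powMonoidHom_apply]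
    ext
    simp only [Units.val_pow_eq_pow_val, Units.val_mk0, Units.val_one]
    apply mul_right_cancel₀ ht0
    rw [← pow_succ, Nat.sub_add_cancel (by omega), ht, one_mul]
  obtain ⟨c₀, hc₀⟩ := hmem
  replace hc₀ : (c₀ : K) ^ (q + 1) = t := by simpa using congrArg Units.val hc₀
  have hmul (u : (powMonoidHom (q + 1) : Kˣ →* Kˣ).ker) :
      ((c₀ : K) * (u.1 : K)) ^ (q + 1) = t := by
    have := congrArg Units.val (MonoidHom.mem_ker.1 u.2)
    simp only [powMonoidHom_apply, Units.val_pow_eq_pow_val, Units.val_one] at this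
    rw [mul_pow, hc₀, this, mul_one]
  refine (Nat.card_congr (Equiv.ofBijective (fun u => ⟨_, hmul u⟩) ⟨?_, ?_⟩)).symm.trans
    (card_ker_powMonoidHom_add_one hK)
  · intro u v h
    exact Subtype.ext (Units.ext (mul_left_cancel₀ c₀.ne_zero (congrArg Subtype.val h)))
  · rintro ⟨c, hc⟩
    have hc0 : c ≠ 0 := by
      rintro rfl
      exact ht0 (by simpa using hc.symm)
    refine ⟨⟨c₀⁻¹ * Units.mk0 c hc0, ?_⟩, by simp⟩
    rw [MonoidHom.mem_ker, powMonoidHom_apply]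
    ext
    simp [mul_pow, hc, hc₀, ht0]

theorem card_pow_add_one_eq_zero {K : Type*} [Field K] {q : ℕ} :
    Nat.card {c : K // c ^ (q + 1) = 0} = 1 := by
  simp

open Classical in
/-- Adding an orthogonal line spanned by a unit vector changes the number of vectors of norm one
in a controlled way. -/
theorem card_norm_eq_one_add (hK : Fintype.card K = q ^ 2) (σ : K →+* K) (hσ : ∀ x, σ x = x ^ q)
    {X Y : Type*} [Finite Y] (f : X → K) (g : Y → K) (hg : ∀ y, σ (g y) = g y)
    (e : X ≃ K × Y) (he : ∀ x, f x = (e x).1 ^ (q + 1) + g (e x).2) :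
    Nat.card {x // f x = 1} + q * Nat.card {y // g y = 1} = (q + 1) * Nat.card Y := by
  have := Fintype.ofFinite Y
  let e' : {x // f x = 1} ≃ Σ y : Y, {c : K // c ^ (q + 1) = 1 - g y} :=
    { toFun := fun x => ⟨(e x).2, (e x).1, by rw [eq_sub_iff_add_eq, ← he, x.2]⟩
      invFun := fun p => ⟨e.symm (p.2, p.1), by
        rw [he, e.apply_symm_apply, p.2.2, sub_add_cancel]⟩
      left_inv := fun x => by simp
      right_inv := fun p => Sigma.subtype_ext (by simp) (by simp) }
  have hfib (y : Y) : Nat.card {c : K // c ^ (q + 1) = 1 - g y} +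
      q * (if g y = 1 then 1 else 0) = q + 1 := by
    split_ifs with h
    · rw [h, sub_self, card_pow_add_one_eq_zero]
      ring
    · rw [card_pow_add_one_eq hK (sub_ne_zero.2 (Ne.symm h))]
      · simp
      · rw [← hσ, map_sub, map_one, hg]
  have hcard : Nat.card {y // g y = 1} = ∑ y, if g y = 1 then 1 else 0 := by
    rw [Nat.card_eq_fintype_card, Fintype.card_subtype, Finset.card_filter]
  rw [Nat.card_congr e', Nat.card_sigma, hcard, Finset.mul_sum, ← Finset.sum_add_distrib,
    Finset.sum_congr rfl fun y _ => hfib y]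
  simp [mul_comm]

end NormFibers

section HermitianForm

variable {K : Type*} [Field K]

/-- The standard sesquilinear form attached to the field endomorphism `σ`. -/
def sesqForm (σ : K →+* K) {n : ℕ} (x y : Fin n → K) : K := ∑ j, x j * σ (y j)

variable {σ : K →+* K} {n : ℕ}

theorem sesqForm_add_left (x y z : Fin n → K) :
    sesqForm σ (x + y) z = sesqForm σ x z + sesqForm σ y z := by
  simp [sesqForm, add_mul, Finset.sum_add_distrib]

theorem sesqForm_sub_left (x y z : Fin n → K) :
    sesqForm σ (x - y) z = sesqForm σ x z - sesqForm σ y z := by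
  simp [sesqForm, sub_mul, Finset.sum_sub_distrib]

theorem sesqForm_smul_left (c : K) (x y : Fin n → K) :
    sesqForm σ (c • x) y = c * sesqForm σ x y := by
  simp [sesqForm, mul_assoc, Finset.mul_sum]

theorem sesqForm_conj (hσσ : ∀ x, σ (σ x) = x) (x y : Fin n → K) :
    σ (sesqForm σ x y) = sesqForm σ y x := by
  simp [sesqForm, map_sum, hσσ, mul_comm]

/-- The family `v` is orthonormal for the standard sesquilinear form. -/
def IsOrthonormalFrame (σ : K →+* K) {n k : ℕ} (v : Fin k → Fin n → K) : Prop :=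
  ∀ i j, sesqForm σ (v i) (v j) = if i = j then 1 else 0

/-- The vectors orthogonal to all members of `v`. -/
abbrev FrameCompl (σ : K →+* K) {n k : ℕ} (v : Fin k → Fin n → K) : Type _ :=
  {x : Fin n → K // ∀ i, sesqForm σ x (v i) = 0}

theorem IsOrthonormalFrame.tail {k : ℕ} {v : Fin (k + 1) → Fin n → K}
    (hv : IsOrthonormalFrame σ v) : IsOrthonormalFrame σ (Fin.tail v) := fun i j => by
  simpa [Fin.tail] using hv i.succ j.succ

theorem isOrthonormalFrame_cons_iff (hσσ : ∀ x, σ (σ x) = x) {k : ℕ} {x : Fin n → K}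
    {v : Fin k → Fin n → K} :
    IsOrthonormalFrame σ (Fin.cons x v : Fin (k + 1) → Fin n → K) ↔
      IsOrthonormalFrame σ v ∧ (∀ i, sesqForm σ x (v i) = 0) ∧ sesqForm σ x x = 1 := by
  constructor
  · intro h
    refine ⟨fun i j => ?_, fun i => ?_, ?_⟩
    · simpa using h i.succ j.succ
    · simpa [Fin.succ_ne_zero, (Fin.succ_ne_zero _).symm] using h 0 i.succ
    · simpa using h 0 0
  · rintro ⟨hv, hx, hxx⟩ i j
    refine Fin.cases ?_ (fun i => ?_) i <;> refine Fin.cases ?_ (fun j => ?_) j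
    · simpa using hxx
    · simpa [(Fin.succ_ne_zero _).symm] using hx j
    · rw [← sesqForm_conj hσσ]
      simp [hx i, Fin.succ_ne_zero]
    · simpa using hv i j

/-- Splitting off the first vector of an orthonormal frame. -/
def frameComplTailEquiv {k : ℕ} {v : Fin (k + 1) → Fin n → K}
    (hv : IsOrthonormalFrame σ v) : FrameCompl σ (Fin.tail v) ≃ K × FrameCompl σ v where
  toFun x := (sesqForm σ x.1 (v 0), ⟨x.1 - sesqForm σ x.1 (v 0) • v 0, fun i => by
    rw [sesqForm_sub_left, sesqForm_smul_left, hv 0 i]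
    refine Fin.cases ?_ (fun i => ?_) i
    · simp
    · simpa [Fin.tail, (Fin.succ_ne_zero _).symm] using x.2 i⟩)
  invFun p := ⟨p.1 • v 0 + p.2.1, fun i => by
    rw [sesqForm_add_left, sesqForm_smul_left, Fin.tail, hv 0 i.succ, p.2.2 i.succ]
    simp [(Fin.succ_ne_zero _).symm]⟩
  left_inv x := by simp
  right_inv p := by
    have h : sesqForm σ (p.1 • v 0 + p.2.1) (v 0) = p.1 := by
      rw [sesqForm_add_left, sesqForm_smul_left, hv 0 0, p.2.2 0]
      simp
    ext
    · exact h
    · simp [h]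

theorem sesqForm_frameComplTailEquiv (hσσ : ∀ x, σ (σ x) = x) {k : ℕ}
    {v : Fin (k + 1) → Fin n → K} (hv : IsOrthonormalFrame σ v) (x : FrameCompl σ (Fin.tail v)) :
    sesqForm σ x.1 x.1 =
      (frameComplTailEquiv hv x).1 * σ (frameComplTailEquiv hv x).1 +
        sesqForm σ (frameComplTailEquiv hv x).2.1 (frameComplTailEquiv hv x).2.1 := by
  obtain ⟨⟨c, y⟩, rfl⟩ := (frameComplTailEquiv hv).symm.surjective x
  rw [Equiv.apply_symm_apply]
  change sesqForm σ (c • v 0 + y.1) (c • v 0 + y.1) = c * σ c + sesqForm σ y.1 y.1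
  have h₁ : sesqForm σ y.1 (c • v 0 + y.1) = sesqForm σ y.1 y.1 := by
    rw [← sesqForm_conj hσσ, sesqForm_add_left, sesqForm_smul_left,
      ← sesqForm_conj hσσ y.1 (v 0), y.2 0]
    simp [sesqForm_conj hσσ]
  have h₂ : sesqForm σ (v 0) (c • v 0 + y.1) = σ c := by
    rw [← sesqForm_conj hσσ, sesqForm_add_left, sesqForm_smul_left, hv 0 0, y.2 0]
    simp
  rw [sesqForm_add_left, sesqForm_smul_left, h₁, h₂]

/-- Splitting off the first coordinate of a vector. -/
theorem sesqForm_self_succ (x : Fin (n + 1) → K) :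
    sesqForm σ x x = x 0 * σ (x 0) + sesqForm σ (Fin.tail x) (Fin.tail x) := by
  simp [sesqForm, Fin.sum_univ_succ, Fin.tail]

variable [Fintype K] {q : ℕ}

theorem card_sesqForm_self_eq_one (hK : Fintype.card K = q ^ 2) (hσ : ∀ x, σ x = x ^ q)
    (hσσ : ∀ x, σ (σ x) = x) (n : ℕ) :
    (q : ℤ) * Nat.card {x : Fin n → K // sesqForm σ x x = 1} =
      (q : ℤ) ^ n * ((q : ℤ) ^ n - (-1) ^ n) := by
  induction n with
  | zero => simp [sesqForm]
  | succ n ih =>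
    have h := card_norm_eq_one_add hK σ hσ (fun x : Fin (n + 1) → K => sesqForm σ x x)
      (fun y : Fin n → K => sesqForm σ y y) (fun y => sesqForm_conj hσσ y y)
      (Fin.consEquiv fun _ => K).symm (fun x => by
        rw [sesqForm_self_succ, hσ, pow_succ']
        rfl)
    rw [Nat.card_fun, Nat.card_eq_fintype_card (α := K), hK, Nat.card_fin] at h
    zify at h
    linear_combination (q : ℤ) * h - (q : ℤ) * ih

theorem card_frameCompl (hK : Fintype.card K = q ^ 2) (hσ : ∀ x, σ x = x ^ q)
    (hσσ : ∀ x, σ (σ x) = x) {k m : ℕ} (hkm : k + m = n) (v : Fin k → Fin n → K)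
    (hv : IsOrthonormalFrame σ v) :
    Nat.card (FrameCompl σ v) = (q ^ 2) ^ m ∧
      (q : ℤ) * Nat.card {x : FrameCompl σ v // sesqForm σ x.1 x.1 = 1} =
        (q : ℤ) ^ m * ((q : ℤ) ^ m - (-1) ^ m) := by
  have hq := two_le_of_card_eq_sq hK
  induction k generalizing m with
  | zero =>
    obtain rfl : m = n := by omega
    let e : FrameCompl σ v ≃ (Fin m → K) := Equiv.subtypeUnivEquiv fun x i => i.elim0
    constructor
    · rw [Nat.card_congr e, Nat.card_fun, Nat.card_eq_fintype_card (α := K), hK, Nat.card_fin]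
    · rw [← card_sesqForm_self_eq_one hK hσ hσσ m,
        Nat.card_congr (e.subtypeEquiv (p := fun x => sesqForm σ x.1 x.1 = 1)
          (q := fun x => sesqForm σ x x = 1) fun x => Iff.rfl)]
  | succ k ih =>
    obtain ⟨h₁, h₂⟩ := ih (m := m + 1) (by omega) (Fin.tail v) hv.tail
    have h := card_norm_eq_one_add hK σ hσ
      (fun x : FrameCompl σ (Fin.tail v) => sesqForm σ x.1 x.1)
      (fun y : FrameCompl σ v => sesqForm σ y.1 y.1) (fun y => sesqForm_conj hσσ y.1 y.1)
      (frameComplTailEquiv hv) (fun x => by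
        rw [sesqForm_frameComplTailEquiv hσσ hv x, hσ, pow_succ'])
    have hc : Nat.card (FrameCompl σ v) = (q ^ 2) ^ m := by
      rw [Nat.card_congr (frameComplTailEquiv hv), Nat.card_prod,
        Nat.card_eq_fintype_card (α := K), hK, pow_succ' (q ^ 2)] at h₁
      exact Nat.eq_of_mul_eq_mul_left (pow_pos (by omega : 0 < q) 2) h₁
    refine ⟨hc, ?_⟩
    rw [hc] at h
    zify at h
    have hq0 : (q : ℤ) ≠ 0 := by omega
    apply mul_left_cancel₀ hq0
    linear_combination (q : ℤ) * h - h₂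

/-- A frame of length `k + 1` is a frame of length `k` together with a unit vector orthogonal
to it. -/
def frameSuccEquiv (hσσ : ∀ x, σ (σ x) = x) (n k : ℕ) :
    {v : Fin (k + 1) → Fin n → K // IsOrthonormalFrame σ v} ≃
      Σ v : {v : Fin k → Fin n → K // IsOrthonormalFrame σ v},
        {x : FrameCompl σ v.1 // sesqForm σ x.1 x.1 = 1} where
  toFun v :=
    have h := (isOrthonormalFrame_cons_iff hσσ (x := v.1 0) (v := Fin.tail v.1)).1
      (by rw [Fin.cons_self_tail]; exact v.2)
    ⟨⟨Fin.tail v.1, h.1⟩, ⟨⟨v.1 0, h.2.1⟩, h.2.2⟩⟩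
  invFun p := ⟨Fin.cons p.2.1.1 p.1.1,
    (isOrthonormalFrame_cons_iff hσσ).2 ⟨p.1.2, p.2.1.2, p.2.2⟩⟩
  left_inv v := by simp
  right_inv p := rfl

theorem card_isOrthonormalFrame (hK : Fintype.card K = q ^ 2) (hσ : ∀ x, σ x = x ^ q)
    (hσσ : ∀ x, σ (σ x) = x) (n k : ℕ) (hk : k ≤ n) :
    (q : ℤ) ^ k * Nat.card {v : Fin k → Fin n → K // IsOrthonormalFrame σ v} =
      ∏ i ∈ Finset.range k, ((q : ℤ) ^ (n - i) * ((q : ℤ) ^ (n - i) - (-1) ^ (n - i))) := by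
  induction k with
  | zero =>
    have : Unique {v : Fin 0 → Fin n → K // IsOrthonormalFrame σ v} :=
      { default := ⟨Fin.elim0, fun i => i.elim0⟩
        uniq := fun v => Subtype.ext (Subsingleton.elim _ _) }
    simp
  | succ k ih =>
    classical
    have := Fintype.ofFinite {v : Fin k → Fin n → K // IsOrthonormalFrame σ v}
    rw [Finset.prod_range_succ, ← ih (by omega), Nat.card_congr (frameSuccEquiv hσσ n k),
      Nat.card_sigma]
    push_cast
    rw [pow_succ, mul_assoc, Finset.mul_sum, Finset.sum_congr rfl fun v _ =>
      (card_frameCompl hK hσ hσσ (m := n - k) (by omega) v.1 v.2).2]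
    simp only [Finset.sum_const, Finset.card_univ, nsmul_eq_mul, Nat.card_eq_fintype_card]
    ring

end HermitianForm

/-- In a field with `q ^ 2` elements, `x ↦ x ^ q` is a ring endomorphism. -/
theorem exists_ringHom_eq_pow {K : Type*} [Field K] [Fintype K] {q : ℕ} (hq : IsPrimePow q)
    (hK : Fintype.card K = q ^ 2) : ∃ σ : K →+* K, ∀ x, σ x = x ^ q := by
  obtain ⟨p, r, hp, -, rfl⟩ := hq
  have : Fact p.Prime := ⟨hp.nat_prime⟩
  rw [← pow_mul] at hK
  have : CharP K p := charP_of_card_eq_prime_pow hK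
  exact ⟨iterateFrobenius K p r, fun x => rfl⟩

theorem prod_ennola (q : ℤ) (n : ℕ) :
    ∏ i ∈ Finset.range n, (q ^ (n - i) * (q ^ (n - i) - (-1) ^ (n - i))) =
      q ^ n * ((-1) ^ n * (-q) ^ (n * (n - 1) / 2) * ∏ i ∈ Finset.Icc 1 n, ((-q) ^ i - 1)) := by
  induction n with
  | zero => simp
  | succ n ih =>
    have hexp : (n + 1) * (n + 1 - 1) / 2 = n * (n - 1) / 2 + n := Nat.triangle_succ n
    have hsq : ((-1 : ℤ) ^ n) * (-1) ^ n = 1 := by rw [← mul_pow]; simp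
    rw [Finset.prod_range_succ', hexp, Finset.prod_Icc_succ_top (by omega)]
    simp only [Nat.add_sub_add_right, Nat.sub_zero]
    rw [ih, pow_add (-q), pow_succ (-q) n, neg_pow q n]
    linear_combination (-q ^ n * q ^ n * q * (-q) ^ (n * (n - 1) / 2) *
      (∏ i ∈ Finset.Icc 1 n, ((-q) ^ i - 1)) * (-1) ^ n * q ^ n * q) * hsq


/-- **Ennola duality for group orders.**
Let `q` be a prime power and `n ≥ 1`. Let `K` be a finite field with `q ^ 2` elements, and
let `σ : x ↦ x ^ q`. Then the order of the finite unitary group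
`U_n(F_q) = {M : M ⬝ (σ M)ᵀ = 1}` equals, as an integer,
`(-1) ^ n * (-q) ^ (n(n-1)/2) * ∏_{i=1}^{n} ((-q) ^ i - 1)`; i.e. it is obtained, up to
sign, from the order formula `|GL_n(F_q)| = q ^ (n(n-1)/2) * ∏ (q ^ i - 1)` by
substituting `-q` for `q`. -/
theorem ennola_duality_card (q n : ℕ) (hq : IsPrimePow q) (hn : 1 ≤ n)
    (K : Type*) [Field K] [Fintype K] (hK : Fintype.card K = q ^ 2) :
    (Nat.card {M : Matrix (Fin n) (Fin n) K //
        M * (M.map fun x => x ^ q).transpose = 1} : ℤ) =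
      (-1 : ℤ) ^ n * (-(q : ℤ)) ^ (n * (n - 1) / 2) *
        ∏ i ∈ Finset.Icc 1 n, ((-(q : ℤ)) ^ i - 1) := by
  obtain ⟨σ, hσ⟩ := exists_ringHom_eq_pow hq hK
  have hσσ (x : K) : σ (σ x) = x := by
    rw [hσ, hσ, ← pow_mul, ← sq, ← hK, FiniteField.pow_card]
  have hq0 : (q : ℤ) ^ n ≠ 0 := pow_ne_zero _ (Int.natCast_ne_zero.2 hq.ne_zero)
  have hiff (M : Matrix (Fin n) (Fin n) K) :
      M * (M.map fun x => x ^ q).transpose = 1 ↔ IsOrthonormalFrame σ M := by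
    simp [← Matrix.ext_iff, Matrix.mul_apply, Matrix.one_apply, IsOrthonormalFrame, sesqForm, hσ]
  apply mul_left_cancel₀ hq0
  rw [← prod_ennola, ← card_isOrthonormalFrame hK hσ hσσ n n le_rfl]
  exact congrArg (fun c : ℕ => (q : ℤ) ^ n * c) (Nat.card_congr (Equiv.subtypeEquivRight hiff))
end

section
/- Let 𝔽 be a finite field with q elements, n ≥ 1, G = GL_n(𝔽), and B ≤ G the subgroup of invertible upper-triangular matrices. Let π be the permutation character of G acting on the coset space G/B, i.e. π(g) is the number of cosets fixed by g. Then the number of irreducible complex characters χ of G with ⟨χ, π⟩ ≠ 0 (equivalently, the number of pairwise non-isomorphic irreducible constituents of Ind_B^G 1) equals the number of partitions of n, i.e. the number of irreducible representations of the Weyl group S_n. -/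
open Matrix CategoryTheory

set_option synthInstance.maxHeartbeats 1000000
set_option maxHeartbeats 1000000

/-- The Borel subgroup of `GL_n(𝔽)` consisting of invertible upper-triangular
matrices. -/
def BorelGL (𝔽 : Type*) [Field 𝔽] (n : ℕ) : Subgroup (GL (Fin n) 𝔽) where
  carrier := {g | Matrix.BlockTriangular (g : Matrix (Fin n) (Fin n) 𝔽) id}
  one_mem' := by simpa using Matrix.blockTriangular_one (α := Fin n)
  mul_mem' := by
    intro a b ha hb
    simpa [Units.val_mul] using Matrix.BlockTriangular.mul ha hb
  inv_mem' := by
    intro a ha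
    haveI : Invertible ((a : Matrix (Fin n) (Fin n) 𝔽)) := a.invertible
    simpa [Matrix.coe_units_inv] using Matrix.blockTriangular_inv_of_blockTriangular ha

/-- The permutation character of `G = GL_n(𝔽)` acting on the coset space `G/B`:
`π(g)` is the number of cosets fixed by `g`. -/
noncomputable def permChar (𝔽 : Type*) [Field 𝔽] (n : ℕ) (g : GL (Fin n) 𝔽) : ℂ :=
  (Nat.card {x : GL (Fin n) 𝔽 ⧸ BorelGL 𝔽 n // g • x = x} : ℂ)

section PowerSeries

open Finset MvPowerSeries

/-- The Cauchy determinant: if `c i j` is an inverse of `1 - x i * y j`, then `det c` is the product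
of the two Vandermonde determinants and of all entries of `c`. -/
theorem det_cauchy {R : Type*} [CommRing R] : ∀ (n : ℕ) (x y : Fin n → R)
    (c : Matrix (Fin n) (Fin n) R), (∀ i j, c i j * (1 - x i * y j) = 1) →
    c.det = (vandermonde x).det * (vandermonde y).det * ∏ i, ∏ j, c i j := by
  intro n
  induction n with
  | zero => intro x y c _; simp
  | succ n ih =>
    intro x y c hc
    have key := ih (fun i => x i.succ) (fun i => y i.succ) (c.submatrix Fin.succ Fin.succ)
      (fun i j => hc i.succ j.succ)
    let M : Matrix (Fin (n + 1)) (Fin (n + 1)) R :=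
      Fin.cons (fun _ => 1) (fun i j => (x i.succ - x 0) * (y j * c i.succ j))
    let M' : Matrix (Fin (n + 1)) (Fin (n + 1)) R :=
      Fin.cons (fun j => if j = 0 then 1 else 0)
        (fun i => Fin.cons ((x i.succ - x 0) * (y 0 * c i.succ 0))
          (fun j => ((x i.succ - x 0) * c i.succ 0) * ((y j.succ - y 0) * c i.succ j.succ)))
    have h1 : c.det = (Matrix.of fun i j => c 0 j * M i j).det := by
      refine Matrix.det_eq_of_forall_row_eq_smul_add_const (fun i => if i = 0 then 0 else 1) 0
        (by simp) ?_
      intro i j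
      refine Fin.cases ?_ (fun i => ?_) i
      · simp [M]
      · simp only [M, Matrix.of_apply, Fin.cons_succ, Fin.cons_zero, Fin.succ_ne_zero, if_false]
        linear_combination (c 0 j) * hc i.succ j - (c i.succ j) * hc 0 j
    have h2 : (Matrix.of fun i j => c 0 j * M i j).det = (∏ j, c 0 j) * M.det :=
      Matrix.det_mul_row _ _
    have h3 : M.det = M'.det := by
      rw [← Matrix.det_transpose M, ← Matrix.det_transpose M']
      refine Matrix.det_eq_of_forall_row_eq_smul_add_const (fun i => if i = 0 then 0 else 1) 0
        (by simp) ?_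
      intro j i
      simp only [Matrix.transpose_apply]
      refine Fin.cases ?_ (fun i => ?_) i
      · refine Fin.cases ?_ (fun j => ?_) j <;> simp [M, M']
      · refine Fin.cases ?_ (fun j => ?_) j
        · simp [M, M']
        · simp only [M, M', Fin.cons_succ, Fin.cons_zero, Fin.succ_ne_zero, if_false]
          linear_combination (x i.succ - x 0) * (y 0 * (c i.succ 0) * hc i.succ j.succ
            - y j.succ * (c i.succ j.succ) * hc i.succ 0)
    have h4 : M'.det = (∏ i : Fin n, (x i.succ - x 0)) * (∏ i : Fin n, c i.succ 0) *
        ((∏ i : Fin n, (y i.succ - y 0)) * (c.submatrix Fin.succ Fin.succ).det) := by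
      rw [Matrix.det_succ_row_zero, Fin.sum_univ_succ]
      simp only [M', Fin.cons_zero, Fin.succ_ne_zero, if_false, mul_zero, zero_mul,
        Finset.sum_const_zero, add_zero, if_true]
      rw [← Finset.prod_mul_distrib, ← Matrix.det_mul_row, ← Matrix.det_mul_column]
      simp [Matrix.submatrix, Matrix.of_apply]
    rw [h1, h2, h3, h4, key, det_vandermonde, det_vandermonde, det_vandermonde, det_vandermonde]
    simp only [Fin.prod_univ_succ, Finset.prod_mul_distrib, Matrix.submatrix_apply]
    simp only [Fin.prod_Ioi_zero, Fin.prod_Ioi_succ]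
    ring

/-- The geometric power series `∑ k, X ^ (k • e)`. -/
noncomputable def geomSeries {σ : Type*} (e : σ →₀ ℕ) : MvPowerSeries σ ℤ :=
  by classical exact fun d => if ∃ k : ℕ, d = k • e then 1 else 0

theorem coeff_geomSeries {σ : Type*} (e d : σ →₀ ℕ) [Decidable (∃ k : ℕ, d = k • e)] :
    coeff d (geomSeries e) = if ∃ k : ℕ, d = k • e then 1 else 0 := by
  change geomSeries e d = _
  unfold geomSeries
  congr

theorem geomSeries_mul {σ : Type*} (e : σ →₀ ℕ) (he : e ≠ 0) :
    geomSeries e * (1 - monomial e 1) = 1 := by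
  classical
  ext d
  rw [mul_sub, mul_one, map_sub, coeff_mul_monomial, coeff_one, coeff_geomSeries,
    coeff_geomSeries, mul_one]
  by_cases hd : d = 0
  · subst hd
    rw [if_pos ⟨0, by simp⟩, if_neg (by simpa using he)]
    simp
  · rw [if_neg hd]
    by_cases h : ∃ k : ℕ, d = k • e
    · obtain ⟨k, rfl⟩ := h
      obtain ⟨k, rfl⟩ : ∃ m, k = m + 1 := Nat.exists_eq_succ_of_ne_zero (by rintro rfl; simp at hd)
      rw [if_pos ⟨_, rfl⟩, if_pos (by rw [add_smul, one_smul]; exact le_add_self),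
        if_pos ⟨k, by rw [add_smul, one_smul, add_tsub_cancel_right]⟩, sub_self]
    · rw [if_neg h, zero_sub, neg_eq_zero]
      split_ifs with h1 h2
      · obtain ⟨k, hk⟩ := h2
        exact absurd ⟨k + 1, by rw [add_smul, one_smul, ← hk, tsub_add_cancel_of_le h1]⟩ h
      · rfl
      · rfl

theorem coeff_prod_geomSeries {σ ι : Type*} [Fintype ι] (e : ι → σ →₀ ℕ) (he : ∀ i, e i ≠ 0)
    (d : σ →₀ ℕ) :
    coeff d (∏ i, geomSeries (e i)) = (Nat.card {k : ι → ℕ // ∑ i, k i • e i = d} : ℤ) := by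
  classical
  rw [coeff_prod]
  simp only [coeff_geomSeries, Finset.prod_ite_zero, Finset.prod_const_one]
  rw [Finset.sum_boole]
  norm_cast
  rw [← Nat.card_eq_finsetCard]
  symm
  refine Nat.card_eq_of_bijective (fun k => ⟨Finsupp.equivFunOnFinite.symm fun i => k.1 i • e i, ?_⟩)
    ⟨?_, ?_⟩
  · rw [Finset.mem_filter, Finset.mem_finsuppAntidiag]
    exact ⟨⟨by simpa using k.2, by simp⟩, fun i _ => ⟨k.1 i, by simp⟩⟩
  · rintro ⟨k, hk⟩ ⟨k', hk'⟩ h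
    ext i
    have := DFunLike.congr_fun (Subtype.ext_iff.1 h) i
    simp only [Finsupp.equivFunOnFinite_symm_apply_apply] at this
    obtain ⟨s, hs⟩ := Finsupp.ne_iff.1 (he i)
    have h2 := DFunLike.congr_fun this s
    simpa [show e i s ≠ 0 by simpa using hs] using h2
  · rintro ⟨l, hl⟩
    rw [Finset.mem_filter, Finset.mem_finsuppAntidiag] at hl
    choose k hk using fun i => hl.2 i (Finset.mem_univ i)
    refine ⟨⟨k, ?_⟩, ?_⟩
    · rw [← hl.1.1]
      exact Finset.sum_congr rfl fun i _ => (hk i).symm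
    · ext i : 2
      simp [hk]

/-- Matrices of natural numbers with prescribed row and column sums. -/
def Contingency {n : ℕ} (α β : Fin n → ℕ) : Type :=
  {m : Fin n → Fin n → ℕ // (∀ i, ∑ j, m i j = α i) ∧ ∀ j, ∑ i, m i j = β j}

/-- The exponent of the monomial `x ^ a * y ^ b`. -/
noncomputable def biExp {n : ℕ} (a b : Fin n → ℕ) : Fin n ⊕ Fin n →₀ ℕ :=
  Finsupp.equivFunOnFinite.symm (Sum.elim a b)

theorem biExp_inj {n : ℕ} {a b a' b' : Fin n → ℕ} :
    biExp a b = biExp a' b' ↔ a = a' ∧ b = b' := by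
  simp [biExp, Sum.elim_eq_iff]

theorem biExp_le {n : ℕ} {a b a' b' : Fin n → ℕ} :
    biExp a b ≤ biExp a' b' ↔ a ≤ a' ∧ b ≤ b' := by
  simp [biExp, Finsupp.le_def, Pi.le_def]

theorem biExp_sub {n : ℕ} (a b a' b' : Fin n → ℕ) :
    biExp a b - biExp a' b' = biExp (a - a') (b - b') := by
  ext s; cases s <;> simp [biExp]

theorem biExp_add {n : ℕ} (a b a' b' : Fin n → ℕ) :
    biExp a b + biExp a' b' = biExp (a + a') (b + b') := by
  ext s; cases s <;> simp [biExp]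

theorem sum_smul_biExp {n : ℕ} {ι : Type*} (s : Finset ι) (k : ι → ℕ) (a b : ι → Fin n → ℕ) :
    ∑ i ∈ s, k i • biExp (a i) (b i) = biExp (∑ i ∈ s, k i • a i) (∑ i ∈ s, k i • b i) := by
  ext t; cases t <;> simp [biExp, Finsupp.finsetSum_apply]

theorem biExp_single_ne_zero {n : ℕ} (i j : Fin n) :
    biExp (Pi.single i 1) (Pi.single j 1) ≠ 0 := by
  intro h
  simpa [biExp] using DFunLike.congr_fun h (Sum.inl i)

theorem coeff_prod_cauchy {n : ℕ} (a b : Fin n → ℕ) :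
    coeff (biExp a b) (∏ i, ∏ j, geomSeries (biExp (Pi.single i 1) (Pi.single j 1))) =
      (Nat.card (Contingency a b) : ℤ) := by
  rw [← Fintype.prod_prod_type' (f := fun i j : Fin n =>
      geomSeries (biExp (Pi.single i 1) (Pi.single j 1))),
    coeff_prod_geomSeries _ (fun p => biExp_single_ne_zero _ _)]
  norm_cast
  refine Nat.card_congr ⟨fun k => ⟨fun i j => k.1 (i, j), ?_⟩,
    fun m => ⟨fun p => m.1 p.1 p.2, ?_⟩, fun _ => rfl, fun _ => rfl⟩
  · have h := k.2
    rw [sum_smul_biExp, biExp_inj] at h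
    constructor
    · intro i
      refine Eq.trans ?_ (congrFun h.1 i)
      simp [Finset.sum_apply, Fintype.sum_prod_type_right, Pi.single_apply]
    · intro j
      refine Eq.trans ?_ (congrFun h.2 j)
      simp [Finset.sum_apply, Fintype.sum_prod_type, Pi.single_apply]
  · rw [sum_smul_biExp, biExp_inj]
    constructor
    · ext i
      rw [← m.2.1 i]
      simp [Finset.sum_apply, Fintype.sum_prod_type, Pi.single_apply]
    · ext i
      rw [← m.2.2 i]
      simp [Finset.sum_apply, Fintype.sum_prod_type, Pi.single_apply]

theorem pi_sum_smul_single {n : ℕ} (f : Fin n → ℕ) :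
    ∑ i, f i • (Pi.single i 1 : Fin n → ℕ) = f := by
  ext j
  simp [Finset.sum_apply, Pi.single_apply]

theorem coeff_prod_diag {n : ℕ} (w : Equiv.Perm (Fin n)) (a b : Fin n → ℕ) :
    coeff (biExp a b) (∏ i, geomSeries (biExp (Pi.single (w i) 1) (Pi.single i 1))) =
      if a ∘ w = b then 1 else 0 := by
  rw [coeff_prod_geomSeries _ (fun p => biExp_single_ne_zero _ _)]
  have key : ∀ k : Fin n → ℕ, ∑ i, k i • biExp (Pi.single (w i) 1) (Pi.single i 1) = biExp a b ↔
      k = a ∘ w ∧ k = b := by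
    intro k
    rw [sum_smul_biExp, biExp_inj]
    have h1 : ∑ i, k i • (Pi.single (w i) 1 : Fin n → ℕ) = k ∘ w.symm := by
      ext j
      simp [Finset.sum_apply, Pi.single_apply, ← Equiv.symm_apply_eq]
    rw [h1, pi_sum_smul_single, Equiv.comp_symm_eq]
  simp_rw [key]
  split_ifs with h
  · simp [h]
  · rw [Nat.cast_eq_zero, Nat.card_eq_zero]
    left
    exact ⟨fun k => h (k.2.1.symm.trans k.2.2)⟩

theorem sum_sign_contingency {n : ℕ} {a b : Fin n → ℕ} (ha : StrictMono a) (hb : StrictMono b) :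
    (∑ w : Equiv.Perm (Fin n), ∑ v : Equiv.Perm (Fin n),
      if (∀ i, (w i : ℕ) ≤ a i) ∧ ∀ i, (v i : ℕ) ≤ b i then
        (Equiv.Perm.sign w : ℤ) * (Equiv.Perm.sign v : ℤ) *
          (Nat.card (Contingency (fun i => a i - w i) (fun i => b i - v i)) : ℤ) else 0) =
      if a = b then 1 else 0 := by
  let c : Matrix (Fin n) (Fin n) (MvPowerSeries (Fin n ⊕ Fin n) ℤ) :=
    fun i j => geomSeries (biExp (Pi.single i 1) (Pi.single j 1))
  let x : Fin n → MvPowerSeries (Fin n ⊕ Fin n) ℤ := fun i => monomial (biExp (Pi.single i 1) 0) 1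
  let y : Fin n → MvPowerSeries (Fin n ⊕ Fin n) ℤ := fun i => monomial (biExp 0 (Pi.single i 1)) 1
  have hc := det_cauchy n x y c (by
    intro i j
    simp only [c, x, y]
    rw [monomial_mul_monomial, mul_one, biExp_add, add_zero, zero_add]
    exact geomSeries_mul _ (biExp_single_ne_zero _ _))
  have hx : (vandermonde x).det = ∑ w : Equiv.Perm (Fin n),
      monomial (biExp (fun i => (w i : ℕ)) 0) (Equiv.Perm.sign w : ℤ) := by
    rw [← Matrix.det_transpose, Matrix.det_apply]
    refine Finset.sum_congr rfl fun w _ => ?_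
    simp only [Matrix.transpose_apply, vandermonde_apply, x, monomial_pow, one_pow, prod_monomial,
      sum_smul_biExp, Finset.prod_const_one, smul_zero, Finset.sum_const_zero]
    rw [Units.smul_def, ← map_zsmul, smul_eq_mul, mul_one, pi_sum_smul_single]
  have hy : (vandermonde y).det = ∑ w : Equiv.Perm (Fin n),
      monomial (biExp 0 (fun i => (w i : ℕ))) (Equiv.Perm.sign w : ℤ) := by
    rw [← Matrix.det_transpose, Matrix.det_apply]
    refine Finset.sum_congr rfl fun w _ => ?_
    simp only [Matrix.transpose_apply, vandermonde_apply, y, monomial_pow, one_pow, prod_monomial,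
      sum_smul_biExp, Finset.prod_const_one, smul_zero, Finset.sum_const_zero]
    rw [Units.smul_def, ← map_zsmul, smul_eq_mul, mul_one, pi_sum_smul_single]

  have h := congrArg (coeff (biExp a b)) hc
  rw [hx, hy, Finset.sum_mul_sum, Finset.sum_mul, map_sum, Matrix.det_apply, map_sum] at h
  simp only [Finset.sum_mul, map_sum, monomial_mul_monomial, coeff_monomial_mul, biExp_add,
    biExp_le, biExp_sub, c, coeff_prod_cauchy, Units.smul_def, map_zsmul, coeff_prod_diag] at h
  rw [Finset.sum_eq_single 1] at h
  · simp only [Equiv.Perm.sign_one, Units.val_one, one_smul, Equiv.Perm.coe_one,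
      Function.comp_id] at h
    refine Eq.trans ?_ (h.symm.trans (if_congr Iff.rfl rfl rfl))
    refine Finset.sum_congr rfl fun w _ => Finset.sum_congr rfl fun v _ => ?_
    simp only [add_zero, zero_add]
    exact if_congr biExp_le.symm rfl rfl
  · intro w _ hw
    rw [if_neg, smul_zero]
    intro hab
    refine hw (Equiv.ext fun i => ?_)
    have hmono : StrictMono w := fun i j hij => by
      rw [← ha.lt_iff_lt]
      have := hb hij
      rwa [← hab] at this
    exact congrFun (hmono.range_inj strictMono_id |>.1 (by simp [w.surjective.range_eq])) i
  · simp

end PowerSeries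
section Characters

open Module

variable (G : Type) [Group G] [Fintype G]

/-- The set of irreducible complex characters of `G`. -/
def irrChars : Set (G → ℂ) :=
  {f | ∃ V : FDRep ℂ G, Simple V ∧ f = V.character}

/-- The symmetric bilinear pairing `(f, f') ↦ |G|⁻¹ ∑ g, f g * f' g⁻¹`. -/
noncomputable def charPairing : (G → ℂ) →ₗ[ℂ] (G → ℂ) →ₗ[ℂ] ℂ :=
  LinearMap.mk₂ ℂ (fun f f' => (Nat.card G : ℂ)⁻¹ * ∑ g, f g * f' g⁻¹)
    (by intro a b c; simp [add_mul, Finset.sum_add_distrib, mul_add])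
    (by
      intro a b c
      simp only [Pi.smul_apply, smul_eq_mul, mul_assoc, ← Finset.mul_sum]
      ring)
    (by intro a b c; simp [Finset.sum_add_distrib, mul_add])
    (by
      intro a b c
      simp only [Pi.smul_apply, smul_eq_mul, mul_left_comm _ a, ← Finset.mul_sum])

variable {G}

theorem charPairing_apply (f f' : G → ℂ) :
    charPairing G f f' = (Nat.card G : ℂ)⁻¹ * ∑ g, f g * f' g⁻¹ := rfl

open scoped Classical in
theorem charPairing_irrChars {χ ψ : G → ℂ} (hχ : χ ∈ irrChars G) (hψ : ψ ∈ irrChars G) :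
    charPairing G χ ψ = if χ = ψ then 1 else 0 := by
  obtain ⟨V, hV, rfl⟩ := hχ
  obtain ⟨W, hW, rfl⟩ := hψ
  have : Invertible (Nat.card G : ℂ) := invertibleOfNonzero (NeZero.ne _)
  have h1 := FDRep.char_orthonormal V W
  rw [charPairing_apply, h1]
  by_cases h : Nonempty (V ≅ W)
  · rw [if_pos h, if_pos (FDRep.char_iso h.some)]
  · rw [if_neg h, if_neg]
    intro heq
    have h2 := FDRep.char_orthonormal V V
    rw [if_pos ⟨Iso.refl V⟩] at h2
    rw [if_neg h, ← heq, h2] at h1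
    exact one_ne_zero h1

theorem character_mem_irrChars {V : Type} [AddCommGroup V] [Module ℂ V] [FiniteDimensional ℂ V]
    (ρ : Representation ℂ G V) [ρ.IsIrreducible] : ρ.character ∈ irrChars G := by
  have : Invertible (Nat.card G : ℂ) := invertibleOfNonzero (NeZero.ne _)
  refine ⟨FDRep.of ρ, ?_, rfl⟩
  rw [FDRep.simple_iff_char_is_norm_one]
  have h := Representation.char_orthonormal ρ ρ
  rw [if_pos ⟨Representation.Equiv.refl ρ⟩, inv_mul_eq_one₀ (NeZero.ne _)] at h
  exact h.symm

theorem character_eq_add_of_isCompl {G V : Type} [Group G] [AddCommGroup V] [Module ℂ V]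
    [FiniteDimensional ℂ V] (ρ : Representation ℂ G V) {σ τ : Subrepresentation ρ}
    (h : IsCompl σ.toSubmodule τ.toSubmodule) :
    ρ.character = σ.toRepresentation.character + τ.toRepresentation.character := by
  ext g
  have : ρ g = (Submodule.prodEquivOfIsCompl _ _ h).conj
      ((σ.toRepresentation g).prodMap (τ.toRepresentation g)) := by
    ext v
    obtain ⟨⟨a, b⟩, rfl⟩ := (Submodule.prodEquivOfIsCompl _ _ h).surjective v
    simp [LinearEquiv.conj_apply, Subrepresentation.toRepresentation]
  simp only [Representation.character, Pi.add_apply]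
  rw [this, LinearMap.trace_conj', LinearMap.trace_prodMap']

theorem character_mem_closure_irrChars (n : ℕ) : ∀ (V : Type) [AddCommGroup V] [Module ℂ V]
    [FiniteDimensional ℂ V] (ρ : Representation ℂ G V), finrank ℂ V = n →
    ρ.character ∈ AddSubgroup.closure (irrChars G) := by
  induction n using Nat.strong_induction_on with
  | _ n ih =>
    intro V _ _ _ ρ hn
    by_cases hirr : ρ.IsIrreducible
    · exact AddSubgroup.subset_closure (character_mem_irrChars ρ)
    rcases subsingleton_or_nontrivial V with hV | hV
    · convert! AddSubgroup.zero_mem _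
      ext g
      simp [Representation.character, Subsingleton.elim (ρ g) 0]
    · obtain ⟨σ, hσ⟩ : ∃ σ : Subrepresentation ρ, σ ≠ ⊥ ∧ σ ≠ ⊤ := by
        by_contra! hcon
        have : Nontrivial (Subrepresentation ρ) := by
          refine ⟨⊥, ⊤, fun h => ?_⟩
          have := congrArg Subrepresentation.toSubmodule h
          exact bot_ne_top (α := Submodule ℂ V) this
        exact hirr ⟨fun σ => or_iff_not_imp_left.2 (hcon σ)⟩
      have : NeZero (Nat.card G : ℂ) := ⟨NeZero.ne _⟩
      obtain ⟨τ, hτ⟩ := exists_isCompl σ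
      have hc : IsCompl σ.toSubmodule τ.toSubmodule := by
        rw [isCompl_iff, disjoint_iff, codisjoint_iff] at hτ ⊢
        exact ⟨congrArg Subrepresentation.toSubmodule hτ.1,
          congrArg Subrepresentation.toSubmodule hτ.2⟩
      have hσ1 : σ.toSubmodule ≠ ⊥ := fun h => hσ.1 (Subrepresentation.toSubmodule_injective h)
      have hσ2 : σ.toSubmodule ≠ ⊤ := fun h => hσ.2 (Subrepresentation.toSubmodule_injective h)
      have hadd := Submodule.finrank_add_eq_of_isCompl hc
      have hpos : 0 < finrank ℂ σ.toSubmodule := by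
        rw [Nat.pos_iff_ne_zero, Ne, Submodule.finrank_eq_zero]
        exact hσ1
      have hlt := Submodule.finrank_lt hσ2
      rw [character_eq_add_of_isCompl ρ hc]
      exact AddSubgroup.add_mem _ (ih _ (by omega) _ _ rfl) (ih _ (by omega) _ _ rfl)

/-- The permutation character of a `G`-set `X`, counting fixed points. -/
noncomputable def fixChar (G X : Type) [Group G] [MulAction G X] (g : G) : ℂ :=
  (Nat.card {x : X // g • x = x} : ℂ)

variable {X Y : Type} [MulAction G X] [Finite X] [MulAction G Y] [Finite Y]

theorem fixChar_inv {G X : Type} [Group G] [MulAction G X] (g : G) : fixChar G X g⁻¹ = fixChar G X g := by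
  unfold fixChar
  congr 1
  refine Nat.card_congr (Equiv.subtypeEquivRight fun x => ?_)
  rw [inv_smul_eq_iff, eq_comm]

/-- The permutation representation of a `G`-set `X`. -/
noncomputable def permRep (G X : Type) [Group G] [MulAction G X] :
    Representation ℂ G (X →₀ ℂ) where
  toFun g := Finsupp.lmapDomain ℂ ℂ (g • ·)
  map_one' := by ext; simp
  map_mul' g h := by ext; simp [mul_smul]

theorem fixChar_mem_closure_irrChars : fixChar G X ∈ AddSubgroup.closure (irrChars G) := by
  classical
  have := Fintype.ofFinite X
  have h := character_mem_closure_irrChars (G := G) _ (X →₀ ℂ) (permRep G X) rfl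
  convert! h using 1
  ext g
  rw [Representation.character, LinearMap.trace_eq_matrix_trace ℂ Finsupp.basisSingleOne,
    Matrix.trace, fixChar]
  simp [LinearMap.toMatrix_apply, permRep, Finsupp.single_apply, Fintype.card_subtype]

theorem charPairing_fixChar :
    charPairing G (fixChar G X) (fixChar G Y) =
      Nat.card (Quotient (MulAction.orbitRel G (X × Y))) := by
  classical
  have := Fintype.ofFinite X
  have := Fintype.ofFinite Y
  have := Fintype.ofFinite (Quotient (MulAction.orbitRel G (X × Y)))
  have h := MulAction.sum_card_fixedBy_eq_card_orbits_mul_card_group G (X × Y)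
  rw [charPairing_apply, inv_mul_eq_iff_eq_mul₀ (NeZero.ne _), mul_comm]
  simp only [Nat.card_eq_fintype_card]
  rw [← Nat.cast_mul, ← h, Nat.cast_sum]
  refine Finset.sum_congr rfl fun g _ => ?_
  rw [fixChar_inv, fixChar, fixChar, ← Nat.cast_mul, ← Nat.card_prod, ← Nat.card_eq_fintype_card]
  congr 1
  refine Nat.card_congr ⟨fun p => ⟨(p.1.1, p.2.1), ?_⟩,
    fun p => (⟨p.1.1, ?_⟩, ⟨p.1.2, ?_⟩), fun _ => rfl, fun _ => rfl⟩
  · exact Prod.ext p.1.2 p.2.2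
  · exact congrArg Prod.fst p.2
  · exact congrArg Prod.snd p.2

/-- The vectors fixed by all elements of a subgroup. -/
noncomputable def fixedVectors {V : Type} [AddCommGroup V] [Module ℂ V] (ρ : Representation ℂ G V)
    (S : Subgroup G) : Submodule ℂ V :=
  Representation.invariants (ρ.comp S.subtype)

theorem fixedVectors_anti {G V : Type} [Group G] [AddCommGroup V] [Module ℂ V]
    (ρ : Representation ℂ G V) {S T : Subgroup G} (h : S ≤ T) :
    fixedVectors ρ T ≤ fixedVectors ρ S :=
  fun _ hv s => hv ⟨s.1, h s.2⟩

theorem sum_subgroup_character {V : Type} [AddCommGroup V] [Module ℂ V] [FiniteDimensional ℂ V]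
    (ρ : Representation ℂ G V) (S : Subgroup G) [Fintype S] :
    ∑ g : S, ρ.character g = (Nat.card S : ℂ) * finrank ℂ (fixedVectors ρ S) := by
  have : Invertible (Nat.card S : ℂ) := invertibleOfNonzero (NeZero.ne _)
  have h := Representation.card_inv_mul_sum_char_eq_finrank (G := S) (ρ.comp S.subtype)
  rw [inv_mul_eq_iff_eq_mul₀ (NeZero.ne _)] at h
  exact h

theorem charPairing_fixChar_ne_zero_iff (V : FDRep ℂ G) :
    charPairing G V.character (fixChar G X) ≠ 0 ↔
      ∃ x : X, fixedVectors V.ρ (MulAction.stabilizer G x) ≠ ⊥ := by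
  classical
  have := Fintype.ofFinite X
  have key : charPairing G V.character (fixChar G X) = (Nat.card G : ℂ)⁻¹ *
      ((∑ x : X, Nat.card (MulAction.stabilizer G x) *
        finrank ℂ (fixedVectors V.ρ (MulAction.stabilizer G x)) : ℕ) : ℂ) := by
    rw [charPairing_apply]
    congr 1
    push_cast
    simp_rw [← sum_subgroup_character, fixChar_inv, fixChar, Nat.card_eq_fintype_card,
      Fintype.card_subtype, ← Finset.sum_boole, Finset.mul_sum]
    rw [Finset.sum_comm]
    refine Finset.sum_congr rfl fun x _ => ?_
    simp only [mul_ite, mul_one, mul_zero]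
    rw [← Finset.sum_filter]
    exact Finset.sum_subtype _ (by simp) _
  rw [key, mul_ne_zero_iff, and_iff_right (inv_ne_zero (NeZero.ne _)), Nat.cast_ne_zero,
    Ne, Finset.sum_eq_zero_iff]
  simp only [Finset.mem_univ, true_imp_iff, mul_eq_zero, Nat.card_pos.ne', false_or,
    Submodule.finrank_eq_zero, not_forall, Ne]

theorem charPairing_fixChar_ne_zero_of_refine (h : ∀ x : X, ∃ y : Y,
    MulAction.stabilizer G y ≤ MulAction.stabilizer G x) {χ : G → ℂ} (hχ : χ ∈ irrChars G)
    (hX : charPairing G χ (fixChar G X) ≠ 0) : charPairing G χ (fixChar G Y) ≠ 0 := by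
  obtain ⟨V, _, rfl⟩ := hχ
  rw [charPairing_fixChar_ne_zero_iff] at hX ⊢
  obtain ⟨x, hx⟩ := hX
  obtain ⟨y, hy⟩ := h x
  exact ⟨y, fun hb => hx (le_bot_iff.1 ((fixedVectors_anti V.ρ hy).trans hb.le))⟩

end Characters
section Lattice

variable {G : Type} [Group G] [Fintype G]

theorem exists_finsupp_of_mem_closure_irrChars {s : G → ℂ}
    (hs : s ∈ AddSubgroup.closure (irrChars G)) :
    ∃ c : irrChars G →₀ ℤ, s = c.sum (fun χ k => k • χ.1) ∧
      charPairing G s s = ((c.sum fun _ k => k ^ 2 : ℤ) : ℂ) := by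
  classical
  rw [← Submodule.span_int_eq_addSubgroupClosure, Submodule.mem_toAddSubgroup] at hs
  have hs' : s ∈ Submodule.span ℤ (Set.range (Subtype.val : irrChars G → G → ℂ)) := by
    rwa [Subtype.range_coe]
  obtain ⟨c, rfl⟩ := Finsupp.mem_span_range_iff_exists_finsupp.1 hs'
  refine ⟨c, rfl, ?_⟩
  simp only [Finsupp.sum, map_sum, LinearMap.sum_apply, map_zsmul, LinearMap.smul_apply]
  push_cast
  refine Finset.sum_congr rfl fun χ hχ => ?_
  rw [Finset.sum_eq_single χ]
  · rw [charPairing_irrChars χ.2 χ.2, if_pos rfl]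
    simp [sq]
  · intro ψ _ hne
    rw [charPairing_irrChars ψ.2 χ.2, if_neg (fun h => hne (Subtype.ext h))]
    simp
  · exact fun h => absurd hχ h

theorem eq_zero_of_charPairing_self {s : G → ℂ} (hs : s ∈ AddSubgroup.closure (irrChars G))
    (h0 : charPairing G s s = 0) : s = 0 := by
  obtain ⟨c, rfl, hc⟩ := exists_finsupp_of_mem_closure_irrChars hs
  rw [hc, Int.cast_eq_zero, Finsupp.sum, Finset.sum_eq_zero_iff_of_nonneg
    (fun _ _ => sq_nonneg _)] at h0
  exact Finset.sum_eq_zero fun χ hχ => by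
    simp [pow_eq_zero_iff two_ne_zero |>.1 (h0 χ hχ)]

theorem eq_or_eq_neg_of_charPairing_self {s : G → ℂ}
    (hs : s ∈ AddSubgroup.closure (irrChars G)) (h1 : charPairing G s s = 1) :
    ∃ χ ∈ irrChars G, s = χ ∨ s = -χ := by
  classical
  obtain ⟨c, rfl, hc⟩ := exists_finsupp_of_mem_closure_irrChars hs
  rw [hc] at h1
  have h2 : ∑ χ ∈ c.support, c χ ^ 2 = 1 := by exact_mod_cast h1
  obtain ⟨χ, hχ⟩ : c.support.Nonempty := by
    rw [Finset.nonempty_iff_ne_empty]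
    intro h
    simp [h] at h2
  rw [← Finset.add_sum_erase _ _ hχ] at h2
  have hpos : ∀ ψ ∈ c.support, 1 ≤ c ψ ^ 2 := fun ψ hψ =>
    Int.add_one_le_iff.2 (sq_pos_of_ne_zero (Finsupp.mem_support_iff.1 hψ))
  have hnn : 0 ≤ ∑ ψ ∈ c.support.erase χ, c ψ ^ 2 := Finset.sum_nonneg fun _ _ => sq_nonneg _
  have hχ1 := hpos χ hχ
  have hempty : c.support.erase χ = ∅ := by
    rw [Finset.eq_empty_iff_forall_notMem]
    intro ψ hψ
    have := Finset.single_le_sum (f := fun ψ => c ψ ^ 2) (fun _ _ => sq_nonneg _) hψ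
    have := hpos ψ (Finset.mem_of_mem_erase hψ)
    linarith
  have hsq : c χ ^ 2 = 1 := by rw [hempty] at h2; simpa using h2
  refine ⟨χ.1, χ.2, ?_⟩
  rw [Finsupp.sum, ← Finset.add_sum_erase _ _ hχ, hempty]
  rcases sq_eq_one_iff.1 hsq with h | h <;> simp [h]

/-- If finitely many elements `h i` of the character lattice span a lattice containing an
orthonormal family of the same size, then the irreducible characters which pair nontrivially with
one of the `h i` are, up to sign, the members of that family. -/
theorem card_constituents_of_orthonormal {ι : Type*} [Fintype ι] [DecidableEq ι] (h s : ι → G → ℂ)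
    (hmem : ∀ i, h i ∈ AddSubgroup.closure (irrChars G))
    (hs : ∀ i, s i ∈ AddSubgroup.closure (Set.range h))
    (horth : ∀ i j, charPairing G (s i) (s j) = if i = j then 1 else 0) (i₀ : ι)
    (hdom : ∀ χ ∈ irrChars G, ∀ i, charPairing G χ (h i) ≠ 0 → charPairing G χ (h i₀) ≠ 0) :
    Nat.card {χ : G → ℂ // χ ∈ irrChars G ∧ charPairing G χ (h i₀) ≠ 0} = Fintype.card ι := by
  classical
  have hs' : ∀ i, s i ∈ AddSubgroup.closure (irrChars G) := fun i =>
    (AddSubgroup.closure_le _).2 (by rintro _ ⟨j, rfl⟩; exact hmem j) (hs i)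
  choose χ hχ hsχ using fun i => eq_or_eq_neg_of_charPairing_self (hs' i) (by simp [horth])
  have hspan_le : ∀ i, s i ∈ Submodule.span ℂ (Set.range h) := fun i =>
    (AddSubgroup.closure_le (Submodule.span ℂ (Set.range h)).toAddSubgroup).2
      Submodule.subset_span (hs i)
  have hlin : LinearIndependent ℂ s := by
    rw [Fintype.linearIndependent_iff]
    intro g hg i
    have := congrArg (fun v => charPairing G v (s i)) hg
    simpa [horth] using this
  have hspan : Submodule.span ℂ (Set.range s) = Submodule.span ℂ (Set.range h) := by
    refine Submodule.eq_of_le_of_finrank_le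
      (Submodule.span_le.2 (by rintro _ ⟨i, rfl⟩; exact hspan_le i)) ?_
    rw [finrank_span_eq_card hlin]
    exact finrank_range_le_card h
  have hne : ∀ i, charPairing G (χ i) (s i) ≠ 0 := by
    intro i
    rcases hsχ i with h | h <;> simp [h, charPairing_irrChars (hχ i) (hχ i)]
  have hwit : ∀ {ψ : G → ℂ} {ι' : Type _} (f : ι' → G → ℂ) {v : G → ℂ},
      v ∈ Submodule.span ℂ (Set.range f) → charPairing G ψ v ≠ 0 →
      ∃ i, charPairing G ψ (f i) ≠ 0 := by
    intro ψ ι' f v hv hψ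
    by_contra! hall
    have : Submodule.span ℂ (Set.range f) ≤ LinearMap.ker (charPairing G ψ) :=
      Submodule.span_le.2 (by rintro _ ⟨i, rfl⟩; exact hall i)
    exact hψ (this hv)
  have hin : ∀ i, charPairing G (χ i) (h i₀) ≠ 0 := by
    intro i
    obtain ⟨j, hj⟩ := hwit h (hspan_le i) (hne i)
    exact hdom _ (hχ i) j hj
  rw [← Nat.card_eq_fintype_card]
  symm
  refine Nat.card_eq_of_bijective (fun i => ⟨χ i, hχ i, hin i⟩) ⟨?_, ?_⟩
  · intro i j hij
    have hij' : χ i = χ j := congrArg Subtype.val hij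
    by_contra hne'
    have h1 := horth i j
    rw [if_neg hne'] at h1
    have h2 := hne i
    rcases hsχ i with h | h <;> rcases hsχ j with h' | h' <;> rw [h] at h1 h2 <;>
      rw [h', ← hij'] at h1 <;> simp_all
  · rintro ⟨ψ, hψ, hψ0⟩
    obtain ⟨i, hi⟩ := hwit s (hspan ▸ Submodule.subset_span ⟨i₀, rfl⟩) hψ0
    refine ⟨i, Subtype.ext ?_⟩
    by_contra hne'
    apply hi
    rcases hsχ i with h | h <;> simp [h, charPairing_irrChars hψ (hχ i), Ne.symm hne']

end Lattice

section AdaptedBasis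

open Module Submodule

variable {K V : Type*} [Field K] [AddCommGroup V] [Module K V]

theorem span_fin_cons_of_adapted {I : Type*} [LinearOrder I] {n : ℕ} {φ : V →ₗ[K] K} {v : V}
    (hv : φ v ≠ 0) (b' : Basis (Fin n) K (LinearMap.ker φ)) (E : I → Submodule K V) (i₀ : I)
    (hmem : ∀ i, i₀ ≤ i → v ∈ E i) (hle : ∀ i, i < i₀ → E i ≤ LinearMap.ker φ)
    (c' : Fin n → I)
    (hspan : ∀ i, (E i).comap (LinearMap.ker φ).subtype = span K (b' '' {k | c' k ≤ i})) (i : I) :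
    E i = span K ((Fin.cons v (fun k => (b' k : V)) : Fin (n + 1) → V) ''
      {k | (Fin.cons i₀ c' : Fin (n + 1) → I) k ≤ i}) := by
  have hmap : (E i ⊓ LinearMap.ker φ) = span K ((fun k => (b' k : V)) '' {k | c' k ≤ i}) := by
    have h := congrArg (Submodule.map (LinearMap.ker φ).subtype) (hspan i)
    rw [Submodule.map_comap_subtype, Submodule.map_span, ← Set.image_comp] at h
    rw [inf_comm]
    exact h
  apply le_antisymm
  · intro x hx
    by_cases hi : i₀ ≤ i
    · have hy : x - (φ x / φ v) • v ∈ E i ⊓ LinearMap.ker φ := by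
        refine ⟨sub_mem hx (smul_mem _ _ (hmem i hi)), ?_⟩
        simp [hv]
      rw [hmap] at hy
      have hx' : x = (φ x / φ v) • v + (x - (φ x / φ v) • v) := by abel
      rw [hx']
      refine add_mem (smul_mem _ _ (subset_span ⟨0, by simpa using hi, by simp⟩)) ?_
      refine span_mono ?_ hy
      rintro _ ⟨k, hk, rfl⟩
      exact ⟨k.succ, by simpa using hk, by simp⟩
    · have hy : x ∈ E i ⊓ LinearMap.ker φ := ⟨hx, hle i (not_le.1 hi) hx⟩
      rw [hmap] at hy
      refine span_mono ?_ hy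
      rintro _ ⟨k, hk, rfl⟩
      exact ⟨k.succ, by simpa using hk, by simp⟩
  · rw [span_le]
    rintro _ ⟨k, hk, rfl⟩
    induction k using Fin.cases with
    | zero => exact hmem i (by simpa using hk)
    | succ k =>
      have : (b' k : V) ∈ E i ⊓ LinearMap.ker φ := by
        rw [hmap]
        exact subset_span ⟨k, by simpa using hk, rfl⟩
      simpa using this.1

theorem exists_basis_span_fin_cons {φ : V →ₗ[K] K} {v : V} (hv : φ v ≠ 0) {n : ℕ}
    (b' : Basis (Fin n) K (LinearMap.ker φ)) :
    ∃ b : Basis (Fin (n + 1)) K V, ⇑b = Fin.cons v (fun k => (b' k : V)) := by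
  refine ⟨Basis.mkFinCons v b' ?_ ?_, Basis.coe_mkFinCons _ _ _ _⟩
  · intro c x hx h
    have := congrArg φ h
    rw [map_add, map_smul, LinearMap.mem_ker.1 hx] at this
    simpa [hv] using this
  · intro z
    refine ⟨-(φ z / φ v), ?_⟩
    simp [hv]

theorem exists_adapted_basis {I J : Type*} [LinearOrder I] [LinearOrder J] [WellFoundedLT I]
    [WellFoundedLT J] (n : ℕ) {K : Type*} [Field K] {V : Type*} [AddCommGroup V] [Module K V]
    [FiniteDimensional K V] (hV : finrank K V = n)
    {F : I → Submodule K V} {F' : J → Submodule K V} (hF : Monotone F) (hF' : Monotone F')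
    (htop : ∃ i, F i = ⊤) (htop' : ∃ j, F' j = ⊤) :
    ∃ (b : Basis (Fin n) K V) (c : Fin n → I) (d : Fin n → J),
      (∀ i, F i = span K (b '' {k | c k ≤ i})) ∧ ∀ j, F' j = span K (b '' {k | d k ≤ j}) := by
  induction n generalizing V with
  | zero =>
    have : Subsingleton V := finrank_zero_iff.1 hV
    exact ⟨Module.finBasisOfFinrankEq K V hV, Fin.elim0, Fin.elim0,
      fun i => Subsingleton.elim _ _, fun j => Subsingleton.elim _ _⟩
  | succ n ih =>
    have hnt : (⊤ : Submodule K V) ≠ ⊥ := by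
      intro h
      have := finrank_top K V
      rw [h, finrank_bot, hV] at this
      omega
    obtain ⟨i₁, hi₁⟩ := htop
    obtain ⟨j₁, hj₁⟩ := htop'
    obtain ⟨i₀, hi₀, hmin⟩ := WellFounded.has_min (wellFounded_lt (α := I)) {i | F i ≠ ⊥}
      ⟨i₁, by simpa [hi₁] using hnt⟩
    obtain ⟨j₀, hj₀, hmin'⟩ := WellFounded.has_min (wellFounded_lt (α := J))
      {j | F i₀ ⊓ F' j ≠ ⊥} ⟨j₁, by simpa [hj₁] using hi₀⟩
    obtain ⟨v, ⟨hvF, hvF'⟩, hv0⟩ := Submodule.exists_mem_ne_zero_of_ne_bot hj₀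
    have hvnot : v ∉ sSup (insert ⊥ (F' '' Set.Iio j₀)) := by
      have hdir : DirectedOn (· ≤ ·) (insert ⊥ (F' '' Set.Iio j₀)) := by
        apply IsChain.directedOn
        apply IsChain.insert
        · rintro _ ⟨x, hx, rfl⟩ _ ⟨y, hy, rfl⟩ _
          rcases le_total x y with h | h
          · exact Or.inl (hF' h)
          · exact Or.inr (hF' h)
        · intro x _ _
          exact Or.inl bot_le
      rw [Submodule.mem_sSup_of_directed (Set.insert_nonempty _ _) hdir]
      rintro ⟨_, rfl | ⟨j, hj, rfl⟩, hx⟩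
      · exact hv0 (by simpa using hx)
      · refine hmin' j (fun h => hv0 ?_) hj
        have hmem : v ∈ F i₀ ⊓ F' j := ⟨hvF, hx⟩
        rwa [h, mem_bot] at hmem
    obtain ⟨φ, hφ, hker⟩ := Submodule.exists_le_ker_of_notMem hvnot
    have hfr : finrank K (LinearMap.ker φ) = n := by
      have h1 := LinearMap.finrank_range_add_finrank_ker φ
      have h2 : LinearMap.range φ = ⊤ := LinearMap.range_eq_top.2
        (LinearMap.surjective (fun h => hφ (by simp [h])))
      rw [h2, finrank_top, finrank_self, hV] at h1
      omega
    obtain ⟨b', c', d', hc, hd⟩ := ih (V := LinearMap.ker φ) hfr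
      (F := fun i => (F i).comap (LinearMap.ker φ).subtype)
      (F' := fun i => (F' i).comap (LinearMap.ker φ).subtype)
      (fun _ _ h => Submodule.comap_mono (hF h)) (fun _ _ h => Submodule.comap_mono (hF' h))
      ⟨i₁, by simp [hi₁]⟩ ⟨j₁, by simp [hj₁]⟩
    obtain ⟨b, hb⟩ := exists_basis_span_fin_cons hφ b'
    refine ⟨b, Fin.cons i₀ c', Fin.cons j₀ d', fun i => ?_, fun j => ?_⟩
    · rw [hb]
      refine span_fin_cons_of_adapted hφ b' F i₀ (fun i h => hF h hvF) (fun i h => ?_) c' hc i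
      have : F i = ⊥ := by
        by_contra hne
        exact hmin i hne h
      simp [this]
    · rw [hb]
      refine span_fin_cons_of_adapted hφ b' F' j₀ (fun i h => hF' h hvF') (fun i h => ?_) d' hd j
      have hmem : F' i ∈ insert ⊥ (F' '' Set.Iio j₀) := Or.inr ⟨i, h, rfl⟩
      exact (le_sSup hmem).trans hker

end AdaptedBasis

section Colorings

open Finset

theorem eq_of_sum_Iic_eq {I : Type*} [PartialOrder I] [LocallyFiniteOrderBot I] [WellFoundedLT I]
    {f g : I → ℕ} (h : ∀ i, ∑ k ∈ Iic i, f k = ∑ k ∈ Iic i, g k) : f = g := by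
  classical
  funext i
  induction i using WellFoundedLT.induction with
  | ind i ih =>
    have hi := h i
    rw [← Iio_insert, sum_insert (by simp), sum_insert (by simp),
      sum_congr rfl (fun k hk => ih k (mem_Iio.1 hk))] at hi
    exact Nat.add_right_cancel hi

theorem card_filter_le_eq_sum {ι I : Type*} [Fintype ι] [PartialOrder I] [DecidableEq I]
    [DecidableLE I] [LocallyFiniteOrderBot I] (c : ι → I) (i : I) :
    #{k | c k ≤ i} = ∑ j ∈ Iic i, #{k | c k = j} := by
  rw [card_eq_sum_card_fiberwise (f := c) (t := Iic i) (fun k hk => by simpa using hk)]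
  refine sum_congr rfl fun j hj => ?_
  congr 1
  ext k
  simp only [mem_filter, mem_univ, true_and, mem_Iic] at hj ⊢
  exact ⟨fun h => h.2, fun h => ⟨h ▸ hj, h⟩⟩

theorem exists_perm_of_card_fiber_eq {ι I : Type*} [Fintype ι] [DecidableEq I] {c c' : ι → I}
    (h : ∀ i, #{k | c k = i} = #{k | c' k = i}) : ∃ σ : Equiv.Perm ι, ∀ k, c' (σ k) = c k := by
  have e : ∀ i, {k // c k = i} ≃ {k // c' k = i} := fun i => Fintype.equivOfCardEq (by
    rw [Fintype.card_subtype, Fintype.card_subtype, h i])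
  let σ : Equiv.Perm ι :=
    (Equiv.sigmaFiberEquiv c).symm.trans
      ((Equiv.sigmaCongrRight fun i => (e i)).trans (Equiv.sigmaFiberEquiv c'))
  exact ⟨σ, fun k => (e (c k) ⟨k, rfl⟩).2⟩

end Colorings

section Coordinates

open Module Submodule

variable {K V ι : Type*} [Field K] [AddCommGroup V] [Module K V]

theorem span_image_inf_span_image (b : Basis ι K V) (S T : Set ι) :
    span K (b '' S) ⊓ span K (b '' T) = span K (b '' (S ∩ T)) := by
  ext x
  simp only [mem_inf, b.mem_span_image, Set.subset_inter_iff]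

theorem finrank_span_image [Fintype ι] (b : Basis ι K V) (p : ι → Prop) [DecidablePred p] :
    finrank K (span K (b '' {k | p k})) = (Finset.univ.filter p).card := by
  have h : b '' {k | p k} = Set.range (fun k : {k // p k} => b k) := by
    rw [Set.image_eq_range]; rfl
  rw [h, ← Fintype.card_subtype]
  exact finrank_span_eq_card (b.linearIndependent.comp _ Subtype.val_injective)

end Coordinates

section Flags

open Module Submodule

variable (K : Type) [Field K] (n : ℕ)

/-- `GL_n(K)` as the group of linear automorphisms of `K^n`. -/
noncomputable def glEquiv : GL (Fin n) K ≃* ((Fin n → K) ≃ₗ[K] (Fin n → K)) :=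
  GeneralLinearGroup.toLin.trans (LinearMap.GeneralLinearGroup.generalLinearEquiv K (Fin n → K))

theorem glEquiv_apply (g : GL (Fin n) K) (v : Fin n → K) :
    glEquiv K n g v = (g : Matrix (Fin n) (Fin n) K) *ᵥ v := rfl

/-- Flags of subspaces of `K^n` whose successive quotients have dimensions `α`. -/
def FlagType (α : Fin n → ℕ) : Type :=
  {F : Fin n → Submodule K (Fin n → K) //
    Monotone F ∧ ∀ i, finrank K (F i) = ∑ k ∈ Finset.Iic i, α k}

variable {K n}

noncomputable instance (α : Fin n → ℕ) : MulAction (GL (Fin n) K) (FlagType K n α) where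
  smul g F := ⟨fun i => (F.1 i).map (glEquiv K n g : (Fin n → K) →ₗ[K] (Fin n → K)),
    fun _ _ h => Submodule.map_mono (F.2.1 h), fun i => by
      rw [LinearEquiv.finrank_map_eq]; exact F.2.2 i⟩
  one_smul F := by
    apply Subtype.ext
    funext i
    change (F.1 i).map ((glEquiv K n 1 : _ ≃ₗ[K] _) : (Fin n → K) →ₗ[K] (Fin n → K)) = _
    rw [map_one]
    exact Submodule.map_id _
  mul_smul g g' F := by
    apply Subtype.ext
    funext i
    change (F.1 i).map ((glEquiv K n (g * g') : _ ≃ₗ[K] _) : (Fin n → K) →ₗ[K] (Fin n → K)) = _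
    rw [map_mul]
    exact Submodule.map_comp _ _ _

theorem FlagType.smul_val {α : Fin n → ℕ} (g : GL (Fin n) K) (F : FlagType K n α) (i : Fin n) :
    (g • F).1 i = (F.1 i).map (glEquiv K n g : (Fin n → K) →ₗ[K] (Fin n → K)) := rfl

instance [Finite K] (α : Fin n → ℕ) : Finite (FlagType K n α) := by
  have : Finite (Submodule K (Fin n → K)) :=
    Finite.of_injective (fun p => (p : Set (Fin n → K))) SetLike.coe_injective
  unfold FlagType
  infer_instance

/-- The basis `b`, coloured by `c`, is adapted to the filtration `F`. -/
def Adapted {I : Type*} [LE I] (b : Basis (Fin n) K (Fin n → K)) (c : Fin n → I)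
    (F : I → Submodule K (Fin n → K)) : Prop :=
  ∀ i, F i = span K (b '' {k | c k ≤ i})

theorem FlagType.card_fiber {α : Fin n → ℕ} (F : FlagType K n α)
    {b : Basis (Fin n) K (Fin n → K)} {c : Fin n → Fin n} (h : Adapted b c F.1) (i : Fin n) :
    (Finset.univ.filter fun k => c k = i).card = α i := by
  refine congrFun (eq_of_sum_Iic_eq (f := fun i => (Finset.univ.filter fun k => c k = i).card)
    fun i => ?_) i
  rw [← card_filter_le_eq_sum, ← F.2.2 i, h i, finrank_span_image]

/-- The flag spanned by a coloured basis. -/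
def FlagType.ofBasis {α : Fin n → ℕ} (b : Basis (Fin n) K (Fin n → K)) (c : Fin n → Fin n)
    (hc : ∀ i, (Finset.univ.filter fun k => c k = i).card = α i) : FlagType K n α :=
  ⟨fun i => span K (b '' {k | c k ≤ i}),
    fun _ _ h => span_mono (Set.image_mono fun _ hk => le_trans hk h), fun i => by
      rw [finrank_span_image, card_filter_le_eq_sum]
      exact Finset.sum_congr rfl fun j _ => hc j⟩

theorem FlagType.exists_eq_top (hn : 1 ≤ n) {α : Fin n → ℕ} (hα : ∑ i, α i = n)
    (F : FlagType K n α) : ∃ i, F.1 i = ⊤ := by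
  refine ⟨⟨n - 1, by omega⟩, eq_top_of_finrank_eq ?_⟩
  rw [F.2.2, finrank_fin_fun]
  refine Eq.trans ?_ hα
  congr 1
  ext k
  simp only [Finset.mem_Iic, Finset.mem_univ, iff_true]
  exact Fin.mk_le_mk.2 (by omega)

theorem FlagType.exists_adapted (hn : 1 ≤ n) {α β : Fin n → ℕ} (hα : ∑ i, α i = n)
    (hβ : ∑ i, β i = n) (F : FlagType K n α) (F' : FlagType K n β) :
    ∃ (b : Basis (Fin n) K (Fin n → K)) (c d : Fin n → Fin n),
      Adapted b c F.1 ∧ Adapted b d F'.1 :=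
  exists_adapted_basis n (finrank_fin_fun K) F.2.1 F'.2.1 (F.exists_eq_top hn hα)
    (F'.exists_eq_top hn hβ)

theorem Adapted.smul {α : Fin n → ℕ} {b : Basis (Fin n) K (Fin n → K)} {c : Fin n → Fin n}
    {F : FlagType K n α} (h : Adapted b c F.1) (g : GL (Fin n) K) :
    Adapted (b.map (glEquiv K n g)) c (g • F).1 := by
  intro i
  rw [FlagType.smul_val, h i, Submodule.map_span, ← Set.image_comp]
  rfl

theorem exists_gl_map_basis (b b' : Basis (Fin n) K (Fin n → K)) (σ : Equiv.Perm (Fin n)) :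
    ∃ g : GL (Fin n) K, ∀ k, glEquiv K n g (b k) = b' (σ k) := by
  obtain ⟨g, hg⟩ := (glEquiv K n).surjective (b.equiv b' σ)
  exact ⟨g, fun k => by rw [hg, Basis.equiv_apply]⟩

theorem Adapted.smul_eq {α : Fin n → ℕ} {b b' : Basis (Fin n) K (Fin n → K)}
    {c c' : Fin n → Fin n} {F F' : FlagType K n α} (h : Adapted b c F.1) (h' : Adapted b' c' F'.1)
    {σ : Equiv.Perm (Fin n)} (hσ : ∀ k, c' (σ k) = c k) {g : GL (Fin n) K}
    (hg : ∀ k, glEquiv K n g (b k) = b' (σ k)) : g • F = F' := by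
  apply Subtype.ext
  funext i
  rw [FlagType.smul_val, h i, h' i, Submodule.map_span]
  congr 1
  ext x
  constructor
  · rintro ⟨_, ⟨k, hk, rfl⟩, rfl⟩
    exact ⟨σ k, by simpa [hσ] using hk, (hg k).symm⟩
  · rintro ⟨k, hk, rfl⟩
    refine ⟨_, ⟨σ.symm k, ?_, rfl⟩, ?_⟩
    · simpa [← hσ] using hk
    · simpa using hg (σ.symm k)

/-- The pair of flags `F`, `F'` has a common adapted basis with `m i j` vectors in position
`(i, j)`. -/
def HasPosition {α β : Fin n → ℕ} (F : FlagType K n α) (F' : FlagType K n β)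
    (m : Fin n → Fin n → ℕ) : Prop :=
  ∃ (b : Basis (Fin n) K (Fin n → K)) (c d : Fin n → Fin n), Adapted b c F.1 ∧ Adapted b d F'.1 ∧
    ∀ i j, (Finset.univ.filter fun k => c k = i ∧ d k = j).card = m i j

theorem sum_card_filter_and {ι I J : Type*} [Fintype ι] [DecidableEq I] [Fintype J] [DecidableEq J]
    (c : ι → I) (d : ι → J) (i : I) :
    ∑ j, (Finset.univ.filter fun k => c k = i ∧ d k = j).card =
      (Finset.univ.filter fun k => c k = i).card := by
  rw [Finset.card_eq_sum_card_fiberwise (f := d) (t := Finset.univ) (fun _ _ => by simp)]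
  simp only [Finset.filter_filter]

theorem HasPosition.contingency {α β : Fin n → ℕ} {F : FlagType K n α} {F' : FlagType K n β}
    {m : Fin n → Fin n → ℕ} (h : HasPosition F F' m) :
    (∀ i, ∑ j, m i j = α i) ∧ ∀ j, ∑ i, m i j = β j := by
  obtain ⟨b, c, d, hc, hd, hm⟩ := h
  simp only [← hm]
  refine ⟨fun i => ?_, fun j => ?_⟩
  · rw [sum_card_filter_and, F.card_fiber hc]
  · simp only [and_comm (a := c _ = _)]
    rw [sum_card_filter_and, F'.card_fiber hd]

theorem HasPosition.smul {α β : Fin n → ℕ} {F : FlagType K n α} {F' : FlagType K n β}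
    {m : Fin n → Fin n → ℕ} (h : HasPosition F F' m) (g : GL (Fin n) K) :
    HasPosition (g • F) (g • F') m := by
  obtain ⟨b, c, d, hc, hd, hm⟩ := h
  exact ⟨_, c, d, hc.smul g, hd.smul g, hm⟩

theorem HasPosition.finrank_inf {α β : Fin n → ℕ} {F : FlagType K n α} {F' : FlagType K n β}
    {m : Fin n → Fin n → ℕ} (h : HasPosition F F' m) (p : Fin n × Fin n) :
    finrank K (F.1 p.1 ⊓ F'.1 p.2 : Submodule K (Fin n → K)) =
      ∑ q ∈ Finset.Iic p, m q.1 q.2 := by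
  obtain ⟨b, c, d, hc, hd, hm⟩ := h
  rw [hc, hd, span_image_inf_span_image]
  have h1 := card_filter_le_eq_sum (fun k => (c k, d k)) p
  simp only [Prod.ext_iff] at h1
  simp only [← hm]
  rw [← h1]
  exact finrank_span_image b (fun k => (c k, d k) ≤ p)

theorem HasPosition.unique {α β : Fin n → ℕ} {F : FlagType K n α} {F' : FlagType K n β}
    {m m' : Fin n → Fin n → ℕ} (h : HasPosition F F' m) (h' : HasPosition F F' m') : m = m' := by
  have := eq_of_sum_Iic_eq (f := fun q : Fin n × Fin n => m q.1 q.2)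
    (g := fun q => m' q.1 q.2) (fun p => by rw [← h.finrank_inf, ← h'.finrank_inf])
  funext i j
  exact congrFun this (i, j)

theorem HasPosition.exists_smul_eq {α β : Fin n → ℕ} {F₁ F₂ : FlagType K n α}
    {F₁' F₂' : FlagType K n β} {m : Fin n → Fin n → ℕ} (h₁ : HasPosition F₁ F₁' m)
    (h₂ : HasPosition F₂ F₂' m) : ∃ g : GL (Fin n) K, g • (F₁, F₁') = (F₂, F₂') := by
  obtain ⟨b, c, d, hc, hd, hm⟩ := h₁
  obtain ⟨b', c', d', hc', hd', hm'⟩ := h₂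
  obtain ⟨σ, hσ⟩ := exists_perm_of_card_fiber_eq (c := fun k => (c k, d k))
    (c' := fun k => (c' k, d' k)) (fun ⟨i, j⟩ => by
      simp only [Prod.mk.injEq]
      rw [hm, hm'])
  obtain ⟨g, hg⟩ := exists_gl_map_basis b b' σ
  exact ⟨g, Prod.ext (hc.smul_eq hc' (fun k => congrArg Prod.fst (hσ k)) hg)
    (hd.smul_eq hd' (fun k => congrArg Prod.snd (hσ k)) hg)⟩

theorem exists_hasPosition (K : Type) [Field K] {α β : Fin n → ℕ} (hα : ∑ i, α i = n)
    (m : Contingency α β) :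
    ∃ (F : FlagType K n α) (F' : FlagType K n β), HasPosition F F' m.1 := by
  obtain ⟨m, hm, hm'⟩ := m
  have hcard : Fintype.card (Fin n) = Fintype.card (Σ p : Fin n × Fin n, Fin (m p.1 p.2)) := by
    rw [Fintype.card_sigma]
    simp only [Fintype.card_fin, Fintype.sum_prod_type, hm, hα]
  let e := Fintype.equivOfCardEq hcard
  have hcount : ∀ i j, (Finset.univ.filter fun k => (e k).1.1 = i ∧ (e k).1.2 = j).card = m i j := by
    intro i j
    rw [← Fintype.card_subtype, ← Fintype.card_fin (m i j)]
    refine Fintype.card_congr ((e.subtypeEquiv (q := fun x => x.1 = (i, j))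
      (fun k => by rw [Prod.ext_iff])).trans (Equiv.sigmaSubtype (i, j)))
  have hc : ∀ i, (Finset.univ.filter fun k => (e k).1.1 = i).card = α i := fun i => by
    rw [← sum_card_filter_and _ (fun k => (e k).1.2)]
    simp only [hcount, hm]
  have hd : ∀ j, (Finset.univ.filter fun k => (e k).1.2 = j).card = β j := fun j => by
    rw [← sum_card_filter_and _ (fun k => (e k).1.1)]
    simp only [and_comm (a := (e _).1.2 = j), hcount, hm']
  exact ⟨.ofBasis (Pi.basisFun K (Fin n)) _ hc, .ofBasis (Pi.basisFun K (Fin n)) _ hd,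
    Pi.basisFun K (Fin n), _, _, fun _ => rfl, fun _ => rfl, hcount⟩

theorem card_orbits_flagType (hn : 1 ≤ n) {α β : Fin n → ℕ} (hα : ∑ i, α i = n)
    (hβ : ∑ i, β i = n) :
    Nat.card (Quotient (MulAction.orbitRel (GL (Fin n) K) (FlagType K n α × FlagType K n β))) =
      Nat.card (Contingency α β) := by
  choose F F' hpos using exists_hasPosition K (β := β) hα
  symm
  refine Nat.card_eq_of_bijective
    (fun m => (Quotient.mk (MulAction.orbitRel (GL (Fin n) K) _) (F m, F' m))) ⟨?_, ?_⟩
  · intro m m' h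
    obtain ⟨g, hg⟩ := MulAction.orbitRel_apply.1 (Quotient.exact h)
    have h1 := (hpos m').smul g
    have hgF : g • F m' = F m := congrArg Prod.fst hg
    have hgF' : g • F' m' = F' m := congrArg Prod.snd hg
    rw [hgF, hgF'] at h1
    exact Subtype.ext ((hpos m).unique h1)
  · intro x
    induction x using Quotient.inductionOn with
    | h x =>
      obtain ⟨b, c, d, hc, hd⟩ := FlagType.exists_adapted hn hα hβ x.1 x.2
      have hx : HasPosition x.1 x.2 _ := ⟨b, c, d, hc, hd, fun _ _ => rfl⟩
      refine ⟨⟨_, hx.contingency⟩, Quotient.sound ?_⟩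
      obtain ⟨g, hg⟩ := hx.exists_smul_eq (hpos ⟨_, hx.contingency⟩)
      exact MulAction.orbitRel_apply.2 ⟨g, hg⟩

end Flags

section FullFlags

open Module Submodule

variable {K : Type} [Field K] {n : ℕ}

theorem card_filter_id_eq (i : Fin n) :
    (Finset.univ.filter fun k : Fin n => k = i).card = 1 := by
  rw [Finset.filter_eq' Finset.univ i]
  simp

theorem FlagType.exists_stabilizer_le (hn : 1 ≤ n) {α : Fin n → ℕ} (hα : ∑ i, α i = n)
    (x : FlagType K n α) : ∃ y : FlagType K n (fun _ => 1),
      MulAction.stabilizer (GL (Fin n) K) y ≤ MulAction.stabilizer (GL (Fin n) K) x := by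
  obtain ⟨b, c, -, hc, -⟩ := FlagType.exists_adapted hn hα hα x x
  let σ := Tuple.sort c
  have hmono : Monotone (c ∘ σ) := Tuple.monotone_sort c
  let y : FlagType K n (fun _ => 1) := .ofBasis (b.reindex σ.symm) id card_filter_id_eq
  have hx : ∀ i, x.1 i = span K (b.reindex σ.symm '' {k | c (σ k) ≤ i}) := by
    intro i
    rw [hc i]
    congr 1
    ext v
    constructor
    · rintro ⟨k, hk, rfl⟩
      exact ⟨σ.symm k, by simpa using hk, by simp⟩
    · rintro ⟨k, hk, rfl⟩
      exact ⟨σ k, hk, by simp⟩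
  have hxy : ∀ i, x.1 i = ⊥ ∨ ∃ j, x.1 i = y.1 j := by
    intro i
    rcases (Finset.univ.filter fun k => c (σ k) ≤ i).eq_empty_or_nonempty with h | h
    · left
      have : {k | c (σ k) ≤ i} = ∅ := by
        simpa [Finset.filter_eq_empty_iff, Set.eq_empty_iff_forall_notMem] using h
      rw [hx, this]
      simp
    · right
      refine ⟨(Finset.univ.filter fun k => c (σ k) ≤ i).max' h,
        (hx i).trans (congrArg (fun S => span K (b.reindex σ.symm '' S)) ?_)⟩
      · ext k
        refine ⟨fun hk => Finset.le_max' _ _ (Finset.mem_filter.2 ⟨Finset.mem_univ _, hk⟩),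
          fun hk => ?_⟩
        have := Finset.max'_mem _ h
        simp only [Finset.mem_filter, Finset.mem_univ, true_and] at this
        exact (hmono hk).trans this
  refine ⟨y, fun g hg => ?_⟩
  rw [MulAction.mem_stabilizer_iff] at hg ⊢
  apply Subtype.ext
  funext i
  rw [FlagType.smul_val]
  rcases hxy i with h | ⟨j, h⟩
  · rw [h, Submodule.map_bot]
  · rw [h, ← FlagType.smul_val, hg]

theorem FlagType.isPretransitive (hn : 1 ≤ n) {α : Fin n → ℕ} (hα : ∑ i, α i = n) :
    MulAction.IsPretransitive (GL (Fin n) K) (FlagType K n α) := by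
  refine ⟨fun x y => ?_⟩
  obtain ⟨b, c, -, hc, -⟩ := FlagType.exists_adapted hn hα hα x x
  obtain ⟨b', c', -, hc', -⟩ := FlagType.exists_adapted hn hα hα y y
  obtain ⟨σ, hσ⟩ := exists_perm_of_card_fiber_eq
    (fun i => (x.card_fiber hc i).trans (y.card_fiber hc' i).symm)
  obtain ⟨g, hg⟩ := exists_gl_map_basis b b' σ
  exact ⟨g, hc.smul_eq hc' hσ hg⟩

/-- The full flag spanned by the initial segments of the standard basis. -/
noncomputable def standardFlag (K : Type) [Field K] (n : ℕ) : FlagType K n (fun _ => 1) :=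
  .ofBasis (Pi.basisFun K (Fin n)) id card_filter_id_eq

theorem mem_standardFlag (i : Fin n) (v : Fin n → K) :
    v ∈ (standardFlag K n).1 i ↔ ∀ k, i < k → v k = 0 := by
  change v ∈ span K (Pi.basisFun K (Fin n) '' {k | k ≤ i}) ↔ _
  rw [Basis.mem_span_image]
  simp only [Set.subset_def, Finset.mem_coe, Finsupp.mem_support_iff, Pi.basisFun_repr,
    Set.mem_ofPred_eq]
  exact forall_congr' fun k => ⟨fun h hk => by_contra fun hv => absurd hk (not_lt.2 (h hv)),
    fun h hv => le_of_not_gt fun hk => hv (h hk)⟩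

theorem stabilizer_standardFlag :
    MulAction.stabilizer (GL (Fin n) K) (standardFlag K n) = BorelGL K n := by
  ext g
  rw [MulAction.mem_stabilizer_iff]
  change _ ↔ Matrix.BlockTriangular (g : Matrix (Fin n) (Fin n) K) id
  constructor
  · intro h i j hij
    have hj : Pi.single j 1 ∈ (standardFlag K n).1 j := by
      rw [mem_standardFlag]
      intro k hk
      exact Pi.single_eq_of_ne hk.ne' _
    have h1 := Submodule.mem_map_of_mem
      (f := (glEquiv K n g : (Fin n → K) →ₗ[K] (Fin n → K))) hj
    rw [← FlagType.smul_val, h, mem_standardFlag] at h1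
    simpa [glEquiv_apply] using h1 i hij
  · intro h
    apply Subtype.ext
    funext i
    apply Submodule.eq_of_le_of_finrank_eq
    · rintro _ ⟨v, hv, rfl⟩
      have hv' := (mem_standardFlag i v).1 hv
      rw [mem_standardFlag]
      intro k hk
      change ∑ l, (g : Matrix (Fin n) (Fin n) K) k l * v l = 0
      refine Finset.sum_eq_zero fun l _ => ?_
      rcases lt_or_ge i l with hl | hl
      · rw [hv' l hl, mul_zero]
      · rw [h (show id l < id k from hl.trans_lt hk), zero_mul]
    · exact LinearEquiv.finrank_map_eq (glEquiv K n g) _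

theorem card_fixed_quotient {G X : Type*} [Group G] [MulAction G X]
    [MulAction.IsPretransitive G X] {x : X} {H : Subgroup G}
    (hH : MulAction.stabilizer G x = H) (g : G) :
    Nat.card {q : G ⧸ H // g • q = q} = Nat.card {y : X // g • y = y} := by
  subst hH
  have hbij : Function.Bijective (MulAction.ofQuotientStabilizer G x) := by
    refine ⟨MulAction.injective_ofQuotientStabilizer G x, fun y => ?_⟩
    obtain ⟨h, rfl⟩ := MulAction.exists_smul_eq G x y
    exact ⟨(h : G ⧸ MulAction.stabilizer G x), rfl⟩
  refine Nat.card_congr ((Equiv.ofBijective _ hbij).subtypeEquiv fun q => ?_)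
  rw [Equiv.ofBijective_apply, ← MulAction.ofQuotientStabilizer_smul]
  exact hbij.1.eq_iff.symm

theorem permChar_eq_fixChar (hn : 1 ≤ n) (g : GL (Fin n) K) :
    permChar K n g = fixChar (GL (Fin n) K) (FlagType K n (fun _ => 1)) g := by
  have := FlagType.isPretransitive (K := K) hn (α := fun _ => 1) (by simp)
  unfold permChar fixChar
  rw [card_fixed_quotient (stabilizer_standardFlag (K := K))]

end FullFlags

section PartitionCount

/-- Partitions of `n`, written as weakly increasing sequences padded by zeros. -/
abbrev PaddedPartition (n : ℕ) : Type := {l : Fin n → ℕ // Monotone l ∧ ∑ i, l i = n}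

theorem exists_monotone_map_eq {n : ℕ} (s : Multiset ℕ) (hs : s.card = n) :
    ∃ f : Fin n → ℕ, Monotone f ∧ Finset.univ.val.map f = s := by
  obtain ⟨l, rfl⟩ : ∃ l : List ℕ, (l : Multiset ℕ) = s := ⟨s.toList, s.coe_toList⟩
  obtain rfl : l.length = n := by simpa using hs
  refine ⟨l.get ∘ Tuple.sort l.get, Tuple.monotone_sort _, ?_⟩
  rw [← Multiset.map_map, Multiset.map_univ_val_equiv, Fin.univ_val_map, List.ofFn_get]

theorem Monotone.eq_of_map_eq {n : ℕ} {f f' : Fin n → ℕ} (hf : Monotone f) (hf' : Monotone f')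
    (h : Finset.univ.val.map f = Finset.univ.val.map f') : f = f' := by
  obtain ⟨σ, hσ⟩ := exists_perm_of_card_fiber_eq (c := f) (c' := f') (fun i => by
    have := congrArg (Multiset.count i) h
    simp only [Multiset.count_map, eq_comm (a := i)] at this
    exact this)
  have h1 : f' ∘ σ = f := funext hσ
  rw [← h1]
  exact Tuple.unique_monotone (f := f') (σ := σ) (τ := 1) (by rwa [h1]) hf'

theorem multiset_eq_of_filter_ne_zero_eq {s t : Multiset ℕ} (hc : s.card = t.card)
    (h : s.filter (· ≠ 0) = t.filter (· ≠ 0)) : s = t := by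
  ext a
  by_cases ha : a = 0
  · subst ha
    have key : ∀ u : Multiset ℕ, u.count 0 + (u.filter (· ≠ 0)).card = u.card := fun u => by
      have := congrArg Multiset.card (Multiset.filter_add_not (fun x => 0 = x) u)
      rw [Multiset.card_add] at this
      rw [Multiset.count_eq_card_filter_eq, ← this]
      simp only [ne_comm, ne_eq]
    have hs := key s
    rw [h] at hs
    have ht := key t
    omega
  · have := congrArg (Multiset.count a) h
    rwa [Multiset.count_filter_of_pos (p := (· ≠ 0)) ha,
      Multiset.count_filter_of_pos (p := (· ≠ 0)) ha] at this

theorem card_paddedPartition (n : ℕ) :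
    Nat.card (PaddedPartition n) = Nat.card (Nat.Partition n) := by
  refine Nat.card_eq_of_bijective
    (fun l => Nat.Partition.ofSums n (Finset.univ.val.map l.1) l.2.2) ⟨?_, ?_⟩
  · intro l l' h
    have h' := congrArg Nat.Partition.parts h
    exact Subtype.ext (l.2.1.eq_of_map_eq l'.2.1
      (multiset_eq_of_filter_ne_zero_eq (by simp) h'))
  · intro p
    have hcard : p.parts.card ≤ n := by
      have := Multiset.card_nsmul_le_sum (s := p.parts) (a := 1) (fun x hx => p.parts_pos hx)
      rw [p.parts_sum] at this
      simpa using this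
    obtain ⟨f, hf, hs⟩ := exists_monotone_map_eq (n := n)
      (p.parts + Multiset.replicate (n - p.parts.card) 0) (by simp [hcard])
    refine ⟨⟨f, hf, ?_⟩, ?_⟩
    · change (Finset.univ.val.map f).sum = n
      rw [hs]
      simp [p.parts_sum]
    · apply Nat.Partition.ext
      change (Finset.univ.val.map f).filter (· ≠ 0) = _
      rw [hs, Multiset.filter_add, Multiset.filter_eq_self.2 (fun x hx => (p.parts_pos hx).ne'),
        Multiset.filter_eq_nil.2 (fun x hx => by simp [Multiset.eq_of_mem_replicate hx]), add_zero]

instance (n : ℕ) : Finite (PaddedPartition n) := by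
  refine Set.Finite.subset (Set.Finite.pi' (fun _ : Fin n => Set.finite_Iic n)) ?_
  rintro l ⟨-, h⟩ i
  exact (Finset.single_le_sum (fun _ _ => Nat.zero_le _) (Finset.mem_univ i)).trans h.le

end PartitionCount

section FlagCharacters

variable (K : Type) [Field K] [Fintype K] [DecidableEq K] {n : ℕ}

/-- The permutation character of `GL_n(K)` on flags of type `α`. -/
noncomputable def flagChar (α : Fin n → ℕ) : GL (Fin n) K → ℂ :=
  fixChar (GL (Fin n) K) (FlagType K n α)

theorem charPairing_flagChar (hn : 1 ≤ n) {α β : Fin n → ℕ} (hα : ∑ i, α i = n)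
    (hβ : ∑ i, β i = n) :
    charPairing (GL (Fin n) K) (flagChar K α) (flagChar K β) = Nat.card (Contingency α β) := by
  unfold flagChar
  rw [charPairing_fixChar, card_orbits_flagType hn hα hβ]

theorem card_contingency_comp_perm (α β : Fin n → ℕ) (σ τ : Equiv.Perm (Fin n)) :
    Nat.card (Contingency (α ∘ σ) (β ∘ τ)) = Nat.card (Contingency α β) := by
  refine Nat.card_congr (Equiv.subtypeEquiv
    (Equiv.arrowCongr σ (Equiv.arrowCongr τ (Equiv.refl ℕ))) fun m => ?_)
  refine and_congr ?_ ?_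
  · rw [← σ.forall_congr_right (q := fun i => _ = α i)]
    refine forall_congr' fun i => ?_
    simp [Equiv.arrowCongr, Equiv.sum_comp τ.symm (m i)]
  · rw [← τ.forall_congr_right (q := fun i => _ = β i)]
    refine forall_congr' fun i => ?_
    simp [Equiv.arrowCongr, Equiv.sum_comp σ.symm (fun k => m k i)]

theorem flagChar_comp_perm (hn : 1 ≤ n) {α : Fin n → ℕ} (hα : ∑ i, α i = n)
    (σ : Equiv.Perm (Fin n)) : flagChar K (α ∘ σ) = flagChar K α := by
  have hσ : ∑ i, (α ∘ σ) i = n := (Equiv.sum_comp σ α).trans hα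
  rw [← sub_eq_zero]
  refine eq_zero_of_charPairing_self
    (sub_mem (fixChar_mem_closure_irrChars) (fixChar_mem_closure_irrChars)) ?_
  simp only [map_sub, LinearMap.sub_apply]
  rw [charPairing_flagChar K hn hσ hσ, charPairing_flagChar K hn hσ hα,
    charPairing_flagChar K hn hα hσ, charPairing_flagChar K hn hα hα,
    card_contingency_comp_perm α α σ σ]
  have h1 := card_contingency_comp_perm α α σ 1
  have h2 := card_contingency_comp_perm α α 1 σ
  simp only [Equiv.Perm.coe_one, Function.comp_id] at h1 h2
  rw [h1, h2]
  ring

/-- The Jacobi-Trudi combination of flag characters. -/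
noncomputable def schurChar (l : Fin n → ℕ) : GL (Fin n) K → ℂ :=
  ∑ w : Equiv.Perm (Fin n), if ∀ i, (w i : ℕ) ≤ l i + i then
    (Equiv.Perm.sign w : ℤ) • flagChar K (fun i => l i + i - w i) else 0

theorem sum_add_sub_perm {l : Fin n → ℕ} (hl : ∑ i, l i = n) {w : Equiv.Perm (Fin n)}
    (hw : ∀ i, (w i : ℕ) ≤ l i + i) : ∑ i, (l i + i - w i) = n := by
  have h1 : ∑ i, (l i + i - w i) + ∑ i, (w i : ℕ) = ∑ i, l i + ∑ i : Fin n, (i : ℕ) := by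
    rw [← Finset.sum_add_distrib, ← Finset.sum_add_distrib]
    exact Finset.sum_congr rfl fun i _ => Nat.sub_add_cancel (hw i)
  rw [Equiv.sum_comp w (fun i : Fin n => (i : ℕ)), hl] at h1
  exact Nat.add_right_cancel h1

theorem charPairing_schurChar (hn : 1 ≤ n) {l l' : Fin n → ℕ} (hl : Monotone l)
    (hl' : Monotone l') (hs : ∑ i, l i = n) (hs' : ∑ i, l' i = n) :
    charPairing (GL (Fin n) K) (schurChar K l) (schurChar K l') = if l = l' then 1 else 0 := by
  have hmono : ∀ {l : Fin n → ℕ}, Monotone l → StrictMono fun i => l i + (i : ℕ) :=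
    fun hl i j hij => add_lt_add_of_le_of_lt (hl hij.le) hij
  have key := congrArg (Int.cast : ℤ → ℂ) (sum_sign_contingency (hmono hl) (hmono hl'))
  have hiff : ((fun i => l i + (i : ℕ)) = fun i => l' i + (i : ℕ)) ↔ l = l' := by
    simp only [funext_iff, Nat.add_right_cancel_iff]
  simp only [hiff] at key
  push_cast at key
  rw [← key]
  simp only [schurChar, map_sum, LinearMap.sum_apply]
  rw [Finset.sum_comm]
  refine Finset.sum_congr rfl fun w _ => Finset.sum_congr rfl fun v _ => ?_
  by_cases hw : ∀ i, (w i : ℕ) ≤ l i + i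
  · by_cases hv : ∀ i, (v i : ℕ) ≤ l' i + i
    · rw [if_pos hw, if_pos hv, if_pos ⟨hw, hv⟩]
      simp only [map_zsmul, LinearMap.smul_apply]
      rw [charPairing_flagChar K hn (sum_add_sub_perm hs hw) (sum_add_sub_perm hs' hv)]
      simp only [zsmul_eq_mul]
      ring
    · rw [if_neg hv, if_neg (fun h => hv h.2 : ¬(_ ∧ _)), map_zero]
  · rw [if_neg hw, if_neg (fun h => hw h.1 : ¬(_ ∧ _)), map_zero,
      LinearMap.zero_apply]

theorem schurChar_mem_closure (hn : 1 ≤ n) {l : Fin n → ℕ} (hs : ∑ i, l i = n) :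
    schurChar K l ∈ AddSubgroup.closure
      (Set.range fun p : PaddedPartition n => flagChar K p.1) := by
  refine sum_mem fun w _ => ?_
  split_ifs with hw
  · refine zsmul_mem (AddSubgroup.subset_closure ?_) _
    have hsum := sum_add_sub_perm hs hw
    refine ⟨⟨_, Tuple.monotone_sort fun i => l i + i - w i, ?_⟩, flagChar_comp_perm K hn hsum _⟩
    exact (Equiv.sum_comp (Tuple.sort fun i => l i + i - w i) (fun i => l i + i - w i)).trans hsum
  · exact zero_mem _

theorem card_constituents_flagChar_one (hn : 1 ≤ n) :
    Nat.card {χ : GL (Fin n) K → ℂ // χ ∈ irrChars (GL (Fin n) K) ∧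
      charPairing (GL (Fin n) K) χ (flagChar K fun _ => 1) ≠ 0} =
      Nat.card (Nat.Partition n) := by
  classical
  have : Fintype (PaddedPartition n) := Fintype.ofFinite _
  rw [← card_paddedPartition, Nat.card_eq_fintype_card (α := PaddedPartition n)]
  refine card_constituents_of_orthonormal
    (fun p : PaddedPartition n => flagChar K p.1) (fun p => schurChar K p.1)
    (fun _ => fixChar_mem_closure_irrChars) (fun p => schurChar_mem_closure K hn p.2.2)
    (fun p p' => ?_) ⟨fun _ => 1, monotone_const, by simp⟩ (fun χ hχ p => ?_)
  · rw [charPairing_schurChar K hn p.2.1 p'.2.1 p.2.2 p'.2.2]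
    simp only [Subtype.ext_iff]
  · exact charPairing_fixChar_ne_zero_of_refine
      (fun x => x.exists_stabilizer_le hn p.2.2) hχ

theorem inner_permChar_eq_charPairing (hn : 1 ≤ n) (f : GL (Fin n) K → ℂ) :
    (1 / (Fintype.card (GL (Fin n) K) : ℂ)) *
        ∑ g : GL (Fin n) K, f g * (starRingEnd ℂ) (permChar K n g) =
      charPairing (GL (Fin n) K) f (flagChar K fun _ => 1) := by
  rw [charPairing_apply, one_div, Nat.card_eq_fintype_card]
  congr 1
  refine Finset.sum_congr rfl fun g _ => ?_
  rw [permChar_eq_fixChar hn, flagChar, fixChar_inv]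
  simp [fixChar]

end FlagCharacters

/-- Let `𝔽` be a finite field with `q` elements, `n ≥ 1`, `G = GL_n(𝔽)`, `B` the Borel
subgroup of invertible upper-triangular matrices, and `π` the permutation character of
`G` on `G/B`. The number of irreducible complex characters `χ` of `G` with `⟨χ, π⟩ ≠ 0`
(i.e. the number of pairwise non-isomorphic irreducible constituents of `Ind_B^G 1`)
equals the number of partitions of `n`, which is the number of irreducible
representations of the Weyl group `S_n`. -/
theorem card_constituents_ind_triv_borel (𝔽 : Type) [Field 𝔽] [Fintype 𝔽] [DecidableEq 𝔽]
    (q n : ℕ) (hq : Fintype.card 𝔽 = q) (hn : 1 ≤ n) :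
    Nat.card {f : GL (Fin n) 𝔽 → ℂ //
        (∃ V : FDRep ℂ (GL (Fin n) 𝔽), Simple V ∧ f = FDRep.character V) ∧
          (1 / (Fintype.card (GL (Fin n) 𝔽) : ℂ)) *
              ∑ g : GL (Fin n) 𝔽, f g * (starRingEnd ℂ) (permChar 𝔽 n g) ≠ 0} =
      Nat.card (Nat.Partition n) := by
  rw [← card_constituents_flagChar_one 𝔽 hn]
  simp only [inner_permChar_eq_charPairing 𝔽 hn]
  rfl
end

section
/- Let 𝔽 be a finite field with q elements and n ≥ 1. Every cuspidal representation of GL_n(𝔽) has dimension ∏_{i=1}^{n-1} (q^i − 1). -/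
open Matrix

/-- A submodule `W` is invariant under a representation `ρ` if `ρ g` maps `W` into
itself for every `g`. -/
def RepInvariant {G V : Type*} [Group G] [AddCommGroup V] [Module ℂ V]
    (ρ : Representation ℂ G V) (W : Submodule ℂ V) : Prop :=
  ∀ g : G, ∀ v ∈ W, ρ g v ∈ W

/-- A representation is irreducible if the underlying space is nonzero and its only
invariant subspaces are `⊥` and `⊤`. -/
def IsIrreducibleRep {G V : Type*} [Group G] [AddCommGroup V] [Module ℂ V]
    (ρ : Representation ℂ G V) : Prop :=
  (⊥ : Submodule ℂ V) ≠ ⊤ ∧ ∀ W : Submodule ℂ V, RepInvariant ρ W → W = ⊥ ∨ W = ⊤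

/-- `u ∈ GL_m(𝔽)` is block upper-triangular unipotent of type `(r, m - r)`, i.e. of the
form `[[I_r, X], [0, I_{m-r}]]`: its diagonal entries are `1` and its off-diagonal
entries vanish outside the top-right `r × (m - r)` block. -/
def IsBlockUnipotent {𝔽 : Type*} [Field 𝔽] {m : ℕ} (r : ℕ) (u : GL (Fin m) 𝔽) : Prop :=
  (∀ i : Fin m, (u : Matrix (Fin m) (Fin m) 𝔽) i i = 1) ∧
    ∀ i j : Fin m, i ≠ j → ¬((i : ℕ) < r ∧ r ≤ (j : ℕ)) →
      (u : Matrix (Fin m) (Fin m) 𝔽) i j = 0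

/-- A finite-dimensional complex representation `ρ` of `GL_m(𝔽)` is cuspidal if it is
irreducible and, for every `0 < r < m`, the only vector fixed by `ρ u` for all block
upper-triangular unipotent matrices `u = [[I_r, X], [0, I_{m-r}]]` is zero. -/
def IsCuspidal {𝔽 : Type*} [Field 𝔽] {m : ℕ} {V : Type*} [AddCommGroup V] [Module ℂ V]
    (ρ : Representation ℂ (GL (Fin m) 𝔽) V) : Prop :=
  IsIrreducibleRep ρ ∧
    ∀ r : ℕ, 0 < r → r < m →
      ∀ v : V, (∀ u : GL (Fin m) 𝔽, IsBlockUnipotent r u → ρ u v = v) → v = 0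

/-- If each descent in consecutive values of a permutation happens at adjacent positions, then the
permutation decreases by steps of one between any two inverted positions. -/
theorem perm_run_of_inversion {n : ℕ} (l : Equiv.Perm (Fin n))
    (H : ∀ p p' : Fin n, (l p').val = (l p).val + 1 → p' < p → p.val = p'.val + 1) :
    ∀ (N : ℕ) (j j' : Fin n), j < j' → l j' < l j → (l j).val - (l j').val ≤ N →
      ∀ p, j ≤ p → p ≤ j' → p.val + (l p).val = j.val + (l j).val := by
  intro N
  induction N with
  | zero => intro j j' _ h1 h2; omega
  | succ N ih =>
    intro j j' h0 h1 h2 p hp hp'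
    obtain ⟨m, hm⟩ := l.surjective ⟨(l j').val + 1, by omega⟩
    have hmv : (l m).val = (l j').val + 1 := by rw [hm]
    have hne : m ≠ j' := by rintro rfl; omega
    rcases lt_or_gt_of_ne hne with h | h
    · have h3 := H j' m hmv h
      rcases eq_or_ne p j' with rfl | hpj
      · rcases eq_or_ne m j with rfl | hmj
        · omega
        · have hl : l m ≠ l j := fun e => hmj (l.injective e)
          have := ih j m (by omega) (by omega) (by omega) m (by omega) le_rfl
          omega
      · rcases eq_or_ne m j with rfl | hmj
        · have : p = m := by omega
          rw [this]
        · have hl : l m ≠ l j := fun e => hmj (l.injective e)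
          exact ih j m (by omega) (by omega) (by omega) p (by omega) (by omega)
    · have hmj : m ≠ j := by rintro rfl; omega
      have hl : l m ≠ l j := fun e => hmj (l.injective e)
      have h4 := ih j m (by omega) (by omega) (by omega) j' (by omega) (by omega)
      have h5 := ih j m (by omega) (by omega) (by omega) m (by omega) le_rfl
      omega

theorem perm_add_eq_of_inversion {n : ℕ} (l : Equiv.Perm (Fin n))
    (H : ∀ p p' : Fin n, (l p').val = (l p).val + 1 → p' < p → p.val = p'.val + 1)
    {j j' : Fin n} (h : j < j') (h' : l j' < l j) :
    j'.val + (l j').val = j.val + (l j).val :=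
  perm_run_of_inversion l H _ j j' h h' le_rfl j' h.le le_rfl

theorem perm_involutive_of_descents {n : ℕ} (l : Equiv.Perm (Fin n))
    (H : ∀ p p' : Fin n, (l p').val = (l p).val + 1 → p' < p → p.val = p'.val + 1)
    (j : Fin n) : l (l j) = j := by
  obtain ⟨i, hi⟩ : ∃ i, i = l j := ⟨_, rfl⟩
  rw [← hi]
  rcases lt_trichotomy j i with h | h | h
  · rcases lt_trichotomy (l i) (l j) with h1 | h1 | h1
    · have := perm_add_eq_of_inversion l H h h1
      omega
    · have := l.injective h1; omega
    · exfalso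
      obtain ⟨m, hm1, hm2⟩ : ∃ m, i ≤ m ∧ l m < i := by
        by_contra hcon
        push Not at hcon
        have hsub : (Finset.Iio i).map l.symm.toEmbedding ⊆ (Finset.Iio i).erase j := by
          intro x hx
          simp only [Finset.mem_map, Finset.mem_Iio, Equiv.coe_toEmbedding] at hx
          obtain ⟨y, hy, rfl⟩ := hx
          refine Finset.mem_erase.2 ⟨?_, ?_⟩
          · rintro rfl; simp at hi; omega
          · rw [Finset.mem_Iio]
            by_contra hc
            have := hcon _ (not_lt.1 hc)
            simp at this; omega
        have := Finset.card_le_card hsub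
        rw [Finset.card_map, Finset.card_erase_of_mem (by simpa using h)] at this
        have : 0 < (Finset.Iio i).card := Finset.card_pos.2 ⟨j, by simpa using h⟩
        omega
      have hmi : m ≠ i := by rintro rfl; omega
      have e1 := perm_add_eq_of_inversion l H (j := j) (j' := m) (by omega) (by omega)
      have e2 := perm_add_eq_of_inversion l H (j := i) (j' := m) (by omega) (by omega)
      omega
  · rw [h] at hi ⊢; exact hi.symm
  · rcases lt_trichotomy (l i) (l j) with h1 | h1 | h1
    · exfalso
      obtain ⟨m, hm1, hm2⟩ : ∃ m, m ≤ i ∧ i < l m := by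
        by_contra hcon
        push Not at hcon
        have hsub : (Finset.Ioi i).map l.symm.toEmbedding ⊆ (Finset.Ioi i).erase j := by
          intro x hx
          simp only [Finset.mem_map, Finset.mem_Ioi, Equiv.coe_toEmbedding] at hx
          obtain ⟨y, hy, rfl⟩ := hx
          refine Finset.mem_erase.2 ⟨?_, ?_⟩
          · rintro rfl; simp at hi; omega
          · rw [Finset.mem_Ioi]
            by_contra hc
            have := hcon _ (not_lt.1 hc)
            simp at this; omega
        have := Finset.card_le_card hsub
        rw [Finset.card_map, Finset.card_erase_of_mem (by simpa using h)] at this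
        have : 0 < (Finset.Ioi i).card := Finset.card_pos.2 ⟨j, by simpa using h⟩
        omega
      have hmi : m ≠ i := by rintro rfl; omega
      have e1 := perm_add_eq_of_inversion l H (j := m) (j' := j) (by omega) (by omega)
      have e2 := perm_add_eq_of_inversion l H (j := m) (j' := i) (by omega) (by omega)
      omega
    · have := l.injective h1; omega
    · have := perm_add_eq_of_inversion l H h h1
      omega

/-- A function that is constant across the adjacent descents of a permutation as in
`perm_involutive_of_descents` is invariant under that permutation. -/
theorem apply_perm_eq_of_descents {n : ℕ} {α : Type*} (l : Equiv.Perm (Fin n)) (d : Fin n → α)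
    (H : ∀ p p' : Fin n, (l p').val = (l p).val + 1 → p' < p → p.val = p'.val + 1)
    (hd : ∀ p p' : Fin n, p'.val = p.val + 1 → l p' < l p → d p' = d p) (j : Fin n) :
    d (l j) = d j := by
  have key : ∀ j : Fin n, j < l j → d (l j) = d j := by
    intro j hj
    have hrun := perm_run_of_inversion l H _ j (l j) hj
      (by rw [perm_involutive_of_descents l H]; exact hj) le_rfl
    have : ∀ t : ℕ, ∀ p : Fin n, p.val = j.val + t → p ≤ l j → d p = d j := by
      intro t
      induction t with
      | zero => intro p hp _; rw [show p = j by omega]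
      | succ t ih =>
        intro p hp hp'
        have hq : j.val + t < n := by omega
        have e1 := hrun p (by omega) hp'
        have e2 := hrun ⟨j.val + t, hq⟩ (by rw [Fin.le_def]; simp) (by rw [Fin.le_def]; simp; omega)
        simp only at e2
        rw [hd ⟨j.val + t, hq⟩ p (by simp; omega) (by omega)]
        exact ih _ rfl (by rw [Fin.le_def]; simp; omega)
    exact this ((l j).val - j.val) (l j) (by omega) le_rfl
  rcases lt_trichotomy j (l j) with h | h | h
  · exact key j h
  · rw [← h]
  · have := key (l j) (by rw [perm_involutive_of_descents l H]; exact h)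
    rw [perm_involutive_of_descents l H] at this
    exact this.symm

section Unipotent

variable {F : Type*} [Field F] {n : ℕ}

/-- Unitriangular matrices whose first `k` columns are those of the identity. -/
def IsUnitriangularFrom (k : ℕ) (M : Matrix (Fin n) (Fin n) F) : Prop :=
  ∀ i j : Fin n, ¬(i < j ∧ k ≤ j.val) → M i j = (1 : Matrix (Fin n) (Fin n) F) i j

theorem IsUnitriangularFrom.one (k : ℕ) :
    IsUnitriangularFrom k (1 : Matrix (Fin n) (Fin n) F) := fun _ _ _ => rfl

theorem IsUnitriangularFrom.mul {k : ℕ} {M N : Matrix (Fin n) (Fin n) F}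
    (hM : IsUnitriangularFrom k M) (hN : IsUnitriangularFrom k N) :
    IsUnitriangularFrom k (M * N) := by
  intro i j hij
  rw [Matrix.mul_apply, Finset.sum_eq_single j, hM i j hij, hN j j (by simp), one_apply_eq,
    mul_one]
  · intro l _ hl
    by_cases h : l < j ∧ k ≤ j.val
    · rw [hM i l (by omega), one_apply_ne (by omega), zero_mul]
    · rw [hN l j h, one_apply_ne hl, mul_zero]
  · simp

theorem IsUnitriangularFrom.det {k : ℕ} {M : Matrix (Fin n) (Fin n) F}
    (hM : IsUnitriangularFrom k M) : M.det = 1 := by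
  rw [Matrix.det_of_isUpperTriangular]
  · exact Finset.prod_eq_one fun i _ => by rw [hM i i (by simp), one_apply_eq]
  · intro i j hij
    have hij' : j < i := hij
    rw [hM i j (by omega), one_apply_ne (by omega)]

variable (F n) in
/-- The group of unitriangular matrices whose first `k` columns are those of the identity. -/
def unipotentFrom [Finite F] (k : ℕ) : Subgroup (GL (Fin n) F) where
  carrier := {g | IsUnitriangularFrom k (g : Matrix (Fin n) (Fin n) F)}
  mul_mem' := fun ha hb => by
    simpa using IsUnitriangularFrom.mul ha hb
  one_mem' := by simpa using IsUnitriangularFrom.one k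
  inv_mem' := by
    intro g hg
    have hpow : ∀ m : ℕ, IsUnitriangularFrom k (g ^ m).val := by
      intro m
      induction m with
      | zero => simpa using IsUnitriangularFrom.one k
      | succ m ih => rw [pow_succ]; simpa using IsUnitriangularFrom.mul ih hg
    have : g⁻¹ = g ^ (orderOf g - 1) := by
      rw [inv_eq_iff_mul_eq_one, ← pow_succ', Nat.sub_add_cancel (orderOf_pos g), pow_orderOf_eq_one]
    change IsUnitriangularFrom k _
    rw [this]
    exact hpow _

variable [Finite F]

theorem IsUnitriangularFrom.exists_mem {k : ℕ} {M : Matrix (Fin n) (Fin n) F}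
    (hM : IsUnitriangularFrom k M) :
    ∃ u ∈ unipotentFrom F n k, (u : Matrix (Fin n) (Fin n) F) = M :=
  ⟨GeneralLinearGroup.mkOfDetNeZero M (by rw [hM.det]; exact one_ne_zero), hM, rfl⟩

/-- The group of unitriangular matrices has order `∏ q ^ k`. -/
theorem card_unipotentFrom_one {q : ℕ} (hq : Nat.card F = q) :
    Nat.card (unipotentFrom F n 1) = ∏ k ∈ Finset.range n, q ^ k := by
  classical
  have := Fintype.ofFinite F
  have e : unipotentFrom F n 1 ≃ Fintype.piFinset fun i : Fin n => Fintype.piFinset fun j : Fin n =>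
      if i < j then (Finset.univ : Finset F) else {(1 : Matrix (Fin n) (Fin n) F) i j} := by
    refine Equiv.ofBijective (fun u => ⟨fun i j => u.1.val i j,
      Fintype.mem_piFinset.2 fun i => Fintype.mem_piFinset.2 fun j => ?_⟩) ⟨?_, ?_⟩
    · split_ifs with h
      · simp
      · rw [Finset.mem_singleton]
        exact u.2 i j (by tauto)
    · intro u v huv
      apply Subtype.ext
      apply Units.ext
      exact congrArg Subtype.val huv
    · rintro ⟨M, hM⟩
      simp only [Fintype.mem_piFinset] at hM
      have hM' : IsUnitriangularFrom 1 (M : Matrix (Fin n) (Fin n) F) := by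
        intro i j hij
        have h1 := hM i j
        rw [if_neg (by omega), Finset.mem_singleton] at h1
        exact h1
      obtain ⟨u, hu, hu'⟩ := hM'.exists_mem
      exact ⟨⟨u, hu⟩, Subtype.ext hu'⟩
  rw [Nat.card_congr e, Nat.card_eq_fintype_card, Fintype.card_coe, Fintype.card_piFinset]
  simp only [Fintype.card_piFinset]
  rw [Finset.prod_comm, ← Fin.prod_univ_eq_prod_range]
  refine Finset.prod_congr rfl fun j _ => ?_
  have : ∀ i : Fin n, (if i < j then (Finset.univ : Finset F)
      else {(1 : Matrix (Fin n) (Fin n) F) i j}).card = if i < j then q else 1 := by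
    intro i
    split_ifs
    · rw [Finset.card_univ, ← hq, Nat.card_eq_fintype_card]
    · simp
  simp only [this]
  rw [Finset.prod_ite, Finset.prod_const, Finset.prod_const_one, mul_one]
  congr 1
  rw [← Fin.card_Iio j]
  congr 1
  ext i
  simp

end Unipotent

section Bruhat

variable {F : Type*} [Field F] {n : ℕ}

/-- Each nonzero entry in the first `j` columns is alone in its row and in its column. -/
def IsMonomialUpTo (j : ℕ) (M : Matrix (Fin n) (Fin n) F) : Prop :=
  ∀ i c : Fin n, c.val < j → M i c ≠ 0 →
    (∀ i', i' ≠ i → M i' c = 0) ∧ ∀ c', c' ≠ c → M i c' = 0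

theorem isUnitriangularFrom_one_sub_vecMulVec {x y : Fin n → F}
    (h : ∀ r c, x r ≠ 0 → y c ≠ 0 → r < c) : IsUnitriangularFrom 1 (1 - vecMulVec x y) := by
  intro i j hij
  rw [Matrix.sub_apply, vecMulVec_apply, sub_eq_self, mul_eq_zero]
  by_contra! hne
  have := h i j hne.1 hne.2
  omega

variable [Finite F]

/-- One elimination step: a pivot at the lowest nonzero entry of a column clears its row and its
column by unitriangular operations. -/
theorem exists_unipotent_clear_column (M : Matrix (Fin n) (Fin n) F) (j : ℕ)
    (hM : IsMonomialUpTo j M) :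
    ∃ u ∈ unipotentFrom F n 1, ∃ u' ∈ unipotentFrom F n 1,
      IsMonomialUpTo (j + 1) (u.val * M * u'.val) := by
  classical
  by_cases hz : ∃ J : Fin n, J.val = j ∧ ∃ i, M i J ≠ 0
  · obtain ⟨J, rfl, hex⟩ := hz
    obtain ⟨I, hI, hmax⟩ : ∃ I, M I J ≠ 0 ∧ ∀ i, M i J ≠ 0 → i ≤ I := by
      have hne : (Finset.univ.filter fun i => M i J ≠ 0).Nonempty := by
        obtain ⟨i, hi⟩ := hex; exact ⟨i, by simpa using hi⟩
      refine ⟨_, (Finset.mem_filter.1 (Finset.max'_mem _ hne)).2, fun i hi => ?_⟩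
      exact Finset.le_max' _ _ (by simpa using hi)
    have hrow : ∀ c : Fin n, c < J → M I c = 0 := by
      intro c hc
      by_contra hne
      exact hI ((hM I c hc hne).2 J (by omega))
    obtain ⟨u, hu, hu'⟩ := (isUnitriangularFrom_one_sub_vecMulVec
      (x := fun r => if r = I then 0 else M r J / M I J) (y := Pi.single I (1 : F)) (by
        intro r c hr hc
        have hc' : c = I := by by_contra h; exact hc (Pi.single_eq_of_ne h _)
        subst hc'
        have hrI : r ≠ c := by rintro rfl; simp at hr
        simp only [if_neg hrI] at hr
        have := hmax r (by intro h; simp [h] at hr)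
        omega)).exists_mem
    obtain ⟨v, hv, hv'⟩ := (isUnitriangularFrom_one_sub_vecMulVec
      (x := Pi.single J (1 : F)) (y := fun c => if c = J then 0 else M I c / M I J) (by
        intro r c hr hc
        have hr' : r = J := by by_contra h; exact hr (Pi.single_eq_of_ne h _)
        subst hr'
        have hcJ : c ≠ r := by rintro rfl; simp at hc
        simp only [if_neg hcJ] at hc
        by_contra hlt
        exact hc (by rw [hrow c (by omega), zero_div]))).exists_mem
    refine ⟨u, hu, v, hv, ?_⟩
    have e1 : ∀ r c, (u.val * M) r c =
        M r c - (if r = I then 0 else M r J / M I J) * M I c := by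
      intro r c
      rw [hu', Matrix.sub_mul, Matrix.one_mul, Matrix.sub_apply, vecMulVec_mul, vecMulVec_apply,
        single_one_vecMul, row_apply]
    have e2 : ∀ r c, (u.val * M * v.val) r c =
        (M r c - (if r = I then 0 else M r J / M I J) * M I c) -
        (M r J - (if r = I then 0 else M r J / M I J) * M I J) *
          (if c = J then 0 else M I c / M I J) := by
      intro r c
      rw [hv', Matrix.mul_sub, Matrix.mul_one, Matrix.sub_apply, mul_vecMulVec, vecMulVec_apply,
        mulVec_single_one, col_apply, e1, e1]
    have f1 : ∀ c, c ≠ J → (u.val * M * v.val) I c = 0 := by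
      intro c hc
      rw [e2]; simp [hc]; field_simp; simp
    have f2 : ∀ r, r ≠ I → (u.val * M * v.val) r J = 0 := by
      intro r hr
      rw [e2]; simp [hr]; field_simp; simp
    have f3 : ∀ r c, r ≠ I → c ≠ J → (u.val * M * v.val) r c =
        M r c - M r J / M I J * M I c := by
      intro r c hr hc
      rw [e2]; simp [hr, hc]; field_simp; simp
    intro i c hc hne
    rcases eq_or_ne c J with rfl | hcJ
    · have hi : i = I := by by_contra h; exact hne (f2 i h)
      subst hi
      exact ⟨f2, f1⟩
    · have hi : i ≠ I := by rintro rfl; exact hne (f1 c hcJ)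
      have hcJ' : c < J := by omega
      have g1 : ∀ r, r ≠ I → (u.val * M * v.val) r c = M r c := by
        intro r hr
        rw [f3 r c hr hcJ, hrow c hcJ', mul_zero, sub_zero]
      rw [g1 i hi] at hne
      obtain ⟨h1, h2⟩ := hM i c hcJ' hne
      refine ⟨fun i' hi' => ?_, fun c' hc' => ?_⟩
      · by_cases hI' : i' = I
        · rw [hI']; exact f1 c hcJ
        · rw [g1 i' hI']; exact h1 i' hi'
      · by_cases hJ' : c' = J
        · rw [hJ']; exact f2 i hi
        · rw [f3 i c' hi hJ', h2 J (by omega), h2 c' hc']; simp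
  · refine ⟨1, one_mem _, 1, one_mem _, ?_⟩
    intro i c hc hne
    simp only [Units.val_one, Matrix.one_mul, Matrix.mul_one] at hne ⊢
    rcases Nat.lt_succ_iff_lt_or_eq.1 hc with h | h
    · exact hM i c h hne
    · exact absurd ⟨c, h, i, hne⟩ hz

/-- Bruhat decomposition: unitriangular operations on both sides make a matrix monomial. -/
theorem exists_unipotent_mul_mul_monomial (M : Matrix (Fin n) (Fin n) F) :
    ∃ u ∈ unipotentFrom F n 1, ∃ u' ∈ unipotentFrom F n 1,
      IsMonomialUpTo n (u.val * M * u'.val) := by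
  have key : ∀ j : ℕ, ∃ u ∈ unipotentFrom F n 1, ∃ u' ∈ unipotentFrom F n 1,
      IsMonomialUpTo j (u.val * M * u'.val) := by
    intro j
    induction j with
    | zero => exact ⟨1, one_mem _, 1, one_mem _, fun i c h => absurd h (by omega)⟩
    | succ j ih =>
      obtain ⟨u, hu, v, hv, h⟩ := ih
      obtain ⟨u', hu', v', hv', h'⟩ := exists_unipotent_clear_column _ j h
      refine ⟨u' * u, mul_mem hu' hu, v * v', mul_mem hv hv', ?_⟩
      simpa only [Units.val_mul, Matrix.mul_assoc] using h'
  exact key n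

end Bruhat

section GelfandGraev

variable {F : Type*} [Field F] {n : ℕ}

variable (F n) in
/-- The matrix pairing, under the trace form, with the superdiagonal entries lying in the columns
`j ≥ k`. -/
def superdiagonalDual (k : ℕ) : Matrix (Fin n) (Fin n) F :=
  Matrix.of fun j i => if k ≤ j.val ∧ i.val + 1 = j.val then 1 else 0

theorem trace_superdiagonalDual_mul (k : ℕ) (M : Matrix (Fin n) (Fin n) F) :
    (superdiagonalDual F n k * M).trace =
      ∑ j : Fin n, ∑ i : Fin n, if k ≤ j.val ∧ i.val + 1 = j.val then M i j else 0 := by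
  simp [Matrix.trace, Matrix.mul_apply, superdiagonalDual]

theorem trace_superdiagonalDual_one (k : ℕ) : (superdiagonalDual F n k).trace = 0 := by
  simp [Matrix.trace, superdiagonalDual]

theorem trace_superdiagonalDual_mul_single (k : ℕ) (i j : Fin n) (t : F) :
    (superdiagonalDual F n k * Matrix.single i j t).trace =
      if k ≤ j.val ∧ i.val + 1 = j.val then t else 0 := by
  rw [Matrix.trace_mul_single]
  simp [superdiagonalDual]

theorem trace_superdiagonalDual_mul_mul {u v : Matrix (Fin n) (Fin n) F}
    (hu : IsUnitriangularFrom 1 u) (hv : IsUnitriangularFrom 1 v) :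
    (superdiagonalDual F n 1 * (u * v)).trace =
      (superdiagonalDual F n 1 * u).trace + (superdiagonalDual F n 1 * v).trace := by
  have h0 : (superdiagonalDual F n 1 * ((u - 1) * (v - 1))).trace = 0 := by
    rw [trace_superdiagonalDual_mul]
    refine Finset.sum_eq_zero fun j _ => Finset.sum_eq_zero fun i _ => ?_
    split_ifs with h
    · rw [Matrix.mul_apply]
      refine Finset.sum_eq_zero fun l _ => ?_
      rw [Matrix.sub_apply, Matrix.sub_apply]
      by_cases hl : i < l
      · rw [hv l j (by omega), sub_self, mul_zero]
      · rw [hu i l (by omega), sub_self, zero_mul]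
    · rfl
  have e : (u - 1) * (v - 1) = u * v - u - v + 1 := by noncomm_ring
  rw [e, Matrix.mul_add, Matrix.mul_sub, Matrix.mul_sub, Matrix.trace_add, Matrix.trace_sub,
    Matrix.trace_sub, Matrix.mul_one, trace_superdiagonalDual_one] at h0
  linear_combination h0

variable (F n) in
/-- The anti-involution of `GL n` given by reflection in the antidiagonal. -/
def antitransposeHom : GL (Fin n) F →* (GL (Fin n) F)ᵐᵒᵖ :=
  (Units.opEquiv : (Matrix (Fin n) (Fin n) F)ᵐᵒᵖˣ ≃* _).toMonoidHom.comp
    (Units.map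
      { toFun := fun M => MulOpposite.op (M.submatrix Fin.rev Fin.rev)ᵀ
        map_one' := by
          rw [Matrix.submatrix_one _ Fin.rev_injective, Matrix.transpose_one]; rfl
        map_mul' := fun M N => by
          rw [← Matrix.submatrix_mul_equiv M N Fin.rev Fin.revPerm Fin.rev, Matrix.transpose_mul]
          rfl })

/-- Reflection of an invertible matrix in the antidiagonal. -/
def antitranspose (g : GL (Fin n) F) : GL (Fin n) F := (antitransposeHom F n g).unop

theorem antitranspose_apply (g : GL (Fin n) F) (i j : Fin n) :
    (antitranspose g).val i j = g.val j.rev i.rev := rfl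

theorem antitranspose_antitranspose (g : GL (Fin n) F) : antitranspose (antitranspose g) = g := by
  apply Units.ext
  ext i j
  rw [antitranspose_apply, antitranspose_apply, Fin.rev_rev, Fin.rev_rev]

variable (F n) in
/-- The anti-involution of the group algebra of `GL n` induced by `antitranspose`. -/
noncomputable def antitransposeAlgHom :
    MonoidAlgebra ℂ (GL (Fin n) F) →ₐ[ℂ] (MonoidAlgebra ℂ (GL (Fin n) F))ᵐᵒᵖ :=
  MonoidAlgebra.lift _ _ _
    ((MonoidHom.op (MonoidAlgebra.of ℂ (GL (Fin n) F))).comp (antitransposeHom F n))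

theorem antitransposeAlgHom_of (g : GL (Fin n) F) :
    antitransposeAlgHom F n (MonoidAlgebra.of ℂ _ g) =
      MulOpposite.op (MonoidAlgebra.of ℂ _ (antitranspose g)) := by
  rw [antitransposeAlgHom, MonoidAlgebra.lift_of]
  rfl

theorem trace_superdiagonalDual_mul_antitranspose (g : GL (Fin n) F) :
    (superdiagonalDual F n 1 * (antitranspose g).val).trace =
      (superdiagonalDual F n 1 * g.val).trace := by
  rw [trace_superdiagonalDual_mul, trace_superdiagonalDual_mul, Finset.sum_comm]
  refine Fintype.sum_equiv Fin.revPerm _ _ fun i => Fintype.sum_equiv Fin.revPerm _ _ fun j => ?_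
  rw [antitranspose_apply]
  simp only [Fin.revPerm_apply, Fin.val_rev]
  congr 1
  apply propext
  omega

variable [Fintype F] (ψ : AddChar F ℂ)

open Classical in
/-- The inverse of the character of the unipotent group `unipotentFrom F n k` attached to the
superdiagonal entries in the columns `j ≥ k`, extended by zero to `GL n`. -/
noncomputable def whittakerFun (k : ℕ) (g : GL (Fin n) F) : ℂ :=
  if g ∈ unipotentFrom F n k then ψ (-(superdiagonalDual F n k * g.val).trace) else 0

theorem whittakerFun_mul {u : GL (Fin n) F} (hu : u ∈ unipotentFrom F n 1) (g : GL (Fin n) F) :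
    whittakerFun ψ 1 (u * g) =
      ψ (-(superdiagonalDual F n 1 * u.val).trace) * whittakerFun ψ 1 g := by
  unfold whittakerFun
  rw [Subgroup.mul_mem_cancel_left _ hu]
  split_ifs with h
  · rw [Units.val_mul, trace_superdiagonalDual_mul_mul hu h, neg_add, AddChar.map_add_eq_mul]
  · rw [mul_zero]

theorem whittakerFun_mul' {u : GL (Fin n) F} (hu : u ∈ unipotentFrom F n 1) (g : GL (Fin n) F) :
    whittakerFun ψ 1 (g * u) =
      ψ (-(superdiagonalDual F n 1 * u.val).trace) * whittakerFun ψ 1 g := by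
  unfold whittakerFun
  rw [Subgroup.mul_mem_cancel_right _ hu]
  split_ifs with h
  · rw [Units.val_mul, trace_superdiagonalDual_mul_mul h hu, neg_add, AddChar.map_add_eq_mul,
      mul_comm]
  · rw [mul_zero]

open Classical in
variable (n) in
/-- The (unnormalised) idempotent of the group algebra attached to the nondegenerate character of
the unitriangular group. -/
noncomputable def whittakerElement : MonoidAlgebra ℂ (GL (Fin n) F) :=
  ∑ g : GL (Fin n) F, whittakerFun ψ 1 g • MonoidAlgebra.of ℂ _ g

theorem of_mul_whittakerElement {u : GL (Fin n) F} (hu : u ∈ unipotentFrom F n 1) :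
    MonoidAlgebra.of ℂ _ u * whittakerElement n ψ =
      ψ ((superdiagonalDual F n 1 * u.val).trace) • whittakerElement n ψ := by
  classical
  unfold whittakerElement
  rw [Finset.mul_sum, Finset.smul_sum]
  refine Fintype.sum_equiv (Equiv.mulLeft u) _ _ fun g => ?_
  rw [Equiv.coe_mulLeft, whittakerFun_mul ψ hu, smul_smul, ← mul_assoc, ← AddChar.map_add_eq_mul,
    add_neg_cancel, AddChar.map_zero_eq_one, one_mul, map_mul, mul_smul_comm]

theorem whittakerElement_mul_of {u : GL (Fin n) F} (hu : u ∈ unipotentFrom F n 1) :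
    whittakerElement n ψ * MonoidAlgebra.of ℂ _ u =
      ψ ((superdiagonalDual F n 1 * u.val).trace) • whittakerElement n ψ := by
  classical
  unfold whittakerElement
  rw [Finset.sum_mul, Finset.smul_sum]
  refine Fintype.sum_equiv (Equiv.mulRight u) _ _ fun g => ?_
  rw [Equiv.coe_mulRight, whittakerFun_mul' ψ hu, smul_smul, ← mul_assoc, ← AddChar.map_add_eq_mul,
    add_neg_cancel, AddChar.map_zero_eq_one, one_mul, map_mul, smul_mul_assoc]

theorem whittakerElement_mul_self :
    whittakerElement n ψ * whittakerElement n ψ =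
      (Nat.card (unipotentFrom F n 1) : ℂ) • whittakerElement n ψ := by
  classical
  nth_rewrite 1 [whittakerElement]
  rw [Finset.sum_mul]
  have : ∀ g : GL (Fin n) F, whittakerFun ψ 1 g • MonoidAlgebra.of ℂ _ g * whittakerElement n ψ =
      (if g ∈ unipotentFrom F n 1 then (1 : ℂ) else 0) • whittakerElement n ψ := by
    intro g
    by_cases h : g ∈ unipotentFrom F n 1
    · rw [smul_mul_assoc, of_mul_whittakerElement ψ h, smul_smul, whittakerFun, if_pos h, if_pos h,
        ← AddChar.map_add_eq_mul, neg_add_cancel, AddChar.map_zero_eq_one]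
    · rw [whittakerFun, if_neg h, if_neg h, zero_smul, zero_smul, zero_mul]
  simp only [this]
  rw [← Finset.sum_smul, Finset.sum_boole, Nat.card_eq_fintype_card, Fintype.card_subtype]

theorem antitranspose_mem {u : GL (Fin n) F} (hu : u ∈ unipotentFrom F n 1) :
    antitranspose u ∈ unipotentFrom F n 1 := by
  intro i j hij
  rw [antitranspose_apply, hu _ _ (by simp only [Fin.lt_def, Fin.val_rev]; omega)]
  simp only [Matrix.one_apply, Fin.rev_inj, eq_comm]

theorem whittakerFun_antitranspose (g : GL (Fin n) F) :
    whittakerFun ψ 1 (antitranspose g) = whittakerFun ψ 1 g := by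
  have h : antitranspose g ∈ unipotentFrom F n 1 ↔ g ∈ unipotentFrom F n 1 :=
    ⟨fun h => antitranspose_antitranspose g ▸ antitranspose_mem h, antitranspose_mem⟩
  by_cases hg : g ∈ unipotentFrom F n 1
  · rw [whittakerFun, whittakerFun, if_pos (h.2 hg), if_pos hg,
      trace_superdiagonalDual_mul_antitranspose]
  · rw [whittakerFun, whittakerFun, if_neg (mt h.1 hg), if_neg hg]

theorem antitransposeAlgHom_whittakerElement :
    antitransposeAlgHom F n (whittakerElement n ψ) = MulOpposite.op (whittakerElement n ψ) := by
  classical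
  rw [whittakerElement, map_sum, Finset.op_sum]
  refine Fintype.sum_equiv
    ⟨antitranspose, antitranspose, antitranspose_antitranspose, antitranspose_antitranspose⟩ _ _
    fun g => ?_
  rw [map_smul, antitransposeAlgHom_of, Equiv.coe_fn_mk, whittakerFun_antitranspose,
    MulOpposite.op_smul]

variable {ψ}

/-- If the double coset of a monomial matrix supports a Whittaker function, then its entries in two
consecutive rows satisfy a compatibility. -/
theorem adjacent_rows_of_whittakerElement_ne_zero (hψ : ψ ≠ 0) {m : GL (Fin n) F}
    (hm : IsMonomialUpTo n m.val)
    (hne : whittakerElement n ψ * MonoidAlgebra.of ℂ _ m * whittakerElement n ψ ≠ 0)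
    {i i' j j' : Fin n} (hi : i'.val = i.val + 1) (hj : j < j') (h1 : m.val i j ≠ 0)
    (h2 : m.val i' j' ≠ 0) : j'.val = j.val + 1 ∧ m.val i' j' = m.val i j := by
  have key : ∀ t : F, ψ t =
      ψ (if j.val + 1 = j'.val then t * m.val i' j' / m.val i j else 0) := by
    intro t
    have hun : ∀ (a b : Fin n) (s : F), a < b →
        IsUnitriangularFrom 1 (1 + Matrix.single a b s) := by
      intro a b s hab c d hcd
      rw [Matrix.add_apply, Matrix.single_apply, if_neg, add_zero]
      rintro ⟨rfl, rfl⟩; omega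
    have htr : ∀ (a b : Fin n) (s : F), (superdiagonalDual F n 1 * (1 + Matrix.single a b s)).trace
        = if a.val + 1 = b.val then s else 0 := by
      intro a b s
      rw [Matrix.mul_add, Matrix.trace_add, Matrix.mul_one, trace_superdiagonalDual_one, zero_add,
        trace_superdiagonalDual_mul_single]
      congr 1
      apply propext
      omega
    obtain ⟨u, hu, hu'⟩ := (hun i i' t (by omega)).exists_mem
    obtain ⟨v, hv, hv'⟩ := (hun j j' (t * m.val i' j' / m.val i j) hj).exists_mem
    have hcomm : u * m = m * v := by
      apply Units.ext
      rw [Units.val_mul, Units.val_mul, hu', hv', Matrix.add_mul, Matrix.mul_add, Matrix.one_mul,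
        Matrix.mul_one]
      congr 1
      ext a b
      by_cases ha : a = i
      · subst ha
        by_cases hb : b = j'
        · subst hb
          rw [Matrix.single_mul_apply_same, Matrix.mul_single_apply_same]
          field_simp
        · rw [Matrix.single_mul_apply_same, Matrix.mul_single_apply_of_ne _ _ _ _ _ hb,
            (hm i' j' j'.2 h2).2 b hb, mul_zero]
      · rw [Matrix.single_mul_apply_of_ne _ _ _ _ _ ha]
        by_cases hb : b = j'
        · subst hb
          rw [Matrix.mul_single_apply_same, (hm i j j.2 h1).1 a ha, zero_mul]
        · rw [Matrix.mul_single_apply_of_ne _ _ _ _ _ hb]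
    have e1 : whittakerElement n ψ * MonoidAlgebra.of ℂ _ (u * m) * whittakerElement n ψ =
        ψ t • (whittakerElement n ψ * MonoidAlgebra.of ℂ _ m * whittakerElement n ψ) := by
      rw [map_mul, ← mul_assoc, whittakerElement_mul_of ψ hu, smul_mul_assoc, smul_mul_assoc, hu',
        htr, if_pos hi.symm]
    have e2 : whittakerElement n ψ * MonoidAlgebra.of ℂ _ (m * v) * whittakerElement n ψ =
        ψ (if j.val + 1 = j'.val then t * m.val i' j' / m.val i j else 0) •
          (whittakerElement n ψ * MonoidAlgebra.of ℂ _ m * whittakerElement n ψ) := by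
      rw [map_mul, ← mul_assoc, mul_assoc _ _ (whittakerElement n ψ), of_mul_whittakerElement ψ hv,
        mul_smul_comm, hv', htr]
    rw [hcomm, e2] at e1
    exact (smul_left_injective ℂ hne e1).symm
  obtain ⟨t, ht⟩ := (AddChar.ne_zero_iff).1 hψ
  have hjj : j.val + 1 = j'.val := by
    by_contra h
    apply ht
    rw [key t, if_neg h, AddChar.map_zero_eq_one]
  refine ⟨hjj.symm, ?_⟩
  simp only [if_pos hjj] at key
  by_contra hd
  apply ht
  have hs : m.val i j - m.val i' j' ≠ 0 := sub_ne_zero.2 (Ne.symm hd)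
  have h3 := key (t * m.val i j / (m.val i j - m.val i' j'))
  have h4 : t * m.val i j / (m.val i j - m.val i' j') =
      t + t * m.val i j / (m.val i j - m.val i' j') * m.val i' j' / m.val i j := by
    field_simp
    ring
  nth_rewrite 1 [h4] at h3
  rw [AddChar.map_add_eq_mul] at h3
  exact mul_right_cancel₀ (AddChar.val_isUnit ψ _).ne_zero (by rw [h3, one_mul])

/-- A monomial matrix whose double coset supports a Whittaker function is symmetric with respect to
the antidiagonal. -/
theorem antitranspose_eq_of_whittakerElement_ne_zero (hψ : ψ ≠ 0) {m : GL (Fin n) F}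
    (hm : IsMonomialUpTo n m.val)
    (hne : whittakerElement n ψ * MonoidAlgebra.of ℂ _ m * whittakerElement n ψ ≠ 0) :
    antitranspose m = m := by
  have hex : ∀ i, ∃ j, m.val i j ≠ 0 := by
    intro i
    by_contra! h
    have hdet : m.val.det ≠ 0 := ((Matrix.isUnit_iff_isUnit_det _).1 m.isUnit).ne_zero
    exact hdet (Matrix.det_eq_zero_of_row_eq_zero i h)
  choose c hc using hex
  have hz : ∀ i j, j ≠ c i → m.val i j = 0 := fun i j h => (hm i (c i) (c i).2 (hc i)).2 j h
  have hinj : Function.Injective c := by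
    intro a b hab
    by_contra hne
    exact hc a ((hm b (c b) (c b).2 (hc b)).1 a hne ▸ by rw [hab])
  have hadj : ∀ i i' : Fin n, i'.val = i.val + 1 → c i < c i' →
      (c i').val = (c i).val + 1 ∧ m.val i' (c i') = m.val i (c i) := fun i i' hi h =>
    adjacent_rows_of_whittakerElement_ne_zero hψ hm hne hi h (hc i) (hc i')
  let κ : Equiv.Perm (Fin n) :=
    (Equiv.ofBijective c (Finite.injective_iff_bijective.1 hinj)).trans Fin.revPerm
  have hκ : ∀ i, κ i = (c i).rev := fun i => rfl
  have H : ∀ p p' : Fin n, (κ.symm p').val = (κ.symm p).val + 1 → p' < p →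
      p.val = p'.val + 1 := by
    intro p p' h hp
    obtain ⟨i, rfl⟩ := κ.surjective p
    obtain ⟨i', rfl⟩ := κ.surjective p'
    rw [Equiv.symm_apply_apply, Equiv.symm_apply_apply] at h
    rw [hκ, hκ, Fin.rev_lt_rev] at hp
    have := (hadj i i' h hp).1
    rw [hκ, hκ, Fin.val_rev, Fin.val_rev]
    omega
  have hinv : ∀ i, κ (κ i) = i := by
    intro i
    have := perm_involutive_of_descents κ.symm H (κ (κ i))
    rw [Equiv.symm_apply_apply, Equiv.symm_apply_apply] at this
    exact this.symm
  have hsymm : κ.symm = κ := by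
    ext i
    rw [← hinv i, Equiv.symm_apply_apply, hinv]
  have hd := apply_perm_eq_of_descents κ (fun i => m.val i (c i)) (hsymm ▸ H) (by
    intro p p' h hp
    rw [hκ, hκ, Fin.rev_lt_rev] at hp
    exact (hadj p p' h hp).2)
  have hrev : ∀ i, c (c i).rev = i.rev := by
    intro i
    have := hinv i
    rw [hκ, hκ] at this
    exact Fin.rev_inj.1 (by rw [Fin.rev_rev]; exact this)
  apply Units.ext
  ext i j
  rw [antitranspose_apply]
  by_cases h : j = c i
  · subst h
    have := hd i
    simp only [hκ, hrev] at this
    exact this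
  · rw [hz i j h, hz]
    intro h'
    apply h
    have := hrev j.rev
    rw [← h', Fin.rev_rev, Fin.rev_rev] at this
    exact this.symm

theorem antitransposeAlgHom_whittakerElement_mul_mul (hψ : ψ ≠ 0)
    (x : MonoidAlgebra ℂ (GL (Fin n) F)) :
    antitransposeAlgHom F n (whittakerElement n ψ * x * whittakerElement n ψ) =
      MulOpposite.op (whittakerElement n ψ * x * whittakerElement n ψ) := by
  induction x using MonoidAlgebra.induction_on with
  | of g =>
    obtain ⟨u, hu, v, hv, h⟩ := exists_unipotent_mul_mul_monomial g.val
    obtain ⟨m, hm⟩ : ∃ m, m = u * g * v := ⟨_, rfl⟩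
    have hmon : IsMonomialUpTo n m.val := by rw [hm]; exact h
    have hg : MonoidAlgebra.of ℂ _ g = MonoidAlgebra.of ℂ _ u⁻¹ * MonoidAlgebra.of ℂ _ m *
        MonoidAlgebra.of ℂ _ v⁻¹ := by
      rw [← map_mul, ← map_mul, hm]
      congr 1
      group
    have e : whittakerElement n ψ * MonoidAlgebra.of ℂ _ g * whittakerElement n ψ =
        (ψ ((superdiagonalDual F n 1 * u⁻¹.val).trace) *
          ψ ((superdiagonalDual F n 1 * v⁻¹.val).trace)) •
          (whittakerElement n ψ * MonoidAlgebra.of ℂ _ m * whittakerElement n ψ) := by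
      rw [hg, ← mul_assoc, ← mul_assoc, whittakerElement_mul_of ψ (inv_mem hu), mul_assoc _ _
        (whittakerElement n ψ), of_mul_whittakerElement ψ (inv_mem hv), smul_mul_assoc,
        mul_smul_comm, smul_mul_assoc, smul_smul, mul_comm]
    rw [e, map_smul, MulOpposite.op_smul]
    congr 1
    by_cases hne : whittakerElement n ψ * MonoidAlgebra.of ℂ _ m * whittakerElement n ψ = 0
    · rw [hne, map_zero, MulOpposite.op_zero]
    · rw [map_mul, map_mul, antitransposeAlgHom_whittakerElement, antitransposeAlgHom_of,
        antitranspose_eq_of_whittakerElement_ne_zero hψ hmon hne, ← MulOpposite.op_mul,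
        ← MulOpposite.op_mul, mul_assoc]
  | add x y hx hy => rw [mul_add, add_mul, map_add, hx, hy, MulOpposite.op_add]
  | smul r x hx =>
    rw [mul_smul_comm, smul_mul_assoc, map_smul, hx, MulOpposite.op_smul]

/-- The endomorphism algebra of the Gelfand-Graev representation is commutative. -/
theorem whittakerElement_commute (hψ : ψ ≠ 0) (x y : MonoidAlgebra ℂ (GL (Fin n) F)) :
    Commute (whittakerElement n ψ * x * whittakerElement n ψ)
      (whittakerElement n ψ * y * whittakerElement n ψ) := by
  have h := antitransposeAlgHom_whittakerElement_mul_mul hψ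
    (x * whittakerElement n ψ * (whittakerElement n ψ * y))
  have e : whittakerElement n ψ * (x * whittakerElement n ψ * (whittakerElement n ψ * y)) *
      whittakerElement n ψ = whittakerElement n ψ * x * whittakerElement n ψ *
        (whittakerElement n ψ * y * whittakerElement n ψ) := by
    simp only [mul_assoc]
  rw [e, map_mul, antitransposeAlgHom_whittakerElement_mul_mul hψ,
    antitransposeAlgHom_whittakerElement_mul_mul hψ, ← MulOpposite.op_mul] at h
  exact (MulOpposite.op_injective h).symm

end GelfandGraev

section WhittakerModel

variable {F : Type*} [Field F] [Fintype F] {n : ℕ} {ψ : AddChar F ℂ}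
  {V : Type*} [AddCommGroup V] [Module ℂ V]

theorem IsIrreducibleRep.exists_asAlgebraHom_apply_eq {G : Type*} [Group G]
    {ρ : Representation ℂ G V} (hρ : IsIrreducibleRep ρ) {w : V} (hw : w ≠ 0) (v : V) :
    ∃ x : MonoidAlgebra ℂ G, ρ.asAlgebraHom x w = v := by
  let W : Submodule ℂ V := LinearMap.range ((LinearMap.applyₗ w).comp ρ.asAlgebraHom.toLinearMap)
  have hmem : ∀ v, v ∈ W ↔ ∃ x : MonoidAlgebra ℂ G, ρ.asAlgebraHom x w = v := fun v => Iff.rfl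
  have hW : RepInvariant ρ W := by
    intro g v hv
    obtain ⟨x, rfl⟩ := (hmem v).1 hv
    refine (hmem _).2 ⟨MonoidAlgebra.of ℂ G g * x, ?_⟩
    rw [map_mul, Representation.asAlgebraHom_of]
    rfl
  rcases hρ.2 W hW with h | h
  · exfalso
    have : w ∈ W := (hmem w).2 ⟨1, by rw [map_one]; rfl⟩
    rw [h] at this
    exact hw ((Submodule.mem_bot ℂ).1 this)
  · exact (hmem v).1 (h ▸ Submodule.mem_top)

variable [FiniteDimensional ℂ V]

/-- Uniqueness of Whittaker models. -/
theorem finrank_range_whittakerElement_le_one (hψ : ψ ≠ 0)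
    {ρ : Representation ℂ (GL (Fin n) F) V} (hρ : IsIrreducibleRep ρ) :
    Module.finrank ℂ (LinearMap.range (ρ.asAlgebraHom (whittakerElement n ψ))) ≤ 1 := by
  obtain ⟨E, hE⟩ : ∃ E, E = whittakerElement n ψ := ⟨_, rfl⟩
  rw [← hE]
  obtain ⟨W, hW⟩ : ∃ W, W = LinearMap.range (ρ.asAlgebraHom E) := ⟨_, rfl⟩
  rw [← hW]
  have hcard : (Nat.card (unipotentFrom F n 1) : ℂ) ≠ 0 := by
    exact_mod_cast Nat.card_pos.ne'
  have hEW : ∀ w ∈ W, ρ.asAlgebraHom E w = (Nat.card (unipotentFrom F n 1) : ℂ) • w := by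
    intro w hw
    rw [hW] at hw
    obtain ⟨v, rfl⟩ := hw
    have := congrArg (fun x => ρ.asAlgebraHom x v) (whittakerElement_mul_self (n := n) ψ)
    rw [← hE] at this
    simpa using this
  have hmap : ∀ x v, ρ.asAlgebraHom (E * x * E) v ∈ W := by
    intro x v
    rw [hW, mul_assoc, map_mul]
    exact ⟨_, rfl⟩
  have htrans : ∀ w ∈ W, w ≠ 0 → ∀ v ∈ W, ∃ x, ρ.asAlgebraHom (E * x * E) w = v := by
    intro w hw hw0 v hv
    obtain ⟨x, hx⟩ := hρ.exists_asAlgebraHom_apply_eq hw0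
      (((Nat.card (unipotentFrom F n 1) : ℂ)⁻¹ * (Nat.card (unipotentFrom F n 1) : ℂ)⁻¹) • v)
    refine ⟨x, ?_⟩
    rw [map_mul, map_mul, Module.End.mul_apply, Module.End.mul_apply, hEW w hw, map_smul, hx,
      map_smul, map_smul, hEW v hv, smul_smul, smul_smul]
    convert one_smul ℂ v using 2
    field_simp
  have hscalar : ∀ x, ∃ c : ℂ, ∀ w ∈ W, ρ.asAlgebraHom (E * x * E) w = c • w := by
    intro x
    by_cases hnt : Nontrivial W
    · obtain ⟨c, hc⟩ := Module.End.exists_eigenvalue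
        ((ρ.asAlgebraHom (E * x * E)).restrict (p := W) (q := W) fun w _ => hmap x w)
      obtain ⟨w, hw⟩ := hc.exists_hasEigenvector
      refine ⟨c, fun v hv => ?_⟩
      have hw0 : (w : V) ≠ 0 := fun h => hw.2 (Subtype.ext h)
      have hwe : ρ.asAlgebraHom (E * x * E) w = c • (w : V) :=
        congrArg Subtype.val hw.apply_eq_smul
      obtain ⟨y, rfl⟩ := htrans w w.2 hw0 v hv
      have hcomm := whittakerElement_commute (n := n) hψ x y
      rw [← hE] at hcomm
      have := congrArg (fun z => ρ.asAlgebraHom z (w : V)) hcomm.eq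
      simp only [map_mul ρ.asAlgebraHom (E * x * E), map_mul ρ.asAlgebraHom (E * y * E),
        Module.End.mul_apply] at this
      rw [this, hwe, map_smul]
    · refine ⟨0, fun w hw => ?_⟩
      have := not_nontrivial_iff_subsingleton.1 hnt
      have h0 : w = 0 := congrArg Subtype.val (Subsingleton.elim (⟨w, hw⟩ : W) 0)
      rw [h0, map_zero, smul_zero]
  by_cases hnt : ∃ w ∈ W, w ≠ 0
  · obtain ⟨w, hw, hw0⟩ := hnt
    refine finrank_le_one (⟨w, hw⟩ : W) fun v => ?_
    obtain ⟨x, hx⟩ := htrans w hw hw0 v v.2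
    obtain ⟨c, hc⟩ := hscalar x
    exact ⟨c, Subtype.ext ((hc w hw).symm.trans hx)⟩
  · push Not at hnt
    refine finrank_le_one (0 : W) fun v => ⟨0, ?_⟩
    rw [smul_zero]
    exact Subtype.ext (hnt v v.2).symm

theorem trace_asAlgebraHom_whittakerElement (ρ : Representation ℂ (GL (Fin n) F) V) :
    LinearMap.trace ℂ V (ρ.asAlgebraHom (whittakerElement n ψ)) =
      Nat.card (unipotentFrom F n 1) *
        Module.finrank ℂ (LinearMap.range (ρ.asAlgebraHom (whittakerElement n ψ))) := by
  obtain ⟨c, hc⟩ : ∃ c : ℂ, c = Nat.card (unipotentFrom F n 1) := ⟨_, rfl⟩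
  have hc0 : c ≠ 0 := by rw [hc]; exact_mod_cast Nat.card_pos.ne'
  obtain ⟨T, hT⟩ : ∃ T, T = ρ.asAlgebraHom (whittakerElement n ψ) := ⟨_, rfl⟩
  have hTT : T * T = c • T := by
    rw [hT, ← map_mul, whittakerElement_mul_self, map_smul, hc]
  rw [← hT, ← hc]
  have hid : IsIdempotentElem (c⁻¹ • T) := by
    rw [IsIdempotentElem, smul_mul_smul_comm, hTT, smul_smul]
    congr 1
    field_simp
  have h1 := (LinearMap.IsIdempotentElem.isProj_range _ hid).trace
  have hr : LinearMap.range (c⁻¹ • T) = LinearMap.range T :=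
    LinearMap.range_smul _ _ (inv_ne_zero hc0)
  rw [hr, map_smul, smul_eq_mul] at h1
  rw [← h1]
  field_simp

end WhittakerModel

section CornerMatrix

variable {F : Type*} [Field F] {n : ℕ}

/-- Matrices which agree with the identity outside the top-left `k × k` corner. -/
def IsCornerMatrix (k : ℕ) (M : Matrix (Fin n) (Fin n) F) : Prop :=
  ∀ i j : Fin n, k ≤ i.val ∨ k ≤ j.val → M i j = (1 : Matrix (Fin n) (Fin n) F) i j

theorem IsCornerMatrix.inv {k : ℕ} {h : GL (Fin n) F} (hh : IsCornerMatrix k h.val) :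
    IsCornerMatrix k h⁻¹.val := by
  intro i j hij
  rcases hij with hi | hj
  · have : (h.val * h⁻¹.val) i j = (1 : Matrix (Fin n) (Fin n) F) i j := by rw [Units.mul_inv]
    rw [Matrix.mul_apply, Finset.sum_eq_single i, hh i i (Or.inl hi), one_apply_eq, one_mul] at this
    · exact this
    · intro l _ hl
      rw [hh i l (Or.inl hi), one_apply_ne hl.symm, zero_mul]
    · simp
  · have : (h⁻¹.val * h.val) i j = (1 : Matrix (Fin n) (Fin n) F) i j := by rw [Units.inv_mul]
    rw [Matrix.mul_apply, Finset.sum_eq_single j, hh j j (Or.inl hj), one_apply_eq, mul_one] at this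
    · exact this
    · intro l _ hl
      rw [hh l j (Or.inr hj), one_apply_ne hl, mul_zero]
    · simp

theorem IsCornerMatrix.conj_mem [Finite F] {k : ℕ} {h g : GL (Fin n) F}
    (hh : IsCornerMatrix k h.val) (hg : g ∈ unipotentFrom F n k) :
    h * g * h⁻¹ ∈ unipotentFrom F n k := by
  have hinv := hh.inv
  intro i j hij
  rw [Units.val_mul, Units.val_mul]
  by_cases hj : k ≤ j.val
  · rw [Matrix.mul_apply, Finset.sum_eq_single j, hinv j j (Or.inl hj), one_apply_eq, mul_one,
      Matrix.mul_apply, Finset.sum_eq_single i, hh i i (Or.inl (by omega)), one_apply_eq, one_mul,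
      hg i j hij]
    · intro l _ hl
      rw [hh i l (Or.inl (by omega)), one_apply_ne hl.symm, zero_mul]
    · simp
    · intro l _ hl
      rw [hinv l j (Or.inr hj), one_apply_ne hl, mul_zero]
    · simp
  · rw [← Units.mul_inv h, Matrix.mul_apply, Matrix.mul_apply]
    refine Finset.sum_congr rfl fun m _ => ?_
    by_cases hm : k ≤ m.val
    · rw [hinv m j (Or.inl hm), one_apply_ne (by omega), mul_zero, mul_zero]
    · congr 1
      rw [Matrix.mul_apply]
      have : ∀ l, g.val l m = (1 : Matrix (Fin n) (Fin n) F) l m := fun l => hg l m (by omega)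
      simp only [this]
      rw [← Matrix.mul_apply, Matrix.mul_one]

theorem superdiagonalDual_mul_eq_self {k : ℕ} {M : Matrix (Fin n) (Fin n) F}
    (hM : ∀ i j : Fin n, k ≤ i.val → M i j = (1 : Matrix (Fin n) (Fin n) F) i j) :
    superdiagonalDual F n (k + 1) * M = superdiagonalDual F n (k + 1) := by
  rw [← Matrix.mul_one (superdiagonalDual F n (k + 1)), Matrix.mul_assoc, Matrix.one_mul]
  ext i j
  rw [Matrix.mul_apply, Matrix.mul_apply]
  refine Finset.sum_congr rfl fun l _ => ?_
  by_cases hl : k ≤ l.val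
  · rw [hM l j hl]
  · rw [superdiagonalDual, Matrix.of_apply, if_neg (by omega), zero_mul, zero_mul]

theorem mul_superdiagonalDual_eq_self {k : ℕ} {M : Matrix (Fin n) (Fin n) F}
    (hM : ∀ i j : Fin n, k ≤ j.val → M i j = (1 : Matrix (Fin n) (Fin n) F) i j) :
    M * superdiagonalDual F n (k + 1) = superdiagonalDual F n (k + 1) := by
  rw [← Matrix.one_mul (superdiagonalDual F n (k + 1)), ← Matrix.mul_assoc, Matrix.mul_one]
  ext i j
  rw [Matrix.mul_apply, Matrix.mul_apply]
  refine Finset.sum_congr rfl fun l _ => ?_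
  by_cases hl : k ≤ l.val
  · rw [hM i l hl]
  · rw [superdiagonalDual, Matrix.of_apply, if_neg (by omega), mul_zero, mul_zero]

/-- The matrix pairing, under the trace form, with the superdiagonal entries in the columns `j > K`
and, through the vector `b`, with the entries of the column `K`. -/
def columnDual (K : Fin n) (b : Fin n → F) : Matrix (Fin n) (Fin n) F :=
  vecMulVec (Pi.single K 1) b + superdiagonalDual F n (K.val + 1)

theorem columnDual_single {K K' : Fin n} (h : K'.val + 1 = K.val) :
    columnDual K (Pi.single K' (1 : F)) = superdiagonalDual F n K := by
  ext i j
  rw [columnDual, Matrix.add_apply, vecMulVec_apply, superdiagonalDual, superdiagonalDual,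
    Matrix.of_apply, Matrix.of_apply, Pi.single_apply, Pi.single_apply]
  by_cases hi : i = K
  · subst hi
    by_cases hj : j = K'
    · subst hj; simp [h]
    · have hj' : j.val ≠ K'.val := fun h' => hj (Fin.ext h')
      rw [if_neg hj, mul_zero, if_neg (by omega), if_neg (by omega), zero_add]
  · rw [if_neg hi, zero_mul, zero_add]
    congr 1
    apply propext
    omega

theorem trace_columnDual_mul (K : Fin n) (b : Fin n → F) (M : Matrix (Fin n) (Fin n) F) :
    (columnDual K b * M).trace = (b ᵥ* M) K + (superdiagonalDual F n (K.val + 1) * M).trace := by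
  rw [columnDual, Matrix.add_mul, Matrix.trace_add, vecMulVec_mul, trace_vecMulVec,
    single_one_dotProduct]

theorem columnDual_mul {K : Fin n} {M : Matrix (Fin n) (Fin n) F}
    (hM : IsCornerMatrix K.val M) (b : Fin n → F) :
    columnDual K b * M = columnDual K (b ᵥ* M) := by
  rw [columnDual, Matrix.add_mul, vecMulVec_mul,
    superdiagonalDual_mul_eq_self fun i j h => hM i j (Or.inl h), columnDual]

theorem mul_columnDual {K : Fin n} {M : Matrix (Fin n) (Fin n) F}
    (hM : IsCornerMatrix K.val M) (b : Fin n → F) :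
    M * columnDual K b = columnDual K b := by
  rw [columnDual, Matrix.mul_add, mul_vecMulVec,
    mul_superdiagonalDual_eq_self fun i j h => hM i j (Or.inr h)]
  congr 2
  ext i
  rw [mulVec_single_one, col_apply, hM i K (Or.inr le_rfl), Matrix.one_apply, Pi.single_apply]

/-- Extension by zero of a vector indexed by the first `K` coordinates. -/
def extendZero (K : Fin n) : (Fin K.val → F) →ₗ[F] (Fin n → F) where
  toFun a i := if h : i.val < K.val then a ⟨i, h⟩ else 0
  map_add' a b := by ext i; simp only [Pi.add_apply]; split_ifs <;> simp
  map_smul' c a := by ext i; simp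

theorem extendZero_single (K : Fin n) (i : Fin K.val) :
    extendZero K (Pi.single i (1 : F)) = Pi.single ⟨i.val, by omega⟩ 1 := by
  ext j
  simp only [extendZero, LinearMap.coe_mk, AddHom.coe_mk, Pi.single_apply]
  split_ifs with h1 h2 h3 h4 <;> simp_all [Fin.ext_iff]

end CornerMatrix

section Derivative

variable {F : Type*} [Field F] [Fintype F] {n : ℕ} (ψ : AddChar F ℂ)

open Classical in
/-- The inverse of the character of `unipotentFrom F n K` attached to `columnDual K b`, extended by
zero to `GL n`. -/
noncomputable def columnFun (K : Fin n) (b : Fin n → F) (g : GL (Fin n) F) : ℂ :=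
  if g ∈ unipotentFrom F n K.val then ψ (-(columnDual K b * g.val).trace) else 0

theorem columnFun_single {K K' : Fin n} (h : K'.val + 1 = K.val) :
    columnFun ψ K (Pi.single K' 1) = whittakerFun ψ K.val := by
  funext g
  rw [columnFun, whittakerFun, columnDual_single h]

variable {ψ}

theorem mem_unipotentFrom_succ_iff {K : Fin n} {g : GL (Fin n) F} :
    g ∈ unipotentFrom F n (K.val + 1) ↔
      g ∈ unipotentFrom F n K.val ∧ ∀ i : Fin n, i < K → g.val i K = 0 := by
  constructor
  · intro h
    refine ⟨fun i j hij => h i j (by omega), fun i hi => ?_⟩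
    rw [h i K (by omega), one_apply_ne (by omega)]
  · rintro ⟨h1, h2⟩ i j hij
    by_cases h : i < j ∧ K.val ≤ j.val
    · have hj : j = K := by omega
      subst hj
      rw [h2 i h.1, one_apply_ne (by omega)]
    · exact h1 i j h

theorem sum_columnFun (hψ : ψ ≠ 0) (K : Fin n) (g : GL (Fin n) F) :
    ∑ a : Fin K.val → F, columnFun ψ K (extendZero K a) g =
      (Fintype.card F : ℂ) ^ K.val * whittakerFun ψ (K.val + 1) g := by
  classical
  by_cases hg : g ∈ unipotentFrom F n K.val
  · let L : (Fin K.val → F) →+ F :=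
      { toFun := fun a => -(extendZero K a ᵥ* g.val) K
        map_zero' := by simp
        map_add' := fun a b => by rw [map_add, Matrix.add_vecMul, Pi.add_apply, neg_add] }
    have hL : ∀ a, columnFun ψ K (extendZero K a) g = ψ.compAddMonoidHom L a *
        ψ (-(superdiagonalDual F n (K.val + 1) * g.val).trace) := by
      intro a
      rw [columnFun, if_pos hg, trace_columnDual_mul, neg_add, AddChar.map_add_eq_mul]
      rfl
    simp only [hL]
    rw [← Finset.sum_mul, AddChar.sum_eq_ite]
    have hiff : ψ.compAddMonoidHom L = 0 ↔ ∀ i : Fin n, i < K → g.val i K = 0 := by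
      constructor
      · intro h i hi
        by_contra hne
        obtain ⟨t, ht⟩ := AddChar.ne_zero_iff.1 hψ
        apply ht
        have h1 := AddChar.eq_zero_iff.1 h
          ((-(t / g.val i K)) • (Pi.single (⟨i.val, hi⟩ : Fin K.val) (1 : F)))
        have h2 : L ((-(t / g.val i K)) • (Pi.single (⟨i.val, hi⟩ : Fin K.val) (1 : F))) = t := by
          change -(extendZero K _ ᵥ* g.val) K = t
          rw [map_smul, extendZero_single, Matrix.smul_vecMul, single_one_vecMul, Pi.smul_apply,
            row_apply, smul_eq_mul]
          field_simp
        rw [AddChar.compAddMonoidHom_apply, h2] at h1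
        exact h1
      · intro h
        rw [AddChar.eq_zero_iff]
        intro a
        have : L a = 0 := by
          change -(extendZero K a ᵥ* g.val) K = 0
          rw [neg_eq_zero, Matrix.vecMul, dotProduct]
          refine Finset.sum_eq_zero fun i _ => ?_
          by_cases hi : i < K
          · rw [h i hi, mul_zero]
          · have : extendZero K a i = 0 := dif_neg (by omega)
            rw [this, zero_mul]
        rw [AddChar.compAddMonoidHom_apply, this, AddChar.map_zero_eq_one]
    rw [whittakerFun]
    by_cases h : ∀ i : Fin n, i < K → g.val i K = 0
    · rw [if_pos (hiff.2 h), if_pos (mem_unipotentFrom_succ_iff.2 ⟨hg, h⟩)]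
      simp
    · rw [if_neg (mt hiff.1 h), if_neg (fun h' => h (mem_unipotentFrom_succ_iff.1 h').2)]
      simp
  · rw [whittakerFun, if_neg (fun h' => hg (mem_unipotentFrom_succ_iff.1 h').1), mul_zero]
    exact Finset.sum_eq_zero fun a _ => if_neg hg

theorem columnFun_conj {K : Fin n} {h : GL (Fin n) F} (hh : IsCornerMatrix K.val h.val)
    (b : Fin n → F) (g : GL (Fin n) F) :
    columnFun ψ K b (h * g * h⁻¹) = columnFun ψ K (b ᵥ* h.val) g := by
  have hmem : h * g * h⁻¹ ∈ unipotentFrom F n K.val ↔ g ∈ unipotentFrom F n K.val := by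
    refine ⟨fun H => ?_, hh.conj_mem⟩
    have := IsCornerMatrix.conj_mem (h := h⁻¹) hh.inv H
    rwa [show h⁻¹ * (h * g * h⁻¹) * h⁻¹⁻¹ = g by group] at this
  have htr : (columnDual K b * (h * g * h⁻¹).val).trace =
      (columnDual K (b ᵥ* h.val) * g.val).trace := by
    rw [Units.val_mul, Units.val_mul, ← Matrix.mul_assoc, ← Matrix.mul_assoc, columnDual_mul hh,
      Matrix.trace_mul_cycle, mul_columnDual hh.inv]
  by_cases hg : g ∈ unipotentFrom F n K.val
  · rw [columnFun, columnFun, if_pos (hmem.2 hg), if_pos hg, htr]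
  · rw [columnFun, columnFun, if_neg (mt hmem.1 hg), if_neg hg]

open Classical in
/-- Pairings of a class function with `columnFun` do not depend on the (nonzero) vector. -/
theorem sum_columnFun_mul_eq_single {θ : GL (Fin n) F → ℂ} (hθ : ∀ h g, θ (h * g * h⁻¹) = θ g)
    {K i : Fin n} (hi : i < K) {b : Fin n → F} (hb : ∀ j, K ≤ j → b j = 0) (hbi : b i ≠ 0) :
    ∑ g, columnFun ψ K b g * θ g = ∑ g, columnFun ψ K (Pi.single i 1) g * θ g := by
  have hdet : ((1 : Matrix (Fin n) (Fin n) F).updateRow i b).det = b i := by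
    rw [← Matrix.cramer_transpose_apply, Matrix.transpose_one, Matrix.cramer_one]
    rfl
  let h : GL (Fin n) F := GeneralLinearGroup.mkOfDetNeZero _ (hdet.trans_ne hbi)
  have hv : h.val = (1 : Matrix (Fin n) (Fin n) F).updateRow i b := rfl
  have hh : IsCornerMatrix K.val h.val := by
    intro r c hrc
    rw [hv, Matrix.updateRow_apply]
    split_ifs with hr
    · rw [hb c (by omega), one_apply_ne (by omega)]
    · rfl
  have hrow : Pi.single i 1 ᵥ* h.val = b := by
    rw [single_one_vecMul, hv]
    ext j
    rw [row_apply, Matrix.updateRow_self]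
  refine Fintype.sum_equiv (MulAut.conj h).toEquiv _ _ fun g => ?_
  change _ = columnFun ψ K (Pi.single i 1) (h * g * h⁻¹) * θ (h * g * h⁻¹)
  rw [columnFun_conj hh, hrow, hθ]

variable {V : Type*} [AddCommGroup V] [Module ℂ V] {ρ : Representation ℂ (GL (Fin n) F) V}

open Classical in
theorem IsCuspidal.sum_columnFun_zero_smul (hρ : IsCuspidal ρ) {K : Fin n} (hK : 0 < K.val) :
    ∑ g, columnFun ψ K 0 g • ρ g = 0 := by
  ext v
  rw [LinearMap.zero_apply]
  refine hρ.2 K.val hK K.2 _ fun u hu => ?_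
  have huU : u ∈ unipotentFrom F n K.val := by
    intro i j hij
    by_cases h : i = j
    · rw [← h, hu.1 i, one_apply_eq]
    · rw [hu.2 i j h (by omega), one_apply_ne h]
  have hdual : columnDual K 0 * u.val = columnDual K 0 := by
    rw [columnDual, vecMulVec_zero, zero_add]
    refine superdiagonalDual_mul_eq_self fun i j hi => ?_
    by_cases h : i = j
    · rw [← h, hu.1 i, one_apply_eq]
    · rw [hu.2 i j h (by omega), one_apply_ne h]
  rw [LinearMap.sum_apply, map_sum]
  refine Fintype.sum_equiv (Equiv.mulLeft u) _ _ fun g => ?_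
  have : columnFun ψ K 0 (u * g) = columnFun ψ K 0 g := by
    rw [columnFun, columnFun, Units.val_mul, ← Matrix.mul_assoc, hdual,
      Subgroup.mul_mem_cancel_left _ huU]
  rw [Equiv.coe_mulLeft, LinearMap.smul_apply, LinearMap.smul_apply, this, map_smul, map_mul,
    Module.End.mul_apply]

open Classical in
variable (ψ) in
/-- The trace of the (unnormalised) projection onto the isotypic part of the nondegenerate character
of `unipotentFrom F n k`. -/
noncomputable def whittakerTrace (ρ : Representation ℂ (GL (Fin n) F) V) (k : ℕ) : ℂ :=
  ∑ g, whittakerFun ψ k g * LinearMap.trace ℂ V (ρ g)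

theorem IsCuspidal.whittakerTrace_succ (hρ : IsCuspidal ρ) (hψ : ψ ≠ 0) {k : ℕ} (hk : 0 < k)
    (hkn : k < n) :
    (Fintype.card F : ℂ) ^ k * whittakerTrace ψ ρ (k + 1) =
      ((Fintype.card F : ℂ) ^ k - 1) * whittakerTrace ψ ρ k := by
  classical
  obtain ⟨K, rfl⟩ : ∃ K : Fin n, K.val = k := ⟨⟨k, hkn⟩, rfl⟩
  obtain ⟨K', hK'⟩ : ∃ K' : Fin n, K'.val + 1 = K.val := ⟨⟨K.val - 1, by omega⟩, by simp; omega⟩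
  have hθ : ∀ h g : GL (Fin n) F, LinearMap.trace ℂ V (ρ (h * g * h⁻¹)) =
      LinearMap.trace ℂ V (ρ g) := by
    intro h g
    rw [map_mul, LinearMap.trace_mul_comm, ← map_mul, ← mul_assoc, inv_mul_cancel, one_mul]
  have hsingle : ∀ i : Fin n, i < K →
      ∑ g, columnFun ψ K (Pi.single i 1) g * LinearMap.trace ℂ V (ρ g) =
        whittakerTrace ψ ρ K.val := by
    intro i hi
    rw [whittakerTrace, ← columnFun_single ψ hK']
    by_cases h : i = K'
    · rw [h]
    have hb : ∀ j, K ≤ j → (Pi.single i 1 + Pi.single K' 1 : Fin n → F) j = 0 := by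
      intro j hj
      rw [Pi.add_apply, Pi.single_eq_of_ne (by omega), Pi.single_eq_of_ne (by omega), add_zero]
    rw [← sum_columnFun_mul_eq_single hθ hi hb (by simp [Pi.single_eq_of_ne h]),
      ← sum_columnFun_mul_eq_single hθ (i := K') (by omega) hb
        (by simp [Pi.single_eq_of_ne (Ne.symm h)])]
  have hne : ∀ a : Fin K.val → F, a ≠ 0 →
      ∑ g, columnFun ψ K (extendZero K a) g * LinearMap.trace ℂ V (ρ g) =
        whittakerTrace ψ ρ K.val := by
    intro a ha
    obtain ⟨i, hi⟩ := Function.ne_iff.1 ha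
    have hi' : extendZero K a ⟨i.val, by omega⟩ = a i := dif_pos i.2
    rw [sum_columnFun_mul_eq_single hθ (i := ⟨i.val, by omega⟩) (Fin.lt_def.2 i.2)
      (fun j hj => dif_neg (by omega)) (by rw [hi']; exact hi)]
    exact hsingle _ (Fin.lt_def.2 i.2)
  have hzero : ∑ g, columnFun ψ K (extendZero K 0) g * LinearMap.trace ℂ V (ρ g) = 0 := by
    have := congrArg (LinearMap.trace ℂ V) (hρ.sum_columnFun_zero_smul (ψ := ψ) hk)
    simpa only [map_zero, map_sum, map_smul, smul_eq_mul] using this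
  calc (Fintype.card F : ℂ) ^ K.val * whittakerTrace ψ ρ (K.val + 1)
      = ∑ a : Fin K.val → F, ∑ g, columnFun ψ K (extendZero K a) g *
          LinearMap.trace ℂ V (ρ g) := by
        rw [Finset.sum_comm, whittakerTrace, Finset.mul_sum]
        refine Finset.sum_congr rfl fun g _ => ?_
        rw [← Finset.sum_mul, sum_columnFun hψ, mul_assoc]
    _ = ∑ a ∈ (Finset.univ : Finset (Fin K.val → F)).erase 0, whittakerTrace ψ ρ K.val := by
        rw [← Finset.add_sum_erase _ _ (Finset.mem_univ 0), hzero, zero_add]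
        exact Finset.sum_congr rfl fun a ha => hne a (Finset.ne_of_mem_erase ha)
    _ = _ := by
        rw [Finset.sum_const, Finset.card_erase_of_mem (Finset.mem_univ 0), Finset.card_univ,
          Fintype.card_fun, Fintype.card_fin, nsmul_eq_mul,
          Nat.cast_sub (Nat.one_le_pow _ _ Fintype.card_pos), Nat.cast_pow, Nat.cast_one]

theorem IsCuspidal.prod_mul_whittakerTrace (hρ : IsCuspidal ρ) (hψ : ψ ≠ 0) (m : ℕ) (hm : m < n) :
    (∏ k ∈ Finset.Icc 1 m, (Fintype.card F : ℂ) ^ k) * whittakerTrace ψ ρ (m + 1) =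
      (∏ k ∈ Finset.Icc 1 m, ((Fintype.card F : ℂ) ^ k - 1)) * whittakerTrace ψ ρ 1 := by
  induction m with
  | zero => simp
  | succ m ih =>
    rw [Finset.prod_Icc_succ_top (by omega), Finset.prod_Icc_succ_top (by omega), mul_assoc,
      hρ.whittakerTrace_succ hψ (by omega) hm, mul_left_comm, ih (by omega)]
    ring

theorem whittakerTrace_one (ρ : Representation ℂ (GL (Fin n) F) V) :
    whittakerTrace ψ ρ 1 = LinearMap.trace ℂ V (ρ.asAlgebraHom (whittakerElement n ψ)) := by
  classical
  rw [whittakerElement, map_sum, map_sum, whittakerTrace]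
  refine Finset.sum_congr rfl fun g _ => ?_
  rw [map_smul, map_smul, Representation.asAlgebraHom_of, smul_eq_mul]

theorem whittakerTrace_self [FiniteDimensional ℂ V] (ρ : Representation ℂ (GL (Fin n) F) V) :
    whittakerTrace ψ ρ n = Module.finrank ℂ V := by
  classical
  have hS : superdiagonalDual F n n = 0 := by
    ext i j
    rw [superdiagonalDual, Matrix.of_apply, if_neg (by omega), Matrix.zero_apply]
  have hmem : ∀ g : GL (Fin n) F, g ∈ unipotentFrom F n n ↔ g = 1 := by
    intro g
    refine ⟨fun h => Units.ext ?_, fun h => h ▸ one_mem _⟩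
    ext i j
    exact h i j (by omega)
  rw [whittakerTrace, Finset.sum_eq_single 1]
  · rw [whittakerFun, if_pos (one_mem _), hS, Matrix.zero_mul, Matrix.trace_zero, neg_zero,
      AddChar.map_zero_eq_one, one_mul, map_one, LinearMap.trace_one]
  · intro g _ hg
    rw [whittakerFun, if_neg (mt (hmem g).1 hg), zero_mul]
  · simp

end Derivative

/-- Let `𝔽` be a finite field with `q` elements and `n ≥ 1`. Every cuspidal
representation of `GL_n(𝔽)` has dimension `∏_{i=1}^{n-1} (q ^ i - 1)`. -/
theorem dim_cuspidal_GL (𝔽 : Type*) [Field 𝔽] [Fintype 𝔽] (q n : ℕ)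
    (hq : Fintype.card 𝔽 = q) (hn : 1 ≤ n) (V : Type*) [AddCommGroup V] [Module ℂ V]
    [FiniteDimensional ℂ V] (ρ : Representation ℂ (GL (Fin n) 𝔽) V)
    (hρ : IsCuspidal ρ) :
    Module.finrank ℂ V = ∏ i ∈ Finset.Icc 1 (n - 1), (q ^ i - 1) := by
  obtain ⟨ψ, hψ⟩ : ∃ ψ : AddChar 𝔽 ℂ, ψ ≠ 0 := by
    obtain ⟨ψ, hψ⟩ := AddChar.exists_apply_ne_zero.2 (one_ne_zero (α := 𝔽))
    exact ⟨ψ, AddChar.ne_zero_iff.2 ⟨1, hψ⟩⟩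
  subst hq
  have hq1 : ∀ k, 1 ≤ Fintype.card 𝔽 ^ k := fun k => Nat.one_le_pow _ _ Fintype.card_pos
  have h1 := hρ.prod_mul_whittakerTrace hψ (n - 1) (by omega)
  have hcard : Nat.card (unipotentFrom 𝔽 n 1) =
      ∏ k ∈ Finset.Icc 1 (n - 1), Fintype.card 𝔽 ^ k := by
    rw [card_unipotentFrom_one Nat.card_eq_fintype_card, Finset.range_eq_Ico,
      Finset.prod_eq_prod_Ico_succ_bot (by omega), pow_zero, one_mul]
    refine Finset.prod_congr ?_ fun _ _ => rfl
    ext k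
    simp only [Finset.mem_Ico, Finset.mem_Icc]
    omega
  rw [Nat.sub_add_cancel hn, whittakerTrace_self, whittakerTrace_one,
    trace_asAlgebraHom_whittakerElement, hcard] at h1
  have hle := finrank_range_whittakerElement_le_one hψ hρ.1
  obtain ⟨r, hr⟩ : ∃ r, r = Module.finrank ℂ
      (LinearMap.range (ρ.asAlgebraHom (whittakerElement n ψ))) := ⟨_, rfl⟩
  rw [← hr] at h1 hle
  have hP : 0 < ∏ k ∈ Finset.Icc 1 (n - 1), Fintype.card 𝔽 ^ k :=
    Finset.prod_pos fun k _ => hq1 k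
  have h2 : (∏ k ∈ Finset.Icc 1 (n - 1), Fintype.card 𝔽 ^ k) * Module.finrank ℂ V =
      (∏ k ∈ Finset.Icc 1 (n - 1), Fintype.card 𝔽 ^ k) *
        ((∏ k ∈ Finset.Icc 1 (n - 1), (Fintype.card 𝔽 ^ k - 1)) * r) := by
    have hcast : ((∏ k ∈ Finset.Icc 1 (n - 1), (Fintype.card 𝔽 ^ k - 1) : ℕ) : ℂ) =
        ∏ k ∈ Finset.Icc 1 (n - 1), ((Fintype.card 𝔽 : ℂ) ^ k - 1) := by
      rw [Nat.cast_prod]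
      refine Finset.prod_congr rfl fun k _ => ?_
      rw [Nat.cast_sub (hq1 k), Nat.cast_pow, Nat.cast_one]
    rw [← Nat.cast_inj (R := ℂ), Nat.cast_mul, Nat.cast_mul, Nat.cast_mul, hcast]
    push_cast at h1 ⊢
    rw [h1]
    ring
  have h3 := Nat.eq_of_mul_eq_mul_left hP h2
  have hV : Module.finrank ℂ V ≠ 0 := by
    intro h0
    have := Module.finrank_zero_iff.1 h0
    exact hρ.1.1 (Subsingleton.elim _ _)
  have hr1 : r = 1 := by
    have : r ≠ 0 := by
      rintro rfl
      exact hV (by rw [h3, mul_zero])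
    omega
  rw [h3, hr1, mul_one]
end

section
/- Let 𝔽 be a finite field and n ≥ 1. The number of conjugacy classes of GL_n(𝔽) consisting of unipotent elements (i.e. elements g with (g − 1)^n = 0) equals the number of partitions of n. -/
open Polynomial

/-- The `F[X]`-module `∏ i, F[X] / (X ^ k i)`, on which `X` acts nilpotently with Jordan blocks of
sizes `k i`. -/
abbrev NilpotentModel (F : Type*) [Field F] {ι : Type*} (k : ι → ℕ) : Type _ :=
  (i : ι) → F[X] ⧸ Ideal.span {(X : F[X]) ^ k i}

/-- An endomorphism has Jordan type `s` if it is conjugate to multiplication by `X` on a product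
of modules `F[X] / (X ^ a)`, where `a` runs over `s`. -/
def HasJordanType {F V : Type*} [Field F] [AddCommGroup V] [Module F V] (f : Module.End F V)
    (s : Multiset ℕ) : Prop :=
  ∃ (d : ℕ) (k : Fin d → ℕ), Finset.univ.val.map k = s ∧
    ∃ e : V ≃ₗ[F] NilpotentModel F k, ∀ v, e (f v) = (X : F[X]) • e v

section

variable {F V W : Type*} [Field F] [AddCommGroup V] [Module F V] [AddCommGroup W] [Module F W]

theorem finrank_quotient_span_X_pow (k : ℕ) :
    Module.finrank F (F[X] ⧸ Ideal.span {(X : F[X]) ^ k}) = k := by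
  rw [finrank_quotient_span_eq_natDegree, natDegree_X_pow]

instance finite_quotient_span_X_pow (k : ℕ) :
    Module.Finite F (F[X] ⧸ Ideal.span {(X : F[X]) ^ k}) :=
  (monic_X_pow k).finite_quotient

theorem finrank_nilpotentModel {d : ℕ} (k : Fin d → ℕ) :
    Module.finrank F (NilpotentModel F k) = (Finset.univ.val.map k).sum := by
  rw [Module.finrank_pi_fintype]
  simp_rw [finrank_quotient_span_X_pow]
  rfl

/-- Multiplication by `X ^ j`, as an `F`-linear map. -/
noncomputable def mulXPow (F : Type*) [Field F] (M : Type*) [AddCommGroup M] [Module F M]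
    [Module F[X] M] [IsScalarTower F F[X] M] (j : ℕ) : M →ₗ[F] M :=
  (LinearMap.lsmul F[X] M (X ^ j)).restrictScalars F

theorem finrank_ker_mulXPow_quotient (k j : ℕ) :
    Module.finrank F (LinearMap.ker (mulXPow F (F[X] ⧸ Ideal.span {(X : F[X]) ^ k}) j)) =
      min k j := by
  have hle : Ideal.span {(X : F[X]) ^ k} ≤ Ideal.span {X ^ (k - j)} :=
    Ideal.span_singleton_le_span_singleton.2 (pow_dvd_pow _ (Nat.sub_le _ _))
  let φ : (F[X] ⧸ Ideal.span {(X : F[X]) ^ k}) →ₗ[F] (F[X] ⧸ Ideal.span {(X : F[X]) ^ (k - j)}) :=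
    (Ideal.Quotient.factorₐ F hle).toLinearMap
  have hφ : Function.Surjective φ := Ideal.Quotient.factor_surjective hle
  have hker : LinearMap.ker (mulXPow F (F[X] ⧸ Ideal.span {(X : F[X]) ^ k}) j) =
      LinearMap.ker φ := by
    ext x
    obtain ⟨f, rfl⟩ := Ideal.Quotient.mk_surjective x
    have h1 : mulXPow F (F[X] ⧸ Ideal.span {(X : F[X]) ^ k}) j (Ideal.Quotient.mk _ f) =
      Ideal.Quotient.mk _ (X ^ j * f) := rfl
    have h2 : φ (Ideal.Quotient.mk _ f) = Ideal.Quotient.mk _ f := rfl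
    rw [LinearMap.mem_ker, LinearMap.mem_ker, h1, h2, Ideal.Quotient.eq_zero_iff_dvd,
      Ideal.Quotient.eq_zero_iff_dvd, X_pow_dvd_iff, X_pow_dvd_iff]
    simp only [coeff_X_pow_mul']
    constructor
    · intro h a ha
      simpa using h (a + j) (by omega)
    · intro h a ha
      split_ifs with hj
      · exact h _ (by omega)
      · rfl
  have := LinearMap.finrank_range_add_finrank_ker φ
  rw [LinearMap.range_eq_top.2 hφ, finrank_top, finrank_quotient_span_X_pow,
    finrank_quotient_span_X_pow] at this
  rw [hker]
  omega

theorem finrank_ker_mulXPow_nilpotentModel {d : ℕ} (k : Fin d → ℕ) (j : ℕ) :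
    Module.finrank F (LinearMap.ker (mulXPow F (NilpotentModel F k) j)) =
      ((Finset.univ.val.map k).map (min · j)).sum := by
  have e : LinearMap.ker (mulXPow F (NilpotentModel F k) j) ≃ₗ[F]
      ((i : Fin d) → LinearMap.ker (mulXPow F (F[X] ⧸ Ideal.span {(X : F[X]) ^ k i}) j)) :=
    { toFun := fun x i => ⟨x.1 i, congrFun x.2 i⟩
      invFun := fun y => ⟨fun i => (y i).1, funext fun i => (y i).2⟩
      map_add' := fun _ _ => rfl
      map_smul' := fun _ _ => rfl
      left_inv := fun _ => rfl
      right_inv := fun _ => rfl }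
  rw [e.finrank_eq, Module.finrank_pi_fintype]
  simp_rw [finrank_ker_mulXPow_quotient]
  rw [Multiset.map_map]
  rfl

theorem map_pow_of_semiconj {ι : Type*} {k : ι → ℕ} {f : Module.End F V}
    {e : V ≃ₗ[F] NilpotentModel F k} (he : ∀ v, e (f v) = (X : F[X]) • e v) (j : ℕ) (v : V) :
    e ((f ^ j) v) = mulXPow F (NilpotentModel F k) j (e v) := by
  change _ = (X ^ j : F[X]) • e v
  induction j with
  | zero => simp
  | succ j ih => rw [pow_succ', Module.End.mul_apply, he, ih, smul_smul, pow_succ']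

theorem exists_perm_of_map_univ_eq {ι α : Type*} [Fintype ι] {k k' : ι → α}
    (h : Finset.univ.val.map k = Finset.univ.val.map k') : ∃ σ : Equiv.Perm ι, k = k' ∘ σ := by
  classical
  have hcard (a : α) : Fintype.card {i // k i = a} = Fintype.card {i // k' i = a} := by
    have := congrArg (Multiset.count a) h
    rw [Multiset.count_map, Multiset.count_map] at this
    rw [Fintype.card_subtype, Fintype.card_subtype]
    simpa only [eq_comm] using! this
  refine ⟨Equiv.ofFiberEquiv fun a => Fintype.equivOfCardEq (hcard a), funext fun i => ?_⟩
  exact (Equiv.ofFiberEquiv_map _ i).symm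

namespace HasJordanType

variable {f : Module.End F V} {g : Module.End F W} {s t : Multiset ℕ}

theorem finrank_eq (h : HasJordanType f s) : Module.finrank F V = s.sum := by
  obtain ⟨d, k, rfl, e, -⟩ := h
  rw [e.finrank_eq, finrank_nilpotentModel]

theorem finrank_ker_pow (h : HasJordanType f s) (j : ℕ) :
    Module.finrank F (LinearMap.ker (f ^ j)) = (s.map (min · j)).sum := by
  obtain ⟨d, k, rfl, e, he⟩ := h
  rw [← finrank_ker_mulXPow_nilpotentModel (F := F)]
  refine (e.submoduleMap _).finrank_eq.trans ?_
  congr 2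
  all_goals
    ext x
    obtain ⟨v, rfl⟩ := e.surjective x
    simp [← map_pow_of_semiconj he]

theorem congr (h : HasJordanType f s) (e : W ≃ₗ[F] V) (he : ∀ w, e (g w) = f (e w)) :
    HasJordanType g s := by
  obtain ⟨d, k, hk, e', he'⟩ := h
  exact ⟨d, k, hk, e.trans e', fun w => by simp [he, he']⟩

theorem exists_semiconj (hf : HasJordanType f s) (hg : HasJordanType g s) :
    ∃ e : V ≃ₗ[F] W, ∀ v, e (f v) = g (e v) := by
  obtain ⟨d, k, hk, e, he⟩ := hf
  obtain ⟨d', k', hk', e', he'⟩ := hg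
  obtain rfl : d = d' := by
    simpa using congrArg Multiset.card (hk.trans hk'.symm)
  obtain ⟨σ, rfl⟩ := exists_perm_of_map_univ_eq (hk.trans hk'.symm)
  let c : NilpotentModel F (k' ∘ σ) ≃ₗ[F[X]] NilpotentModel F k' :=
    LinearEquiv.piCongrLeft F[X] (fun i => F[X] ⧸ Ideal.span {(X : F[X]) ^ k' i}) σ
  refine ⟨(e.trans (c.restrictScalars F)).trans e'.symm, fun v => e'.injective ?_⟩
  simp [he, he']

theorem pow_eq_zero (h : HasJordanType f s) {n : ℕ} (hs : ∀ a ∈ s, a ≤ n) : f ^ n = 0 := by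
  obtain ⟨d, k, rfl, e, he⟩ := h
  ext v
  apply e.injective
  rw [map_pow_of_semiconj he]
  generalize e v = y
  ext i
  obtain ⟨p, hp⟩ := Ideal.Quotient.mk_surjective (y i)
  have : mulXPow F (NilpotentModel F k) n y i =
    Ideal.Quotient.mk (Ideal.span {(X : F[X]) ^ k i}) (X ^ n * p) := by
      change (X ^ n : F[X]) • y i = _
      rw [← hp]; rfl
  rw [this]
  simp only [LinearMap.zero_apply, map_zero, Pi.zero_apply]
  rw [Ideal.Quotient.eq_zero_iff_dvd]
  exact (pow_dvd_pow _ (hs _ (by simp))).mul_right _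

end HasJordanType

theorem count_add_sum_map_min (s : Multiset ℕ) (a : ℕ) :
    s.count (a + 1) + (s.map (min · (a + 2))).sum + (s.map (min · a)).sum =
      2 * (s.map (min · (a + 1))).sum := by
  induction s using Multiset.induction_on with
  | empty => simp
  | cons b s ih =>
    simp only [Multiset.count_cons, Multiset.map_cons, Multiset.sum_cons]
    split_ifs <;> omega

theorem multiset_eq_of_sum_map_min_eq {s t : Multiset ℕ} (hs : 0 ∉ s) (ht : 0 ∉ t)
    (h : ∀ j, (s.map (min · j)).sum = (t.map (min · j)).sum) : s = t := by
  ext a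
  cases a with
  | zero => rw [Multiset.count_eq_zero_of_notMem hs, Multiset.count_eq_zero_of_notMem ht]
  | succ a =>
    have h1 := count_add_sum_map_min s a
    have h2 := count_add_sum_map_min t a
    rw [h, h, h] at h1
    omega

theorem HasJordanType.unique {f : Module.End F V} {s t : Multiset ℕ} (h : HasJordanType f s)
    (h' : HasJordanType f t) (hs : 0 ∉ s) (ht : 0 ∉ t) : s = t :=
  multiset_eq_of_sum_map_min_eq hs ht fun j => by rw [← h.finrank_ker_pow, h'.finrank_ker_pow]

/-- Blocks of size zero may be dropped from a Jordan type. -/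
theorem exists_hasJordanType_of_nilpotentModel {ι : Type*} [Fintype ι] {f : Module.End F V}
    (k : ι → ℕ) (e : V ≃ₗ[F] NilpotentModel F k) (he : ∀ v, e (f v) = (X : F[X]) • e v) :
    ∃ s : Multiset ℕ, 0 ∉ s ∧ HasJordanType f s := by
  classical
  let σ := (Fintype.equivFin {i // k i ≠ 0}).symm
  let k' : Fin (Fintype.card {i // k i ≠ 0}) → ℕ := fun i => k (σ i).1
  have hsub : ∀ i, k i = 0 → ∀ x : F[X] ⧸ Ideal.span {(X : F[X]) ^ k i}, x = 0 := by
    intro i hi x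
    obtain ⟨p, rfl⟩ := Ideal.Quotient.mk_surjective x
    rw [Ideal.Quotient.eq_zero_iff_dvd, hi, pow_zero]
    exact one_dvd _
  let c : NilpotentModel F k →ₗ[F[X]] NilpotentModel F k' :=
    LinearMap.pi fun i => LinearMap.proj (σ i).1
  have hc : Function.Bijective c := by
    constructor
    · intro x y hxy
      ext i
      by_cases hi : k i = 0
      · rw [hsub i hi (x i), hsub i hi (y i)]
      · obtain ⟨j, hj⟩ := σ.surjective ⟨i, hi⟩
        obtain rfl : (σ j).1 = i := congrArg Subtype.val hj
        exact congrFun hxy j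
    · intro y
      refine ⟨fun i => if hi : k i = 0 then 0 else
        (LinearEquiv.piCongrLeft F[X] (fun i : {i // k i ≠ 0} =>
          F[X] ⧸ Ideal.span {(X : F[X]) ^ k i}) σ y) ⟨i, hi⟩, ?_⟩
      ext i
      have hi : k (σ i) ≠ 0 := (σ i).2
      simp only [c, LinearMap.pi_apply, LinearMap.proj_apply, dif_neg hi]
      exact Equiv.piCongrLeft_apply_apply (fun i : {i // k i ≠ 0} =>
          F[X] ⧸ Ideal.span {(X : F[X]) ^ k i}) σ y i
  refine ⟨Finset.univ.val.map k', ?_, _, k', rfl,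
    e.trans ((LinearEquiv.ofBijective c hc).restrictScalars F), fun v => ?_⟩
  · simp only [Multiset.mem_map, not_exists, not_and]
    exact fun i _ => (σ i).2
  · simp [he]

theorem exists_hasJordanType [Module.Finite F V] {f : Module.End F V} (hf : IsNilpotent f) :
    ∃ s : Multiset ℕ, 0 ∉ s ∧ HasJordanType f s := by
  obtain ⟨n, hn⟩ := hf
  have htors : Module.IsTorsion' (Module.AEval' f) (Submonoid.powers (X : F[X])) := by
    intro x
    obtain ⟨v, rfl⟩ := (Module.AEval'.of f).surjective x
    refine ⟨⟨X ^ n, n, rfl⟩, ?_⟩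
    change (X ^ n : F[X]) • Module.AEval'.of f v = 0
    rw [Module.AEval'.X_pow_smul_of, hn]
    simp
  obtain ⟨d, k, ⟨e⟩⟩ := Module.torsion_by_prime_power_decomposition irreducible_X htors
  let e' : Module.AEval' f ≃ₗ[F[X]] NilpotentModel F k :=
    e.trans (DirectSum.linearEquivFunOnFintype F[X] (Fin d) _)
  refine exists_hasJordanType_of_nilpotentModel k ((Module.AEval'.of f).trans (e'.restrictScalars F)) ?_
  intro v
  change e' (Module.AEval'.of f (f v)) = (X : F[X]) • e' (Module.AEval'.of f v)
  rw [← map_smul, Module.AEval'.X_smul_of]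

theorem exists_end_hasJordanType [Module.Finite F V] (s : Multiset ℕ)
    (hs : Module.finrank F V = s.sum) : ∃ f : Module.End F V, HasJordanType f s := by
  obtain ⟨l, rfl⟩ := Quot.exists_rep s
  have hk : Finset.univ.val.map l.get = (l : Multiset ℕ) := by
    simp
  let e : V ≃ₗ[F] NilpotentModel F l.get := LinearEquiv.ofFinrankEq _ _ (by
    rw [finrank_nilpotentModel, hk]; exact hs)
  refine ⟨e.symm.conj (mulXPow F _ 1), _, l.get, hk, e, fun v => ?_⟩
  simp [LinearEquiv.conj_apply, mulXPow]

theorem isConj_iff_exists_semiconj {n : ℕ} (g h : Matrix.GeneralLinearGroup (Fin n) F) :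
    IsConj g h ↔ ∃ e : (Fin n → F) ≃ₗ[F] (Fin n → F),
      ∀ v, e (Matrix.toLin' (g - 1 : Matrix (Fin n) (Fin n) F) v) =
        Matrix.toLin' (h - 1 : Matrix (Fin n) (Fin n) F) (e v) := by
  have key (e : (Fin n → F) ≃ₗ[F] (Fin n → F)) :
      (∀ v, e (Matrix.toLin' (g - 1 : Matrix (Fin n) (Fin n) F) v) =
        Matrix.toLin' (h - 1 : Matrix (Fin n) (Fin n) F) (e v)) ↔
      SemiconjBy (LinearMap.GeneralLinearGroup.ofLinearEquiv e)
        (Matrix.GeneralLinearGroup.toLin g) (Matrix.GeneralLinearGroup.toLin h) := by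
    rw [SemiconjBy, Units.ext_iff, LinearMap.ext_iff]
    refine forall_congr' fun v => ?_
    simp [Matrix.GeneralLinearGroup.coe_toLin]
  simp_rw [key]
  constructor
  · intro hc
    obtain ⟨u, hu⟩ := isConj_iff.1 (Matrix.GeneralLinearGroup.toLin.toMonoidHom.map_isConj hc)
    exact ⟨u.toLinearEquiv, mul_inv_eq_iff_eq_mul.1 hu⟩
  · rintro ⟨e, he⟩
    have hc : IsConj (Matrix.GeneralLinearGroup.toLin g) (Matrix.GeneralLinearGroup.toLin h) :=
      isConj_iff.2 ⟨_, mul_inv_eq_iff_eq_mul.2 he⟩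
    simpa using Matrix.GeneralLinearGroup.toLin.symm.toMonoidHom.map_isConj hc

theorem Matrix.GeneralLinearGroup.exists_hasJordanType {n : ℕ} (p : n.Partition) :
    ∃ g : Matrix.GeneralLinearGroup (Fin n) F,
      HasJordanType (Matrix.toLin' (g - 1 : Matrix (Fin n) (Fin n) F)) p.parts := by
  obtain ⟨f, hf⟩ := exists_end_hasJordanType (F := F) (V := Fin n → F) p.parts
    (by rw [p.parts_sum]; simp)
  have hnil : IsNilpotent (LinearMap.toMatrix' f) :=
    IsNilpotent.map ⟨n, hf.pow_eq_zero fun a ha => p.le_of_mem_parts ha⟩ LinearMap.toMatrixAlgEquiv'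
  refine ⟨hnil.isUnit_one_add.unit, ?_⟩
  simpa using hf

end

/-- Let `𝔽` be a finite field and `n ≥ 1`. The number of conjugacy classes of `GL_n(𝔽)`
consisting of unipotent elements (elements `g` with `(g - 1) ^ n = 0`) equals the number
of partitions of `n`. -/
theorem card_unipotent_conjClasses (𝔽 : Type*) [Field 𝔽] [Fintype 𝔽] (n : ℕ) (hn : 1 ≤ n) :
    Nat.card {c : ConjClasses (Matrix.GeneralLinearGroup (Fin n) 𝔽) //
        ∀ g ∈ c.carrier, ((g : Matrix (Fin n) (Fin n) 𝔽) - 1) ^ n = 0} =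
      Nat.card (Nat.Partition n) := by
  have h0 (p : n.Partition) : 0 ∉ p.parts := fun h => (p.parts_pos h).ne rfl
  choose g hg using Matrix.GeneralLinearGroup.exists_hasJordanType (F := 𝔽) (n := n)
  have htype {p : n.Partition} {h : Matrix.GeneralLinearGroup (Fin n) 𝔽} (hc : IsConj h (g p)) :
      HasJordanType (Matrix.toLin' (h - 1 : Matrix (Fin n) (Fin n) 𝔽)) p.parts := by
    obtain ⟨e, he⟩ := (isConj_iff_exists_semiconj _ _).1 hc
    exact (hg p).congr e he
  symm
  refine Nat.card_congr (Equiv.ofBijective (fun p => ⟨ConjClasses.mk (g p), ?_⟩) ⟨?_, ?_⟩)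
  · intro h hh
    rw [ConjClasses.mem_carrier_iff_mk_eq, ConjClasses.mk_eq_mk_iff_isConj] at hh
    apply Matrix.toLin'.injective
    rw [Matrix.toLin'_pow, (htype hh).pow_eq_zero fun a ha => p.le_of_mem_parts ha, map_zero]
  · intro p q hpq
    have hc : IsConj (g p) (g q) := ConjClasses.mk_eq_mk_iff_isConj.1 (congrArg Subtype.val hpq)
    exact Nat.Partition.ext ((hg p).unique (htype hc) (h0 p) (h0 q))
  · rintro ⟨c, hc⟩
    obtain ⟨h, rfl⟩ := ConjClasses.mk_surjective c
    have hnil := hc h ConjClasses.mem_carrier_mk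
    obtain ⟨s, hs0, hs⟩ := exists_hasJordanType
      (f := Matrix.toLin' (h - 1 : Matrix (Fin n) (Fin n) 𝔽))
      ⟨n, by rw [← Matrix.toLin'_pow, hnil, map_zero]⟩
    let p : n.Partition :=
      ⟨s, fun {i} hi => Nat.pos_of_ne_zero fun h => hs0 (h ▸ hi), by simpa using hs.finrank_eq.symm⟩
    refine ⟨p, Subtype.ext (ConjClasses.mk_eq_mk_iff_isConj.2 ?_)⟩
    exact (isConj_iff_exists_semiconj _ _).2 ((hg p).exists_semiconj hs)
end
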